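/- arXiv:1205.0669 — 5 statements merged into one kernel-verified Lean document; each statement's English description precedes it below -/
import Mathlib

section
/- In the setup below, the zero weight space L₀ contains a nonzero element y such that the adjoint operator ad(y): L(𝔤,σ) → L(𝔤,σ) is k-diagonalizable. -/
open LaurentPolynomial TensorProduct

noncomputable section

section Graded

variable {k 𝔤 A : Type*} [Field k] [LieRing 𝔤] [LieAlgebra k 𝔤] [AddCommGroup A]
  {G : A → Submodule k 𝔤} {p : A → 𝔤 →ₗ[k] 𝔤}

/-- The inductive step of Kreknin's theorem, for a perfect graded Lie algebra: a homogeneous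
component of minimal level can be removed from a set of components generating the algebra. -/
theorem lieSpan_erase_eq_top [DecidableEq A]
    (hp : ∀ a, ∀ x ∈ G a, p a x = x) (hp' : ∀ a b, a ≠ b → ∀ x ∈ G b, p a x = 0)
    (hG : ⨆ a, G a = ⊤) (hbr : ∀ a b, ∀ x ∈ G a, ∀ y ∈ G b, ⁅x, y⁆ ∈ G (a + b))
    (hperf : Submodule.span k {z : 𝔤 | ∃ x y : 𝔤, ⁅x, y⁆ = z} = ⊤)
    {T : Finset A} {a : A} (ha : a ∈ T)
    (hstep : ∀ s ∈ T, G (a - s) ≠ ⊥ → s ≠ a ∧ a - s ∈ T.erase a)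
    (hT : LieSubalgebra.lieSpan k 𝔤 (⋃ b ∈ T, (G b : Set 𝔤)) = ⊤) :
    LieSubalgebra.lieSpan k 𝔤 (⋃ b ∈ T.erase a, (G b : Set 𝔤)) = ⊤ := by
  set Q := LieSubalgebra.lieSpan k 𝔤 (⋃ b ∈ T.erase a, (G b : Set 𝔤)) with hQ
  have hmemQ : ∀ b ∈ T.erase a, ∀ x ∈ G b, x ∈ Q := fun b hb x hx ↦
    LieSubalgebra.subset_lieSpan (Set.mem_biUnion hb hx)
  let N : Submodule k 𝔤 := Submodule.span k {z | ∃ s ∈ T, ∃ y ∈ G s, ∃ x : 𝔤, ⁅x, y⁆ = z}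
  have hN : ∀ y : 𝔤, ∀ x : 𝔤, ⁅x, y⁆ ∈ N := by
    intro y
    have hy : y ∈ LieSubalgebra.lieSpan k 𝔤 (⋃ b ∈ T, (G b : Set 𝔤)) := by simp [hT]
    induction hy using LieSubalgebra.lieSpan_induction with
    | mem y hy =>
      obtain ⟨s, hs, hys⟩ := Set.mem_iUnion₂.mp hy
      exact fun x ↦ Submodule.subset_span ⟨s, hs, y, hys, x, rfl⟩
    | zero => simp
    | add y z _ _ hy hz => intro x; rw [lie_add]; exact N.add_mem (hy x) (hz x)
    | smul c y _ hy => intro x; rw [lie_smul]; exact N.smul_mem c (hy x)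
    | lie y z _ _ hy hz =>
      intro x
      rw [leibniz_lie, ← lie_skew y]
      exact N.add_mem (hz _) (N.neg_mem (hy _))
  have hNtop : N = ⊤ := by
    rw [← top_le_iff, ← hperf, Submodule.span_le]
    rintro _ ⟨x, y, rfl⟩
    exact hN y x
  have hpQ : ∀ z : 𝔤, p a z ∈ Q := by
    intro z
    have hz : z ∈ N := hNtop ▸ Submodule.mem_top
    induction hz using Submodule.span_induction with
    | zero => simp
    | add y z _ _ hy hz => rw [map_add]; exact Q.add_mem hy hz
    | smul c y _ hy => rw [map_smul]; exact Q.smul_mem c hy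
    | mem z hz =>
      obtain ⟨s, hs, y, hy, x, rfl⟩ := hz
      have hx : x ∈ ⨆ b, G b := hG ▸ Submodule.mem_top
      induction hx using Submodule.iSup_induction' with
      | zero => simp
      | add x x' _ _ h h' => rw [add_lie, map_add]; exact Q.add_mem h h'
      | mem r x hx =>
        by_cases hrs : a = r + s
        · have hr : r = a - s := by rw [hrs, add_sub_cancel_right]
          have hxy := hbr r s x hx y hy
          rw [← hrs] at hxy
          rw [hp a _ hxy]
          by_cases hbot : G (a - s) = ⊥
          · rw [hr, hbot, Submodule.mem_bot] at hx
            simp [hx]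
          · obtain ⟨hsa, has⟩ := hstep s hs hbot
            exact Q.lie_mem (hmemQ _ (hr ▸ has) x hx)
              (hmemQ s (Finset.mem_erase.mpr ⟨hsa, hs⟩) y hy)
        · rw [hp' a _ hrs _ (hbr r s x hx y hy)]
          exact Q.zero_mem
  rw [← top_le_iff, ← hT, LieSubalgebra.lieSpan_le]
  refine Set.iUnion₂_subset fun b hb x hx ↦ ?_
  by_cases hba : b = a
  · subst hba
    rw [← hp b x hx]
    exact hpQ x
  · exact hmemQ b (Finset.mem_erase.mpr ⟨hba, hb⟩) x hx

/-- **Kreknin's theorem** for perfect Lie algebras: a perfect Lie algebra with a finite grading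
by a cyclically ordered group and trivial component of level zero is trivial. -/
theorem subsingleton_of_graded_of_perfect
    (hp : ∀ a, ∀ x ∈ G a, p a x = x) (hp' : ∀ a b, a ≠ b → ∀ x ∈ G b, p a x = 0)
    (hG : ⨆ a, G a = ⊤) (hbr : ∀ a b, ∀ x ∈ G a, ∀ y ∈ G b, ⁅x, y⁆ ∈ G (a + b))
    (hperf : Submodule.span k {z : 𝔤 | ∃ x y : 𝔤, ⁅x, y⁆ = z} = ⊤)
    (S : Finset A) (hS : ∀ a ∉ S, G a = ⊥) (ρ : A → ℝ)
    (hlt : ∀ a s, ρ a < ρ s → ρ a < ρ (a - s))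
    (heq : ∀ a s, ρ s = ρ a → G (a - s) = ⊥) :
    Subsingleton 𝔤 := by
  classical
  have key : ∀ n : ℕ, ∀ T : Finset A, T.card = n → (∀ a ∈ T, ∀ b ∈ S, ρ a < ρ b → b ∈ T) →
      LieSubalgebra.lieSpan k 𝔤 (⋃ b ∈ T, (G b : Set 𝔤)) = ⊤ →
      (⊥ : LieSubalgebra k 𝔤) = ⊤ := by
    intro n
    induction n with
    | zero =>
      intro T hT _ h
      rw [Finset.card_eq_zero] at hT
      simpa [hT] using h
    | succ n ih =>
      intro T hT hup h
      obtain ⟨a, ha, hmin⟩ := T.exists_min_image ρ (Finset.card_pos.mp (by omega))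
      refine ih (T.erase a) (by rw [Finset.card_erase_of_mem ha, hT]; rfl) ?_
        (lieSpan_erase_eq_top hp hp' hG hbr hperf ha ?_ h)
      · intro c hc b hb hcb
        have hcT := Finset.mem_of_mem_erase hc
        refine Finset.mem_erase.mpr ⟨?_, hup c hcT b hb hcb⟩
        rintro rfl
        exact absurd (hmin c hcT) (not_le.mpr hcb)
      · intro s hs hne
        have hlts : ρ a < ρ s := (hmin s hs).lt_of_ne fun h ↦ hne (heq a s h.symm)
        have hlt' := hlt a s hlts
        have hmem : a - s ∈ S := by
          by_contra hc
          exact hne (hS _ hc)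
        refine ⟨?_, Finset.mem_erase.mpr ⟨?_, hup a ha _ hmem hlt'⟩⟩
        · rintro rfl; exact lt_irrefl _ hlts
        · intro h; rw [h] at hlt'; exact lt_irrefl _ hlt'
  have hSspan : LieSubalgebra.lieSpan k 𝔤 (⋃ b ∈ S, (G b : Set 𝔤)) = ⊤ := by
    rw [← LieSubalgebra.toSubmodule_inj, LieSubalgebra.top_toSubmodule, ← top_le_iff, ← hG]
    refine iSup_le fun a x hx ↦ ?_
    by_cases ha : a ∈ S
    · exact LieSubalgebra.subset_lieSpan (Set.mem_biUnion ha hx)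
    · rw [hS a ha, Submodule.mem_bot] at hx
      rw [hx]; exact Submodule.zero_mem _
  have := key _ S rfl (fun _ _ b hb _ ↦ hb) hSspan
  refine ⟨fun x y ↦ ?_⟩
  have h0 : ∀ z : 𝔤, z = 0 := fun z ↦ by
    rw [← LieSubalgebra.mem_bot (R := k), this]; exact LieSubalgebra.mem_top z
  rw [h0 x, h0 y]

omit [AddCommGroup A] in
theorem isInternal_of_projections [DecidableEq A]
    (hp : ∀ a, ∀ x ∈ G a, p a x = x) (hp' : ∀ a b, a ≠ b → ∀ x ∈ G b, p a x = 0)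
    (hG : ⨆ a, G a = ⊤) : DirectSum.IsInternal G := by
  refine DirectSum.isInternal_submodule_of_iSupIndep_of_iSup_eq_top (fun a ↦ ?_) hG
  rw [Submodule.disjoint_def]
  intro x hx hx'
  have hle : ⨆ b, ⨆ (_ : b ≠ a), G b ≤ LinearMap.ker (p a) :=
    iSup₂_le fun b hb y hy ↦ hp' a b hb.symm y hy
  rw [← hp a x hx]
  exact hle hx'

variable [FiniteDimensional k 𝔤] [LieAlgebra.IsKilling k 𝔤]

/-- If a graded Killing Lie algebra has nonzero neutral component, then this component
contains an element which is not `ad`-nilpotent. -/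
theorem exists_not_isNilpotent_ad_of_graded
    (hp : ∀ a, ∀ x ∈ G a, p a x = x) (hp' : ∀ a b, a ≠ b → ∀ x ∈ G b, p a x = 0)
    (hG : ⨆ a, G a = ⊤) (hbr : ∀ a b, ∀ x ∈ G a, ∀ y ∈ G b, ⁅x, y⁆ ∈ G (a + b))
    (h0 : G 0 ≠ ⊥) : ∃ x ∈ G 0, ¬ IsNilpotent (LieAlgebra.ad k 𝔤 x) := by
  classical
  by_contra! hnil
  let H : LieSubalgebra k 𝔤 :=
    { G 0 with lie_mem' := fun {x y} hx hy ↦ by simpa using hbr 0 0 x hx y hy }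
  have hH : LieModule.IsNilpotent H 𝔤 :=
    (LieModule.isNilpotent_iff_forall' (R := k)).mpr fun x ↦ hnil x x.2
  have hint := isInternal_of_projections hp hp' hG
  refine h0 ((Submodule.eq_bot_iff _).mpr fun x hx ↦ ?_)
  have hker : x ∈ LinearMap.ker (killingForm k 𝔤) := by
    rw [LinearMap.mem_ker]
    ext y
    have hy : y ∈ ⨆ b, G b := hG ▸ Submodule.mem_top
    induction hy using Submodule.iSup_induction' with
    | zero => simp
    | add y z _ _ hy hz => rw [map_add, hy, hz]; simp
    | mem b y hy =>
      by_cases hb : b = 0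
      · subst hb
        have := LinearMap.congr_fun₂ (LieModule.traceForm_eq_zero_of_isNilpotent k H 𝔤)
          ⟨x, hx⟩ ⟨y, hy⟩
        rw [LieModule.traceForm_apply_apply] at this
        exact this
      · rw [killingForm_apply_apply]
        refine LinearMap.trace_eq_zero_of_mapsTo_ne hint (b + ·) (fun c hc ↦ hb (by simpa using hc)) ?_
        intro c z hz
        simpa using hbr 0 (b + c) x hx _ (hbr b c y hy z hz)
  rwa [LieAlgebra.IsKilling.ker_killingForm_eq_bot, Submodule.mem_bot] at hker

/-- The semisimple part of `ad x` is inner, and is a polynomial in `ad x`. -/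
theorem exists_ad_isSemisimple_mem_adjoin [IsAlgClosed k] [CharZero k] (x : 𝔤)
    (hx : ¬ IsNilpotent (LieAlgebra.ad k 𝔤 x)) :
    ∃ h : 𝔤, h ≠ 0 ∧ LieAlgebra.ad k 𝔤 h ∈ Algebra.adjoin k {LieAlgebra.ad k 𝔤 x} ∧
      (LieAlgebra.ad k 𝔤 h).IsSemisimple := by
  set f := LieAlgebra.ad k 𝔤 x with hf
  obtain ⟨n, hn, s, hs, hnil, hss, hfns⟩ := f.exists_isNilpotent_isSemisimple
  have hcomm : Commute f s := (Algebra.commute_of_mem_adjoin_self hs)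
  have hs_eq : ∀ μ : k, ∀ y ∈ f.maxGenEigenspace μ, s y = μ • y := by
    intro μ y hy
    obtain ⟨N, hN⟩ := Module.End.mem_maxGenEigenspace f μ y |>.mp hy
    obtain ⟨M, hM⟩ := hnil
    have hsn : s - μ • 1 = -n + (f - μ • 1) := by rw [hfns]; abel
    have hcn : Commute (-n) (f - μ • 1) := by
      refine Commute.neg_left (Commute.sub_right ?_ ?_)
      · exact (Algebra.commute_of_mem_adjoin_self hn).symm
      · exact (Commute.one_right n).smul_right μ
    have hy' : y ∈ s.maxGenEigenspace μ := by
      refine (Module.End.mem_maxGenEigenspace s μ y).mpr ⟨M + N, ?_⟩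
      rw [hsn, hcn.add_pow, LinearMap.sum_apply]
      refine Finset.sum_eq_zero fun i hi ↦ ?_
      rw [← Nat.cast_comm]
      by_cases hiM : M ≤ i
      · have : (-n) ^ i = 0 := by rw [neg_pow, pow_eq_zero_of_le hiM hM, mul_zero]
        rw [this]; simp
      · rw [Module.End.mul_apply, Module.End.mul_apply,
          Module.End.pow_map_zero_of_le (by omega : N ≤ M + N - i) hN, map_zero, map_zero]
    rw [(Module.End.isFinitelySemisimple_iff_isSemisimple.mpr hss).maxGenEigenspace_eq_eigenspace]
      at hy'
    exact Module.End.mem_eigenspace_iff.mp hy'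
  have hder : ∀ y z : 𝔤, s ⁅y, z⁆ = ⁅y, s z⁆ - ⁅z, s y⁆ := by
    intro y z
    have hy : y ∈ ⨆ μ, f.maxGenEigenspace μ := by
      rw [f.iSup_maxGenEigenspace_eq_top]; exact Submodule.mem_top
    have hz : z ∈ ⨆ μ, f.maxGenEigenspace μ := by
      rw [f.iSup_maxGenEigenspace_eq_top]; exact Submodule.mem_top
    induction hy using Submodule.iSup_induction' with
    | zero => simp
    | add y y' _ _ h h' => simp only [add_lie, map_add, h, h', lie_add]; abel
    | mem μ y hy =>
      induction hz using Submodule.iSup_induction' with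
      | zero => simp
      | add z z' _ _ h h' => simp only [add_lie, map_add, h, h', lie_add]; abel
      | mem ν z hz =>
        rw [hs_eq _ _ hy, hs_eq _ _ hz,
          hs_eq (μ + ν) _ (LieModule.lie_mem_maxGenEigenspace_toEnd hy hz),
          lie_smul, lie_smul, ← lie_skew y z]
        module
  obtain ⟨h, hh⟩ := LieDerivation.IsKilling.exists_eq_ad
    (⟨s, hder⟩ : LieDerivation k 𝔤 𝔤)
  have hads : LieAlgebra.ad k 𝔤 h = s := by
    ext y
    have := congrArg (fun D : LieDerivation k 𝔤 𝔤 ↦ D y) hh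
    simpa using this
  refine ⟨h, ?_, hads ▸ hs, hads ▸ hss⟩
  rintro rfl
  rw [map_zero] at hads
  rw [hfns, ← hads, add_zero] at hx
  exact hx hnil

/-- A graded Killing Lie algebra with nonzero neutral component has a nonzero semisimple element
in this component. -/
theorem exists_ad_isSemisimple_of_graded [IsAlgClosed k] [CharZero k]
    (hp : ∀ a, ∀ x ∈ G a, p a x = x) (hp' : ∀ a b, a ≠ b → ∀ x ∈ G b, p a x = 0)
    (hG : ⨆ a, G a = ⊤) (hbr : ∀ a b, ∀ x ∈ G a, ∀ y ∈ G b, ⁅x, y⁆ ∈ G (a + b))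
    (h0 : G 0 ≠ ⊥) :
    ∃ h ∈ G 0, h ≠ 0 ∧ (LieAlgebra.ad k 𝔤 h).IsSemisimple := by
  obtain ⟨x, hx, hxnil⟩ := exists_not_isNilpotent_ad_of_graded hp hp' hG hbr h0
  obtain ⟨h, hh0, hadj, hss⟩ := exists_ad_isSemisimple_mem_adjoin x hxnil
  refine ⟨h, ?_, hh0, hss⟩
  have hmap : ∀ b, ∀ y ∈ G b, ⁅h, y⁆ ∈ G b := by
    intro b y hy
    have hle : Algebra.adjoin k {LieAlgebra.ad k 𝔤 x} ≤
        { carrier := {F : Module.End k 𝔤 | ∀ y ∈ G b, F y ∈ G b}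
          mul_mem' := fun {F F'} hF hF' y hy ↦ hF _ (hF' y hy)
          add_mem' := fun {F F'} hF hF' y hy ↦ (G b).add_mem (hF y hy) (hF' y hy)
          algebraMap_mem' := fun c y hy ↦ by
            rw [Module.algebraMap_end_apply]; exact (G b).smul_mem c hy :
          Subalgebra k (Module.End k 𝔤) } := by
      refine Algebra.adjoin_le ?_
      rintro _ rfl y hy
      simpa using hbr 0 b x hx y hy
    exact hle hadj y hy
  have hpG : ∀ a y, p a y ∈ G a := by
    intro a y
    have hy : y ∈ ⨆ b, G b := hG ▸ Submodule.mem_top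
    induction hy using Submodule.iSup_induction' with
    | zero => simp
    | add y z _ _ hy hz => rw [map_add]; exact (G a).add_mem hy hz
    | mem b y hy =>
      by_cases hab : a = b
      · subst hab; rwa [hp a y hy]
      · rw [hp' a b hab y hy]; exact (G a).zero_mem
  have hcent : h - p 0 h = 0 := by
    rw [← LieDerivation.IsKilling.ad_apply_eq_zero_iff k 𝔤]
    ext y
    have hy : y ∈ ⨆ b, G b := hG ▸ Submodule.mem_top
    induction hy using Submodule.iSup_induction' with
    | zero => simp
    | add y z _ _ hy hz => rw [map_add, map_add, hy, hz]
    | mem b y hy =>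
      have hcomm : ∀ z : 𝔤, ⁅p 0 z, y⁆ = p b ⁅z, y⁆ := by
        intro z
        have hz : z ∈ ⨆ b, G b := hG ▸ Submodule.mem_top
        induction hz using Submodule.iSup_induction' with
        | zero => simp
        | add z w _ _ hz hw => simp only [map_add, add_lie, hz, hw]
        | mem a z hz =>
          by_cases ha : a = 0
          · subst ha
            rw [hp 0 z hz, hp b _ (by simpa using hbr 0 b z hz y hy)]
          · rw [hp' 0 a (Ne.symm ha) z hz,
              hp' b (a + b) (by simpa using ha) _ (hbr a b z hz y hy), zero_lie]
      rw [LieDerivation.ad_apply_apply, sub_lie, hcomm, hp b _ (hmap b y hy), sub_self]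
      rfl
  rw [sub_eq_zero.mp hcent]
  exact hpG 0 h

end Graded

section Loop

variable {k : Type*} [Field k] [CharZero k]

/-- Finitely many elements of a field of characteristic zero can be told apart from the integral
multiples of `m` by an additive map to `ℝ` which is normalised at `m`. -/
theorem exists_addMonoidHom_real (S : Finset k) {m : k} (hm : m ≠ 0) :
    ∃ F : k →+ ℝ, F m = 1 ∧ ∀ α ∈ S, (∃ n : ℤ, F α = n) → ∃ n : ℤ, α = n * m := by
  classical
  obtain ⟨f, hf⟩ : ∃ f : Module.Dual ℚ k, f m ≠ 0 := by
    obtain ⟨f, hf⟩ := Module.exists_dual_forall_apply_ne_zero (K := ℚ) (fun _ : Unit ↦ m)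
      fun _ ↦ hm
    exact ⟨f, hf ()⟩
  let W : Submodule ℚ k := Submodule.span ℚ {m}
  obtain ⟨g, hg⟩ := Module.exists_dual_forall_apply_ne_zero (K := ℚ)
    (fun α : {α : S // (α : k) ∉ W} ↦ W.mkQ α.1)
    fun α h ↦ α.2 (by simpa using h)
  let F : k →+ ℝ :=
    { toFun := fun α ↦ ((f α / f m : ℚ) : ℝ) + Real.sqrt 2 * ((g (W.mkQ α) : ℚ) : ℝ)
      map_zero' := by simp
      map_add' := fun α β ↦ by simp only [map_add]; push_cast; ring }
  have hgm : g (W.mkQ m) = 0 := by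
    have : W.mkQ m = 0 :=
      (Submodule.Quotient.mk_eq_zero W).mpr (Submodule.mem_span_singleton_self (R := ℚ) m)
    rw [this, map_zero]
  refine ⟨F, ?_, ?_⟩
  · change ((f m / f m : ℚ) : ℝ) + Real.sqrt 2 * ((g (W.mkQ m) : ℚ) : ℝ) = 1
    rw [hgm, div_self hf]; simp
  · rintro α hα ⟨n, hn⟩
    change ((f α / f m : ℚ) : ℝ) + Real.sqrt 2 * ((g (W.mkQ α) : ℚ) : ℝ) = n at hn
    have hαW : α ∈ W := by
      by_contra hc
      have hg0 : g (W.mkQ α) ≠ 0 := hg ⟨⟨α, hα⟩, hc⟩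
      have hirr : Irrational (((f α / f m : ℚ) : ℝ) +
          Real.sqrt 2 * ((g (W.mkQ α) : ℚ) : ℝ)) :=
        (irrational_sqrt_two.mul_ratCast hg0).ratCast_add _
      exact hirr ⟨n, by rw [hn]; simp⟩
    obtain ⟨q, rfl⟩ := Submodule.mem_span_singleton.mp hαW
    rw [map_smul W.mkQ, map_smul g, hgm, map_smul, smul_eq_mul, mul_div_assoc, div_self hf] at hn
    have hq : q = n := by
      simp only [mul_one, smul_zero, Rat.cast_zero, mul_zero, add_zero] at hn
      exact_mod_cast hn
    exact ⟨n, by rw [hq, Rat.smul_def]; simp⟩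

omit [CharZero k] in
/-- A linear map on a space with a diagonalizable operator may be prescribed on eigenspaces. -/
theorem exists_linearMap_eqOn_eigenspaces {V W : Type*} [AddCommGroup V] [Module k V]
    [AddCommGroup W] [Module k W] {D : Module.End k V} (hD : ⨆ w, D.eigenspace w = ⊤)
    (φ : k → V →ₗ[k] W) : ∃ Φ : V →ₗ[k] W, ∀ w, ∀ l ∈ D.eigenspace w, Φ l = φ w l := by
  classical
  have hint := DirectSum.isInternal_submodule_of_iSupIndep_of_iSup_eq_top
    D.eigenspaces_iSupIndep hD
  let e := LinearEquiv.ofBijective (DirectSum.coeLinearMap D.eigenspace) hint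
  refine ⟨(DirectSum.toModule k k W fun w ↦ (φ w).comp (D.eigenspace w).subtype).comp
    e.symm.toLinearMap, fun w l hl ↦ ?_⟩
  have : e.symm l = DirectSum.lof k k (fun w ↦ D.eigenspace w) w ⟨l, hl⟩ := by
    rw [LinearEquiv.symm_apply_eq]
    exact (DirectSum.coeLinearMap_lof D.eigenspace w ⟨l, hl⟩).symm
  rw [LinearMap.comp_apply, LinearEquiv.coe_coe, this, DirectSum.toModule_lof]
  rfl

section Eigen

variable {V : Type*} [AddCommGroup V] [Module k V] {D : Module.End k V} {T : V ≃ₗ[k] V} {m : k}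

omit [CharZero k] in
theorem zpow_mem_eigenspace (hDT : ∀ l, D (T l) = T (D l) + m • T l) (j : ℤ) :
    ∀ {w : k} {l : V}, l ∈ D.eigenspace w → (T ^ j) l ∈ D.eigenspace (w + j * m) := by
  have h1 : ∀ {w : k} {l : V}, l ∈ D.eigenspace w → T l ∈ D.eigenspace (w + m) := by
    intro w l hl
    rw [Module.End.mem_eigenspace_iff] at hl ⊢
    rw [hDT, hl, map_smul, add_smul]
  have h2 : ∀ {w : k} {l : V}, l ∈ D.eigenspace w → T⁻¹ l ∈ D.eigenspace (w - m) := by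
    intro w l hl
    rw [Module.End.mem_eigenspace_iff] at hl ⊢
    apply T.injective
    have hT : T (T⁻¹ l) = l := T.apply_symm_apply l
    have h := hDT (T⁻¹ l)
    rw [hT, hl] at h
    rw [map_smul, hT, sub_smul, h, add_sub_cancel_right]
  induction j using Int.induction_on with
  | zero => intro w l hl; simpa using hl
  | succ j ih =>
    intro w l hl
    rw [zpow_add_one, LinearEquiv.mul_apply]
    have := ih (h1 hl)
    convert this using 2
    push_cast; ring
  | pred j ih =>
    intro w l hl
    rw [zpow_sub_one, LinearEquiv.mul_apply]
    have := ih (h2 hl)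
    convert this using 2
    push_cast; ring

/-- Averaging over the `T`-translates of the eigenspace of `D` for the eigenvalue `w`. -/
theorem exists_coset_sum (hD : ⨆ w, D.eigenspace w = ⊤)
    (hDT : ∀ l, D (T l) = T (D l) + m • T l) (hm : m ≠ 0) (w : k) :
    ∃ Φ : V →ₗ[k] V, (∀ l, Φ l ∈ D.eigenspace w) ∧ (∀ l, Φ (T l) = Φ l) ∧
      (∀ l ∈ D.eigenspace w, Φ l = l) ∧
      (∀ w', (∀ j : ℤ, w' ≠ w + j * m) → ∀ l ∈ D.eigenspace w', Φ l = 0) := by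
  classical
  let φ : k → V →ₗ[k] V := fun w' ↦
    if h : ∃ j : ℤ, w' = w + j * m then ((T ^ (-h.choose) : V ≃ₗ[k] V) : V →ₗ[k] V) else 0
  have hφ : ∀ j : ℤ, φ (w + j * m) = ((T ^ (-j) : V ≃ₗ[k] V) : V →ₗ[k] V) := by
    intro j
    have h : ∃ i : ℤ, w + j * m = w + i * m := ⟨j, rfl⟩
    have hj : j = h.choose := by
      have := h.choose_spec
      have := mul_right_cancel₀ hm (add_left_cancel this)
      exact_mod_cast this
    simp only [φ, dif_pos h]
    rw [← hj]
  have hφ0 : ∀ w', (∀ j : ℤ, w' ≠ w + j * m) → φ w' = 0 := by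
    intro w' h
    simp only [φ]
    rw [dif_neg (by simpa using h)]
  obtain ⟨Φ, hΦ⟩ := exists_linearMap_eqOn_eigenspaces hD φ
  have hmem : ∀ l, l ∈ ⨆ w, D.eigenspace w := fun l ↦ hD ▸ Submodule.mem_top
  refine ⟨Φ, ?_, ?_, ?_, ?_⟩
  · intro l
    induction hmem l using Submodule.iSup_induction' with
    | zero => simp
    | add x y _ _ hx hy => rw [map_add]; exact Submodule.add_mem _ hx hy
    | mem w' l hl =>
      rw [hΦ w' l hl]
      by_cases h : ∃ j : ℤ, w' = w + j * m
      · obtain ⟨j, rfl⟩ := h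
        rw [hφ]
        have := zpow_mem_eigenspace hDT (-j) hl
        simpa using this
      · rw [hφ0 w' (by simpa using h)]; simp
  · intro l
    induction hmem l using Submodule.iSup_induction' with
    | zero => simp
    | add x y _ _ hx hy => simp only [map_add, hx, hy]
    | mem w' l hl =>
      have hTl : T l ∈ D.eigenspace (w' + m) := by
        simpa using zpow_mem_eigenspace hDT 1 hl
      rw [hΦ w' l hl, hΦ _ _ hTl]
      by_cases h : ∃ j : ℤ, w' = w + j * m
      · obtain ⟨j, rfl⟩ := h
        have : w + j * m + m = w + ((j + 1 : ℤ) : k) * m := by push_cast; ring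
        rw [this, hφ, hφ]
        change (T ^ (-(j + 1))) (T l) = (T ^ (-j)) l
        rw [← LinearEquiv.mul_apply, ← zpow_add_one]
        congr 2; ring
      · rw [hφ0 w' (by simpa using h), hφ0 (w' + m), LinearMap.zero_apply, LinearMap.zero_apply]
        intro j hj
        exact h ⟨j - 1, by push_cast; linear_combination hj⟩
  · intro l hl
    rw [hΦ w l hl]
    have := hφ 0
    simp only [Int.cast_zero, zero_mul, add_zero, neg_zero, zpow_zero] at this
    rw [this]; rfl
  · intro w' h l hl
    rw [hΦ w' l hl, hφ0 w' h, LinearMap.zero_apply]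

end Eigen

variable [IsAlgClosed k] {𝔤 L : Type*} [LieRing 𝔤] [LieAlgebra k 𝔤] [FiniteDimensional k 𝔤]
  [LieAlgebra.IsKilling k 𝔤] [LieRing L] [LieAlgebra k L]

/-- Let `L` be a Lie algebra with a diagonalizable derivation `D` and a shift `T` for `D`, such that
`L` modulo `T - 1` is a nontrivial perfect Killing Lie algebra `𝔤`. Then the kernel of `D` contains
a nonzero `ad`-diagonalizable element. -/
theorem exists_diagonalizable_of_shift [Nontrivial 𝔤]
    (hperf : Submodule.span k {z : 𝔤 | ∃ x y : 𝔤, ⁅x, y⁆ = z} = ⊤)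
    {D : Module.End k L} {T : L ≃ₗ[k] L} {m : k} (hm : m ≠ 0)
    (hD : ⨆ w, D.eigenspace w = ⊤) (hDT : ∀ l, D (T l) = T (D l) + m • T l)
    (hDlie : ∀ x y, D ⁅x, y⁆ = ⁅D x, y⁆ + ⁅x, D y⁆)
    (ev : L →ₗ⁅k⁆ 𝔤) (ψ : 𝔤 →ₗ[k] L) (hevψ : ∀ v, ev (ψ v) = v)
    (hevT : ∀ l, ev (T l) = ev l) (hψev : ∀ l, ∃ l', ψ (ev l) - l = T l' - l') :
    ∃ y : L, y ≠ 0 ∧ D y = 0 ∧ ⨆ w : k, (LieAlgebra.ad k L y).eigenspace w = ⊤ := by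
  classical
  choose Φ hΦmem hΦT hΦid hΦzero using exists_coset_sum hD hDT hm
  have hΦev : ∀ w l, Φ w (ψ (ev l)) = Φ w l := by
    intro w l
    obtain ⟨l', hl'⟩ := hψev l
    rw [← sub_eq_zero, ← map_sub, hl', map_sub, hΦT, sub_self]
  have hlie : ∀ {w w' : k} {x y : L}, x ∈ D.eigenspace w → y ∈ D.eigenspace w' →
      ⁅x, y⁆ ∈ D.eigenspace (w + w') := by
    intro w w' x y hx hy
    rw [Module.End.mem_eigenspace_iff] at hx hy ⊢
    rw [hDlie, hx, hy, smul_lie, lie_smul, add_smul]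
  have hevz : ∀ (l : L) (i : ℤ), ev ((T ^ i) l) = ev l := by
    intro l i
    induction i using Int.induction_on with
    | zero => simp
    | succ i ih => rw [add_comm, zpow_add, LinearEquiv.mul_apply, zpow_one, hevT, ih]
    | pred i ih =>
      rw [← ih, ← hevT, ← LinearEquiv.mul_apply, ← zpow_one_add]
      congr 3; ring
  let A := k ⧸ AddSubgroup.zmultiples m
  let q : k → A := QuotientAddGroup.mk
  let r : A → k := Quotient.out
  have hqr : ∀ a, q (r a) = a := fun a ↦ QuotientAddGroup.out_eq' a
  have hq : ∀ {w w' : k}, q w = q w' ↔ ∃ j : ℤ, w' = w + j * m := by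
    intro w w'
    rw [QuotientAddGroup.eq, AddSubgroup.mem_zmultiples_iff]
    refine exists_congr fun j ↦ ?_
    rw [zsmul_eq_mul]
    constructor
    · intro h; linear_combination -h
    · intro h; linear_combination -h
  let G : A → Submodule k 𝔤 := fun a ↦ (D.eigenspace (r a)).map (ev : L →ₗ[k] 𝔤)
  have hG_mem : ∀ {w : k} {a : A}, q w = a → ∀ l ∈ D.eigenspace w, ev l ∈ G a := by
    intro w a hwa l hl
    rw [← hqr a] at hwa
    obtain ⟨j, hj⟩ := hq.mp hwa
    refine ⟨(T ^ j) l, ?_, hevz l j⟩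
    rw [hj]
    exact zpow_mem_eigenspace hDT j hl
  let p : A → 𝔤 →ₗ[k] 𝔤 := fun a ↦ (ev : L →ₗ[k] 𝔤) ∘ₗ Φ (r a) ∘ₗ ψ
  have hp : ∀ a, ∀ x ∈ G a, p a x = x := by
    rintro a _ ⟨l, hl, rfl⟩
    change ev (Φ (r a) (ψ (ev l))) = ev l
    rw [hΦev, hΦid _ l hl]
  have hΦG : ∀ a b, a ≠ b → ∀ x ∈ G b, Φ (r a) (ψ x) = 0 := by
    rintro a b hab _ ⟨l, hl, rfl⟩
    change Φ (r a) (ψ (ev l)) = 0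
    rw [hΦev]
    refine hΦzero _ (r b) (fun j hj ↦ hab ?_) l hl
    rw [← hqr a, ← hqr b]
    exact hq.mpr ⟨j, hj⟩
  have hp' : ∀ a b, a ≠ b → ∀ x ∈ G b, p a x = 0 := by
    intro a b hab x hx
    change ev (Φ (r a) (ψ x)) = 0
    rw [hΦG a b hab x hx, map_zero]
  have hG : ⨆ a, G a = ⊤ := by
    rw [eq_top_iff]
    intro v _
    rw [← hevψ v]
    generalize ψ v = l
    have hl : l ∈ ⨆ w, D.eigenspace w := hD ▸ Submodule.mem_top
    induction hl using Submodule.iSup_induction' with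
    | zero => simp
    | add x y _ _ hx hy => rw [map_add]; exact Submodule.add_mem _ hx hy
    | mem w l hl => exact Submodule.mem_iSup_of_mem (q w) (hG_mem rfl l hl)
  have hbr : ∀ a b, ∀ x ∈ G a, ∀ y ∈ G b, ⁅x, y⁆ ∈ G (a + b) := by
    rintro a b _ ⟨l, hl, rfl⟩ _ ⟨l', hl', rfl⟩
    change ⁅ev l, ev l'⁆ ∈ _
    rw [← LieHom.map_lie]
    refine hG_mem ?_ _ (hlie hl hl')
    conv_rhs => rw [← hqr a, ← hqr b]
    rfl
  have h0 : G 0 ≠ ⊥ := by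
    intro hbot
    have hfin : {a | G a ≠ ⊥}.Finite := WellFoundedGT.finite_ne_bot_of_iSupIndep
      (isInternal_of_projections hp hp' hG).submodule_iSupIndep
    set S := hfin.toFinset with hS
    have hSbot : ∀ a ∉ S, G a = ⊥ := fun a ha ↦ by simpa [hS] using ha
    obtain ⟨F, hFm, hF⟩ := exists_addMonoidHom_real (S.image r) hm
    let ρ : A → ℝ := fun a ↦ Int.fract (F (r a))
    have hρ : ∀ a s, ρ (a - s) = Int.fract (ρ a - ρ s) := by
      intro a s
      have : q (r a - r s) = q (r (a - s)) := by
        rw [hqr]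
        conv_rhs => rw [← hqr a, ← hqr s]
        rfl
      obtain ⟨j, hj⟩ := hq.mp this
      have hFj : F (j * m) = j := by
        rw [← zsmul_eq_mul, map_zsmul, hFm]; simp
      simp only [ρ]
      rw [hj, map_add, map_sub, hFj, Int.fract_add_intCast, Int.fract_eq_fract]
      refine ⟨⌊F (r a)⌋ - ⌊F (r s)⌋, ?_⟩
      rw [Int.fract, Int.fract]; push_cast; ring
    have hρ0 : ∀ a, 0 ≤ ρ a := fun a ↦ Int.fract_nonneg _
    have hρ1 : ∀ a, ρ a < 1 := fun a ↦ Int.fract_lt_one _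
    refine not_subsingleton 𝔤 (subsingleton_of_graded_of_perfect hp hp' hG hbr hperf S hSbot ρ ?_ ?_)
    · intro a s has
      have : Int.fract (ρ a - ρ s) = ρ a - ρ s + 1 := by
        rw [Int.fract_eq_iff]
        exact ⟨by linarith [hρ0 a, hρ1 s], by linarith, -1, by push_cast; ring⟩
      rw [hρ, this]
      linarith [hρ1 s]
    · intro a s has
      by_contra hne
      have hmem : a - s ∈ S := by
        by_contra hc
        exact hne (hSbot _ hc)
      have hz : Int.fract (F (r (a - s))) = 0 := by
        change ρ (a - s) = 0
        rw [hρ, has, sub_self, Int.fract_zero]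
      obtain ⟨n, hn⟩ := hF _ (Finset.mem_image_of_mem r hmem)
        ⟨⌊F (r (a - s))⌋, by rw [← Int.self_sub_floor, sub_eq_zero] at hz; exact hz⟩
      have : a - s = 0 := by
        rw [← hqr (a - s), hn]
        exact (hq (w := 0).mpr ⟨n, by ring⟩).symm
      exact hne (this ▸ hbot)
  obtain ⟨h, ⟨l₀, hl₀, rfl⟩, hh0, hss⟩ := exists_ad_isSemisimple_of_graded hp hp' hG hbr h0
  replace hh0 : ev l₀ ≠ 0 := hh0
  obtain ⟨i, hi⟩ := hq.mp (hqr 0 : q (r 0) = q 0)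
  obtain ⟨y, hy, hyev⟩ : ∃ y ∈ D.eigenspace 0, ev y = ev l₀ :=
    ⟨(T ^ i) l₀, hi ▸ zpow_mem_eigenspace hDT i hl₀, hevz l₀ i⟩
  have hylie : ∀ {w : k} {l : L}, l ∈ D.eigenspace w → ⁅y, l⁆ ∈ D.eigenspace w := fun hl ↦ by
    simpa using hlie hy hl
  have hcomm : ∀ w l, Φ w ⁅y, l⁆ = ⁅y, Φ w (ψ (ev l))⁆ := by
    intro w l
    have hl : l ∈ ⨆ w, D.eigenspace w := hD ▸ Submodule.mem_top
    induction hl using Submodule.iSup_induction' with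
    | zero => simp
    | add x z _ _ hx hz => simp only [map_add, lie_add, hx, hz]
    | mem w' l hl =>
      by_cases hw : ∃ j : ℤ, w' = w + j * m
      · obtain ⟨j, rfl⟩ := hw
        have hl' : (T ^ (-j)) l ∈ D.eigenspace w := by
          simpa using zpow_mem_eigenspace hDT (-j) hl
        rw [← hΦev, LieHom.map_lie, ← hevz l (-j), ← LieHom.map_lie, hΦev, hΦev,
          hΦid _ _ hl', hΦid _ _ (hylie hl')]
      · push Not at hw
        rw [hΦev, hΦzero _ _ hw _ hl, hΦzero _ _ hw _ (hylie hl), lie_zero]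
  refine ⟨y, ?_, by simpa using hy, ?_⟩
  · rintro rfl
    exact hh0 (by rw [← hyev, map_zero])
  rw [← top_le_iff, ← hD, iSup_le_iff]
  intro w l hl
  rw [← hΦid w l hl, ← hΦev]
  generalize ev l = v
  have hv : v ∈ ⨆ μ, (LieAlgebra.ad k 𝔤 (ev l₀)).eigenspace μ := by
    have := hss.iSup_eigenspace_eq_top
    exact this ▸ Submodule.mem_top
  induction hv using Submodule.iSup_induction' with
  | zero => simp
  | add x z _ _ hx hz => simp only [map_add]; exact Submodule.add_mem _ hx hz
  | mem μ v hv =>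
    refine Submodule.mem_iSup_of_mem μ ?_
    rw [Module.End.mem_eigenspace_iff, LieAlgebra.ad_apply] at hv ⊢
    have := hcomm w (ψ v)
    rw [hevψ, ← hΦev, LieHom.map_lie, hyev, hevψ, hv, map_smul, map_smul] at this
    exact this.symm

end Loop

section Twisted

variable {k : Type*} [Field k] {𝔤 : Type*} [LieRing 𝔤] [LieAlgebra k 𝔤]

theorem span_lie_eq_top_of_isSimple [LieAlgebra.IsSimple k 𝔤] :
    Submodule.span k {z : 𝔤 | ∃ x y : 𝔤, ⁅x, y⁆ = z} = ⊤ := by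
  have h : ⁅(⊤ : LieIdeal k 𝔤), (⊤ : LieIdeal k 𝔤)⁆ = ⊤ := by
    refine (LieAlgebra.IsSimple.eq_bot_or_eq_top _).resolve_left fun h ↦ ?_
    refine LieAlgebra.IsSimple.non_abelian (R := k) (L := 𝔤) ⟨fun x y ↦ ?_⟩
    rw [← LieSubmodule.mem_bot (R := k) (L := 𝔤), ← h]
    exact LieSubmodule.lie_mem_lie (LieSubmodule.mem_top x) (LieSubmodule.mem_top y)
  have h' := congrArg LieSubmodule.toSubmodule h
  rw [LieSubmodule.lieIdeal_oper_eq_linear_span'] at h'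
  simpa using h'

theorem iSup_eigenspace_eq_top_of_iterate_eq [IsAlgClosed k] [CharZero k] [FiniteDimensional k 𝔤]
    {m : ℕ} (hm : 0 < m) {f : Module.End k 𝔤} (hf : ∀ y, f^[m] y = y) :
    ⨆ w, f.eigenspace w = ⊤ := by
  have h : f.IsSemisimple := by
    refine Module.End.isSemisimple_of_squarefree_aeval_eq_zero (p := Polynomial.X ^ m - 1) ?_ ?_
    · exact (Polynomial.X_pow_sub_one_separable_iff.mpr (by exact_mod_cast hm.ne')).squarefree
    · ext y
      simp [Module.End.pow_apply, hf]
  exact h.iSup_eigenspace_eq_top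

variable {V : Type*} [AddCommGroup V] [Module k V] {σ : 𝔤 ≃ₗ⁅k⁆ 𝔤} {ζ : k}
  {u : ℤ → 𝔤 →ₗ[k] V}

theorem homogeneous_induction
    (hu_span : ∀ l : V, ∃ f : ℤ →₀ 𝔤, (∀ i, σ (f i) = ζ ^ i • f i) ∧
      l = f.sum fun i yi => u i yi)
    {P : V → Prop} (h0 : P 0) (hadd : ∀ l l', P l → P l' → P (l + l'))
    (hu : ∀ p y, σ y = ζ ^ p • y → P (u p y)) (l : V) : P l := by
  obtain ⟨f, hf, rfl⟩ := hu_span l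
  exact Finset.sum_induction _ P hadd h0 fun i _ ↦ hu i _ (hf i)

/-- A linear map on a direct sum of eigenspaces may be prescribed on the summands. -/
theorem exists_linearMap_homogeneous
    (hu_span : ∀ l : V, ∃ f : ℤ →₀ 𝔤, (∀ i, σ (f i) = ζ ^ i • f i) ∧
      l = f.sum fun i yi => u i yi)
    (hu_ind : ∀ f : ℤ →₀ 𝔤, (∀ i, σ (f i) = ζ ^ i • f i) →
      (f.sum fun i yi => u i yi) = 0 → f = 0)
    {W : Type*} [AddCommGroup W] [Module k W] (φ : ℤ → 𝔤 →ₗ[k] W) :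
    ∃ Φ : V →ₗ[k] W, ∀ p y, σ y = ζ ^ p • y → Φ (u p y) = φ p y := by
  classical
  let F : Submodule k (ℤ →₀ 𝔤) :=
    { carrier := {f | ∀ i, σ (f i) = ζ ^ i • f i}
      zero_mem' := fun i ↦ by simp
      add_mem' := fun {f g} hf hg i ↦ by simp [hf i, hg i]
      smul_mem' := fun c f hf i ↦ by simp [hf i, smul_comm c] }
  let E : F →ₗ[k] V := (Finsupp.lsum k u).comp F.subtype
  have hE : Function.Bijective E := by
    constructor
    · rw [← LinearMap.ker_eq_bot, LinearMap.ker_eq_bot']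
      exact fun f hf ↦ Subtype.ext (hu_ind f f.2 hf)
    · intro l
      obtain ⟨f, hf, rfl⟩ := hu_span l
      exact ⟨⟨f, hf⟩, rfl⟩
  let e := LinearEquiv.ofBijective E hE
  refine ⟨(Finsupp.lsum k φ).comp (F.subtype.comp e.symm.toLinearMap), fun p y hy ↦ ?_⟩
  have hmem : Finsupp.single p y ∈ F := by
    intro i
    by_cases h : p = i
    · subst h; simpa using hy
    · simp [Finsupp.single_eq_of_ne' h]
  have : e.symm (u p y) = ⟨Finsupp.single p y, hmem⟩ := by
    rw [LinearEquiv.symm_apply_eq]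
    change _ = Finsupp.lsum k u (Finsupp.single p y)
    simp
  change Finsupp.lsum k φ (e.symm (u p y) : F).1 = _
  rw [this]
  simp

theorem eigenspace_induction [IsAlgClosed k] [CharZero k] [FiniteDimensional k 𝔤] {m : ℕ}
    (hm : 0 < m) (hσ : ∀ y : 𝔤, (⇑σ)^[m] y = y) (hζ : IsPrimitiveRoot ζ m)
    {P : 𝔤 → Prop} (h0 : P 0) (hadd : ∀ y z, P y → P z → P (y + z))
    (hP : ∀ (p : ℤ) y, σ y = ζ ^ p • y → P y) (y : 𝔤) : P y := by
  have htop : ⨆ w, Module.End.eigenspace (σ : 𝔤 →ₗ[k] 𝔤) w = ⊤ :=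
    iSup_eigenspace_eq_top_of_iterate_eq hm hσ
  have hy : y ∈ ⨆ w, Module.End.eigenspace (σ : 𝔤 →ₗ[k] 𝔤) w := htop ▸ Submodule.mem_top
  induction hy using Submodule.iSup_induction' with
  | zero => exact h0
  | add y z _ _ hy hz => exact hadd y z hy hz
  | mem w y hy =>
    replace hy : σ y = w • y := Module.End.mem_eigenspace_iff.mp hy
    by_cases hy0 : y = 0
    · exact hy0 ▸ h0
    have hpow : ∀ n : ℕ, (⇑σ)^[n] y = w ^ n • y := by
      intro n
      induction n with
      | zero => simp
      | succ n ih => rw [Function.iterate_succ_apply', ih, map_smul, hy, smul_smul, pow_succ]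
    have hw : w ^ m = 1 := by
      refine smul_left_injective k hy0 ?_
      change w ^ m • y = (1 : k) • y
      rw [← hpow, hσ, one_smul]
    have : NeZero m := ⟨hm.ne'⟩
    obtain ⟨i, -, rfl⟩ := hζ.eq_pow_of_pow_eq_one hw
    exact hP i y (by simpa using hy)

/-- The eigenvectors of `σ` lift to homogeneous elements, linearly on each eigenspace. -/
theorem exists_homogeneous_lift [IsAlgClosed k] [CharZero k] [FiniteDimensional k 𝔤] {m : ℕ}
    (hm : 0 < m) (hσ : ∀ y : 𝔤, (⇑σ)^[m] y = y) (hζ : IsPrimitiveRoot ζ m)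
    (u : ℤ → 𝔤 →ₗ[k] V) :
    ∃ ψ : 𝔤 →ₗ[k] V, ∀ (p : ℤ) y, σ y = ζ ^ p • y →
      ∃ i j : ℤ, σ y = ζ ^ i • y ∧ p = i + m * j ∧ ψ y = u i y := by
  classical
  obtain ⟨ψ, hψ⟩ := exists_linearMap_eqOn_eigenspaces
    (iSup_eigenspace_eq_top_of_iterate_eq (f := (σ : 𝔤 →ₗ[k] 𝔤)) hm hσ)
    fun w ↦ if h : ∃ i : ℤ, ζ ^ i = w then u h.choose else 0
  refine ⟨ψ, fun p y hy ↦ ?_⟩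
  have h : ∃ i : ℤ, ζ ^ i = ζ ^ p := ⟨p, rfl⟩
  have hi := h.choose_spec
  have hψy := hψ (ζ ^ p) y (Module.End.mem_eigenspace_iff.mpr hy)
  rw [dif_pos h] at hψy
  have hdvd : (m : ℤ) ∣ p - h.choose := by
    rw [← hζ.zpow_eq_one_iff_dvd, zpow_sub₀ (hζ.ne_zero hm.ne'), hi,
      div_self (zpow_ne_zero _ (hζ.ne_zero hm.ne'))]
  obtain ⟨j, hj⟩ := hdvd
  exact ⟨h.choose, j, by rw [hi, hy], by linarith, hψy⟩

/-- An operator induced on a quotient by a diagonalizable operator is diagonalizable. -/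
theorem iSup_eigenspace_eq_top_of_surjective {W : Type*} [AddCommGroup W] [Module k W]
    {f : Module.End k W} {g : Module.End k V} {π : W →ₗ[k] V} (hπ : Function.Surjective π)
    (h : ∀ z, π (f z) = g (π z)) (hf : ⨆ w, f.eigenspace w = ⊤) :
    ⨆ w, g.eigenspace w = ⊤ := by
  rw [eq_top_iff, ← LinearMap.range_eq_top.mpr hπ, ← Submodule.map_top, ← hf, Submodule.map_iSup]
  refine iSup_mono fun w ↦ ?_
  rintro _ ⟨z, hz, rfl⟩
  rw [SetLike.mem_coe, Module.End.mem_eigenspace_iff] at hz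
  rw [Module.End.mem_eigenspace_iff, ← h, hz, map_smul]

end Twisted

/-- The zero weight space `L₀` of `O_x` contains a nonzero element `y`
whose adjoint operator `ad(y) : L(𝔤,σ) → L(𝔤,σ)` is `k`-diagonalizable. -/
theorem exists_diagonalizable_in_L0
    -- the base field
    (k : Type) [Field k] [IsAlgClosed k] [CharZero k]
    -- the simple finite-dimensional Lie algebra 𝔤
    (𝔤 : Type) [LieRing 𝔤] [LieAlgebra k 𝔤] [FiniteDimensional k 𝔤]
    [LieAlgebra.IsSimple k 𝔤]
    -- the order m of σ and a primitive m-th root of unity ζ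
    (m : ℕ) (hm : 0 < m)
    (σ : 𝔤 ≃ₗ⁅k⁆ 𝔤) (hσ : ∀ y : 𝔤, (⇑σ)^[m] y = y)
    (ζ : k) (hζ : IsPrimitiveRoot ζ m)
    -- the twisted loop algebra L(𝔤,σ) = ⊕_{i∈ℤ} 𝔤_ī ⊗ sⁱ, an R-Lie algebra for
    -- R = k[t^{±1}] = LaurentPolynomial k (with t = sᵐ);
    -- `u p y` represents `y ⊗ sᵖ` for `y ∈ 𝔤_p̄`, i.e. `σ y = ζ^p • y`
    (Lg : Type) [LieRing Lg] [LieAlgebra (LaurentPolynomial k) Lg]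
    [LieAlgebra k Lg] [IsScalarTower k (LaurentPolynomial k) Lg]
    (u : ℤ → 𝔤 →ₗ[k] Lg)
    (hu_bracket : ∀ (p q : ℤ) (y z : 𝔤), σ y = ζ ^ p • y → σ z = ζ ^ q • z →
      ⁅u p y, u q z⁆ = u (p + q) ⁅y, z⁆)
    (hu_t : ∀ (p : ℤ) (y : 𝔤), σ y = ζ ^ p • y →
      (T 1 : LaurentPolynomial k) • u p y = u (p + (m : ℤ)) y)
    (hu_span : ∀ l : Lg, ∃ f : ℤ →₀ 𝔤, (∀ i, σ (f i) = ζ ^ i • f i) ∧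
      l = f.sum fun i yi => u i yi)
    (hu_ind : ∀ f : ℤ →₀ 𝔤, (∀ i, σ (f i) = ζ ^ i • f i) →
      (f.sum fun i yi => u i yi) = 0 → f = 0)
    -- the twisted affine Kac–Moody algebra L̂(𝔤,σ) = L(𝔤,σ) ⊕ kc ⊕ kd
    (Lhat : Type) [LieRing Lhat] [LieAlgebra k Lhat]
    (c d : Lhat) (ι : Lg →ₗ[k] Lhat)
    (hc : ∀ z : Lhat, ⁅c, z⁆ = 0)
    (hd : ∀ (p : ℤ) (y : 𝔤), σ y = ζ ^ p • y →
      ⁅d, ι (u p y)⁆ = (p : k) • ι (u p y))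
    (hbr : ∀ (p q : ℤ) (y z : 𝔤), σ y = ζ ^ p • y → σ z = ζ ^ q • z →
      ⁅ι (u p y), ι (u q z)⁆ =
        ι (u (p + q) ⁅y, z⁆) +
          (if p + q = 0 then (p : k) * killingForm k 𝔤 y z else 0) • c)
    (hdec : ∀ z : Lhat, ∃ (l : Lg) (a b : k), z = ι l + a • c + b • d)
    (huniq : ∀ (l : Lg) (a b : k), ι l + a • c + b • d = 0 → l = 0 ∧ a = 0 ∧ b = 0)
    -- the invariant nondegenerate bilinear form (·,·) on L̂(𝔤,σ)
    (B : LinearMap.BilinForm k Lhat)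
    (hBsymm : ∀ z w : Lhat, B z w = B w z)
    (hBinv : ∀ z w y : Lhat, B ⁅z, w⁆ y = B z ⁅w, y⁆)
    (hBval : ∀ (p q : ℤ) (y z : 𝔤), σ y = ζ ^ p • y → σ z = ζ ^ q • z →
      B (ι (u p y)) (ι (u q z)) = if p + q = 0 then killingForm k 𝔤 y z else 0)
    (hBc : ∀ l : Lg, B c (ι l) = 0) (hBd : ∀ l : Lg, B d (ι l) = 0)
    (hBcc : B c c = 0) (hBdd : B d d = 0) (hBcd : B c d = 1)
    -- the element x = x' + d with 0 ≠ x' ∈ L(𝔤,σ), ad(x) k-diagonalizable on L̂(𝔤,σ)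
    (x' : Lg) (hx'0 : x' ≠ 0) (x : Lhat) (hx : x = ι x' + d)
    (hxdiag : (⨆ w : k, Module.End.eigenspace (LieAlgebra.ad k Lhat x) w) = ⊤) :
    ∃ y : Lg, y ≠ 0 ∧ (∃ μ : k, ⁅x, ι y⁆ = μ • c) ∧
      (⨆ w : k, Module.End.eigenspace (LieAlgebra.ad k Lg y) w) = ⊤ := by
  classical
  have hζ0 : ζ ≠ 0 := hζ.ne_zero hm.ne'
  have hm0 : (m : k) ≠ 0 := by exact_mod_cast hm.ne'
  have hshift : ∀ (p j : ℤ) (y : 𝔤), σ y = ζ ^ p • y → σ y = ζ ^ (p + m * j) • y := by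
    intro p j y hy
    rw [zpow_add₀ hζ0, zpow_mul, zpow_natCast, hζ.pow_eq_one, one_zpow, mul_one, hy]
  have hσlie : ∀ (p q : ℤ) (y z : 𝔤), σ y = ζ ^ p • y → σ z = ζ ^ q • z →
      σ ⁅y, z⁆ = ζ ^ (p + q) • ⁅y, z⁆ := by
    intro p q y z hy hz
    rw [LieEquiv.map_lie, hy, hz, smul_lie, lie_smul, smul_smul, zpow_add₀ hζ0]
  have hind := @homogeneous_induction k _ 𝔤 _ _ Lg _ _ σ ζ u hu_span
  -- multiplication by `t`
  let τ : Lg ≃ₗ[k] Lg := LinearEquiv.ofLinearMap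
    (DistribSMul.toLinearMap k Lg (T 1 : LaurentPolynomial k))
    (DistribSMul.toLinearMap k Lg (T (-1) : LaurentPolynomial k))
    (by ext l; change (T 1 : LaurentPolynomial k) • (T (-1) : LaurentPolynomial k) • l = l
        rw [smul_smul, ← T_add, add_neg_cancel, T_zero, one_smul])
    (by ext l; change (T (-1) : LaurentPolynomial k) • (T 1 : LaurentPolynomial k) • l = l
        rw [smul_smul, ← T_add, neg_add_cancel, T_zero, one_smul])
  have hτ : ∀ l, τ l = (T 1 : LaurentPolynomial k) • l := fun _ ↦ rfl
  have hτu : ∀ (p : ℤ) (y : 𝔤), σ y = ζ ^ p • y → τ (u p y) = u (p + m) y := hu_t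
  -- evaluation at `s = 1`
  obtain ⟨ev₀, hev₀⟩ := exists_linearMap_homogeneous hu_span hu_ind fun _ ↦ LinearMap.id
  have hev₀lie : ∀ l l', ev₀ ⁅l, l'⁆ = ⁅ev₀ l, ev₀ l'⁆ := by
    intro l l'
    induction l using hind with
    | h0 => simp
    | hadd a b ha hb => simp only [add_lie, map_add, ha, hb]
    | hu p y hy =>
      induction l' using hind with
      | h0 => simp
      | hadd a b ha hb => simp only [lie_add, map_add, ha, hb]
      | hu q z hz =>
        rw [hu_bracket p q y z hy hz, hev₀ _ _ (hσlie p q y z hy hz), hev₀ p y hy, hev₀ q z hz]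
        rfl
  let ev : Lg →ₗ⁅k⁆ 𝔤 := { ev₀ with map_lie' := fun {l l'} ↦ hev₀lie l l' }
  have hev : ∀ (p : ℤ) (y : 𝔤), σ y = ζ ^ p • y → ev (u p y) = y := hev₀
  have hevτ : ∀ l, ev (τ l) = ev l := by
    intro l
    induction l using hind with
    | h0 => simp
    | hadd a b ha hb => simp only [map_add, ha, hb]
    | hu p y hy =>
      rw [hτu p y hy, hev p y hy, hev _ y (by simpa using hshift p 1 y hy)]
  obtain ⟨ψ, hψ⟩ := exists_homogeneous_lift hm hσ hζ u
  have hevψ : ∀ y, ev (ψ y) = y := by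
    intro y
    induction y using eigenspace_induction (σ := σ) hm hσ hζ with
    | h0 => simp
    | hadd a b ha hb => simp only [map_add, ha, hb]
    | hP p y hy =>
      obtain ⟨i, j, hi, -, h⟩ := hψ p y hy
      rw [h, hev i y hi]
  have hrange : ∀ (i j : ℤ) (y : 𝔤), σ y = ζ ^ i • y →
      u i y - u (i + m * j) y ∈ LinearMap.range (τ.toLinearMap - LinearMap.id) := by
    intro i j y hy
    have hstep : ∀ j : ℤ, u (i + m * (j + 1)) y - u (i + m * j) y =
        (τ.toLinearMap - LinearMap.id : Module.End k Lg) (u (i + m * j) y) := by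
      intro j
      rw [LinearMap.sub_apply, LinearEquiv.coe_coe, hτu _ y (hshift i j y hy), LinearMap.id_apply]
      congr 3; ring
    induction j using Int.induction_on with
    | zero => simp
    | succ j ih =>
      have := Submodule.sub_mem _ ih ⟨_, (hstep j).symm⟩
      rwa [sub_sub_sub_cancel_right] at this
    | pred j ih =>
      have h := hstep (-j - 1)
      rw [sub_add_cancel] at h
      have := Submodule.add_mem _ ih ⟨_, h.symm⟩
      rwa [sub_add_sub_cancel] at this
  have hψev : ∀ l, ∃ l', ψ (ev l) - l = τ l' - l' := by
    have hmem : ∀ l, ψ (ev l) - l ∈ LinearMap.range (τ.toLinearMap - LinearMap.id) := by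
      intro l
      induction l using hind with
      | h0 => simp
      | hadd a b ha hb =>
        rw [map_add, map_add, add_sub_add_comm]
        exact Submodule.add_mem _ ha hb
      | hu p y hy =>
        obtain ⟨i, j, hi, rfl, h⟩ := hψ p y hy
        rw [hev _ y hy, h]
        exact hrange i j y hi
    intro l
    obtain ⟨l', hl'⟩ := hmem l
    exact ⟨l', hl'.symm⟩
  -- the degree derivation
  obtain ⟨δ, hδ⟩ := exists_linearMap_homogeneous hu_span hu_ind fun p ↦ (p : k) • u p
  have hδι : ∀ l, ⁅d, ι l⁆ = ι (δ l) := by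
    intro l
    induction l using hind with
    | h0 => simp
    | hadd a b ha hb => simp only [map_add, lie_add, ha, hb]
    | hu p y hy => rw [hd p y hy, hδ p y hy]; simp
  have hδlie : ∀ l l', δ ⁅l, l'⁆ = ⁅δ l, l'⁆ + ⁅l, δ l'⁆ := by
    intro l l'
    induction l using hind with
    | h0 => simp
    | hadd a b ha hb => simp only [add_lie, map_add, ha, hb]; abel
    | hu p y hy =>
      induction l' using hind with
      | h0 => simp
      | hadd a b ha hb => simp only [lie_add, map_add, ha, hb]; abel
      | hu q z hz =>
        rw [hu_bracket p q y z hy hz, hδ _ _ (hσlie p q y z hy hz), hδ p y hy, hδ q z hz]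
        simp only [LinearMap.smul_apply, smul_lie, lie_smul, hu_bracket p q y z hy hz]
        rw [Int.cast_add, add_smul]
  have hδτ : ∀ l, δ (τ l) = τ (δ l) + (m : k) • τ l := by
    intro l
    induction l using hind with
    | h0 => simp
    | hadd a b ha hb => simp only [map_add, smul_add, ha, hb]; abel
    | hu p y hy =>
      rw [hτu p y hy, hδ _ y (by simpa using hshift p 1 y hy), hδ p y hy]
      simp only [LinearMap.smul_apply, map_smul, hτu p y hy]
      rw [Int.cast_add, add_smul, Int.cast_natCast]
  have hιlie : ∀ l l', ∃ μ : k, ⁅ι l, ι l'⁆ = ι ⁅l, l'⁆ + μ • c := by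
    intro l l'
    induction l using hind with
    | h0 => exact ⟨0, by simp⟩
    | hadd a b ha hb =>
      obtain ⟨μ, hμ⟩ := ha
      obtain ⟨ν, hν⟩ := hb
      refine ⟨μ + ν, ?_⟩
      simp only [add_lie, map_add, hμ, hν, add_smul]; abel
    | hu p y hy =>
      induction l' using hind with
      | h0 => exact ⟨0, by simp⟩
      | hadd a b ha hb =>
        obtain ⟨μ, hμ⟩ := ha
        obtain ⟨ν, hν⟩ := hb
        refine ⟨μ + ν, ?_⟩
        simp only [lie_add, map_add, hμ, hν, add_smul]; abel
      | hu q z hz => exact ⟨_, by rw [hu_bracket p q y z hy hz]; exact hbr p q y z hy hz⟩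
  -- the operator `O_x`
  let D : Module.End k Lg := LieAlgebra.ad k Lg x' + δ
  have hDapp : ∀ l, D l = ⁅x', l⁆ + δ l := fun _ ↦ rfl
  have hxι : ∀ l, ∃ μ : k, ⁅x, ι l⁆ = ι (D l) + μ • c := by
    intro l
    obtain ⟨μ, hμ⟩ := hιlie x' l
    refine ⟨μ, ?_⟩
    rw [hx, add_lie, hμ, hδι, hDapp, map_add]; abel
  have hDlie : ∀ l l', D ⁅l, l'⁆ = ⁅D l, l'⁆ + ⁅l, D l'⁆ := by
    intro l l'
    rw [hDapp, hDapp, hDapp, hδlie, leibniz_lie, add_lie, lie_add]; abel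
  have hDτ : ∀ l, D (τ l) = τ (D l) + (m : k) • τ l := by
    intro l
    rw [hDapp, hDapp, hδτ, map_add, hτ l, hτ ⁅x', l⁆, lie_smul]; abel
  let E : (Lg × k × k) →ₗ[k] Lhat := ι.coprod
    ((LinearMap.toSpanSingleton k Lhat c).coprod (LinearMap.toSpanSingleton k Lhat x))
  have hEapp : ∀ l a b, E (l, a, b) = ι l + (a • c + b • x) := fun _ _ _ ↦ rfl
  have hE : Function.Bijective E := by
    constructor
    · rw [← LinearMap.ker_eq_bot, LinearMap.ker_eq_bot']
      rintro ⟨l, a, b⟩ h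
      rw [hEapp, hx] at h
      have h' : ι (l + b • x') + a • c + b • d = 0 := by
        rw [← h, map_add, map_smul, smul_add]; abel
      obtain ⟨h1, rfl, rfl⟩ := huniq _ _ _ h'
      simpa using h1
    · intro z
      obtain ⟨l, a, b, rfl⟩ := hdec z
      refine ⟨(l - b • x', a, b), ?_⟩
      rw [hEapp, hx, map_sub, map_smul, smul_add]; abel
  let e := LinearEquiv.ofBijective E hE
  let pr : Lhat →ₗ[k] Lg := (LinearMap.fst k Lg (k × k)).comp e.symm.toLinearMap
  have hpr : ∀ (l : Lg) (a b : k), pr (ι l + (a • c + b • x)) = l := by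
    intro l a b
    change (e.symm (e (l, a, b))).1 = l
    rw [e.symm_apply_apply]
  have hprad : ∀ z, pr (LieAlgebra.ad k Lhat x z) = D (pr z) := by
    intro z
    obtain ⟨⟨l, a, b⟩, rfl⟩ := hE.2 z
    obtain ⟨μ, hμ⟩ := hxι l
    rw [hEapp, hpr, LieAlgebra.ad_apply, lie_add, lie_add, lie_smul, lie_smul, lie_self,
      ← lie_skew x c, hc, hμ]
    simpa using hpr (D l) μ 0
  have hD := iSup_eigenspace_eq_top_of_surjective
    (fun l ↦ ⟨ι l, by simpa using hpr l 0 0⟩ : Function.Surjective pr) hprad hxdiag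
  have : Nontrivial 𝔤 := LieAlgebra.IsSimple.nontrivial k 𝔤
  obtain ⟨y, hy0, hDy, hy⟩ := exists_diagonalizable_of_shift (span_lie_eq_top_of_isSimple (k := k))
    hm0 hD hDτ hDlie ev ψ hevψ hevτ hψev
  obtain ⟨μ, hμ⟩ := hxι y
  exact ⟨y, hy0, ⟨μ, by rw [hμ, hDy, map_zero, zero_add]⟩, hy⟩
end
end

section
/- The restriction homomorphism τ: Aut_{k-Lie}(L̂(𝔤)_S) → Aut_{k-Lie}(L̃(𝔤)_S), φ ↦ φ|_{L̃(𝔤)_S} (well defined because L̃(𝔤)_S is the derived subalgebra of L̂(𝔤)_S), is surjective: every k-Lie algebra automorphism of L̃(𝔤)_S extends to a k-Lie algebra automorphism of L̂(𝔤)_S. -/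
open LaurentPolynomial TensorProduct

noncomputable section

theorem LaurentPolynomial.exists_eq_smul_T_of_mul_eq_one {k : Type*} [Field k]
    {f g : k[T;T⁻¹]} (h : f * g = 1) : ∃ (a : k) (n : ℤ), f = a • T n := by
  obtain ⟨i, p, hp⟩ := f.exists_T_pow
  obtain ⟨j, q, hq⟩ := g.exists_T_pow
  have hpq : p * q = Polynomial.X ^ (i + j) := by
    apply Polynomial.toLaurent_injective
    rw [map_mul, hp, hq, Polynomial.toLaurent_X_pow, mul_mul_mul_comm, h, one_mul, ← T_add]
    push_cast
    rfl
  obtain ⟨m, -, hm⟩ := (dvd_prime_pow Polynomial.prime_X _).1 ⟨q, hpq.symm⟩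
  obtain ⟨v, hv⟩ := hm.symm
  obtain ⟨a, -, ha⟩ := Polynomial.isUnit_iff.1 v.isUnit
  refine ⟨a, m - i, ?_⟩
  have hf : f = Polynomial.toLaurent p * T (-i) := by
    rw [hp, mul_assoc, ← T_add]
    simp
  rw [hf, ← hv, ← ha, map_mul, Polynomial.toLaurent_X_pow, Polynomial.toLaurent_C,
    LaurentPolynomial.smul_eq_C_mul, sub_eq_add_neg, T_add]
  ring

namespace LieAlgebra.IsSimple

variable {k 𝔤 : Type*} [Field k] [LieRing 𝔤] [LieAlgebra k 𝔤] [IsSimple k 𝔤]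

theorem span_lie_eq_top : Submodule.span k {x : 𝔤 | ∃ a b : 𝔤, ⁅a, b⁆ = x} = ⊤ := by
  have h : ⁅(⊤ : LieIdeal k 𝔤), (⊤ : LieIdeal k 𝔤)⁆ = ⊤ := by
    refine (IsSimple.eq_bot_or_eq_top _).resolve_left fun h => ?_
    refine IsSimple.non_abelian k (L := 𝔤) ⟨fun x y => ?_⟩
    rw [← LieSubmodule.mem_bot (R := k) (L := 𝔤), ← h]
    exact LieSubmodule.lie_mem_lie (LieSubmodule.mem_top x) (LieSubmodule.mem_top y)
  rw [← LieSubmodule.toSubmodule_inj, LieSubmodule.lieIdeal_oper_eq_linear_span] at h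
  simpa using h

theorem hom_ext_lie {V : Type*} [AddCommGroup V] [Module k V] {φ φ' : 𝔤 →ₗ[k] V}
    (h : ∀ a b : 𝔤, φ ⁅a, b⁆ = φ' ⁅a, b⁆) : φ = φ' :=
  LinearMap.ext_on (span_lie_eq_top (k := k)) (by rintro _ ⟨a, b, rfl⟩; exact h a b)

theorem exists_eq_smul_of_map_lie [IsAlgClosed k] [FiniteDimensional k 𝔤]
    (φ : 𝔤 →ₗ[k] 𝔤) (h : ∀ x y : 𝔤, φ ⁅x, y⁆ = ⁅x, φ y⁆) : ∃ a : k, ∀ y, φ y = a • y := by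
  have := IsSimple.nontrivial k 𝔤
  obtain ⟨a, ha⟩ := Module.End.exists_eigenvalue φ
  refine ⟨a, fun y => ?_⟩
  let I : LieIdeal k 𝔤 :=
    { Module.End.eigenspace φ a with
      lie_mem := by
        intro x m hm
        have hm : φ m = a • m := Module.End.mem_eigenspace_iff.1 hm
        exact Module.End.mem_eigenspace_iff.2 (by rw [h, hm, lie_smul]) }
  have hI : I = ⊤ := (IsSimple.eq_bot_or_eq_top I).resolve_left fun h0 => by
    obtain ⟨v, hv⟩ := ha.exists_hasEigenvector
    exact hv.2 ((LieSubmodule.mem_bot v).1 (h0 ▸ (show v ∈ I from hv.1)))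
  exact Module.End.mem_eigenspace_iff.1 (show y ∈ I from hI ▸ LieSubmodule.mem_top y)

theorem eq_zero_of_forall_lie_eq_zero (k : Type*) {𝔤 : Type*} [Field k] [LieRing 𝔤]
    [LieAlgebra k 𝔤] [IsSimple k 𝔤] {x : 𝔤} (h : ∀ y : 𝔤, ⁅x, y⁆ = 0) : x = 0 := by
  have hx : x ∈ LieAlgebra.center k 𝔤 :=
    (LieModule.mem_maxTrivSubmodule k 𝔤 𝔤 x).2 fun y => by rw [← lie_skew, h, neg_zero]
  rwa [LieAlgebra.center_eq_bot, LieSubmodule.mem_bot] at hx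

theorem exists_killingForm_ne_zero [CharZero k] [FiniteDimensional k 𝔤] :
    ∃ y z : 𝔤, killingForm k 𝔤 y z ≠ 0 := by
  have := IsSimple.nontrivial k 𝔤
  obtain ⟨y, hy⟩ := exists_ne (0 : 𝔤)
  by_contra! h
  exact hy ((LieAlgebra.IsKilling.killingForm_nondegenerate k 𝔤).1 y (h y))

end LieAlgebra.IsSimple

/-- The maps `u p : y ↦ y ⊗ sᵖ` identify the Lie algebra `Lg` with the loop algebra of `𝔤`. -/
structure IsLoopRealization {k 𝔤 Lg : Type*} [Field k] [LieRing 𝔤] [LieAlgebra k 𝔤]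
    [LieRing Lg] [LieAlgebra k Lg] (u : ℤ → 𝔤 →ₗ[k] Lg) : Prop where
  lie : ∀ (p q : ℤ) (y z : 𝔤), ⁅u p y, u q z⁆ = u (p + q) ⁅y, z⁆
  span : ∀ l : Lg, ∃ f : ℤ →₀ 𝔤, l = f.sum fun i yi => u i yi
  ind : ∀ f : ℤ →₀ 𝔤, (f.sum fun i yi => u i yi) = 0 → f = 0

namespace IsLoopRealization

variable {k 𝔤 Lg : Type*} [Field k] [LieRing 𝔤] [LieAlgebra k 𝔤]
    [LieRing Lg] [LieAlgebra k Lg] {u : ℤ → 𝔤 →ₗ[k] Lg} (hu : IsLoopRealization u)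

include hu in
theorem lsum_bijective : Function.Bijective (Finsupp.lsum k u) :=
  ⟨(injective_iff_map_eq_zero _).2 fun f hf => hu.ind f hf,
    fun l => (hu.span l).imp fun _ hf => hf.symm⟩

/-- The coefficients of the elements of the loop algebra. -/
def coeffEquiv : Lg ≃ₗ[k] (ℤ →₀ 𝔤) :=
  (LinearEquiv.ofBijective (Finsupp.lsum k u) hu.lsum_bijective).symm

@[simp]
theorem coeffEquiv_u (p : ℤ) (y : 𝔤) : hu.coeffEquiv (u p y) = Finsupp.single p y := by
  rw [coeffEquiv, LinearEquiv.symm_apply_eq]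
  simp

include hu in
@[elab_as_elim]
theorem induction {P : Lg → Prop} (l : Lg) (single : ∀ p y, P (u p y))
    (add : ∀ l l', P l → P l' → P (l + l')) : P l := by
  obtain ⟨f, rfl⟩ := hu.span l
  exact Finset.sum_induction _ P add (by simpa using single 0 0) fun i _ => single i _

include hu in
theorem hom_ext {V : Type*} [AddCommGroup V] [Module k V] {φ φ' : Lg →ₗ[k] V}
    (h : ∀ p y, φ (u p y) = φ' (u p y)) : φ = φ' := by
  ext l
  induction l using hu.induction with
  | single p y => exact h p y
  | add l l' hl hl' => rw [map_add, map_add, hl, hl']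

include hu in
theorem hom_ext_lie [LieAlgebra.IsSimple k 𝔤] {V : Type*} [AddCommGroup V] [Module k V]
    {φ φ' : Lg →ₗ[k] V} (h : ∀ p a b, φ ⁅u p a, u 0 b⁆ = φ' ⁅u p a, u 0 b⁆) : φ = φ' := by
  refine hu.hom_ext fun p y => ?_
  have := LieAlgebra.IsSimple.hom_ext_lie (φ := φ ∘ₗ u p) (φ' := φ' ∘ₗ u p) fun a b => by
    simpa [hu.lie] using h p a b
  exact LinearMap.congr_fun this y

/-- The coefficient of `sⁱ`. -/
def coeff (i : ℤ) : Lg →ₗ[k] 𝔤 := Finsupp.lapply i ∘ₗ hu.coeffEquiv.toLinearMap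

theorem coeff_u (i p : ℤ) (y : 𝔤) : hu.coeff i (u p y) = if p = i then y else 0 := by
  simp [coeff, Finsupp.single_apply]

theorem ext_coeff {l l' : Lg} (h : ∀ i, hu.coeff i l = hu.coeff i l') : l = l' :=
  hu.coeffEquiv.injective (Finsupp.ext h)

theorem coeff_lie (i : ℤ) (x : 𝔤) (l : Lg) : hu.coeff i ⁅u 0 x, l⁆ = ⁅x, hu.coeff i l⁆ := by
  induction l using hu.induction with
  | single p y =>
    rw [hu.lie, coeff_u, coeff_u, zero_add]
    split_ifs <;> simp
  | add l l' hl hl' => simp [hl, hl']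

theorem coeff_sum (s : Finset ℤ) (f : ℤ → 𝔤) (i : ℤ) :
    hu.coeff i (∑ j ∈ s, u j (f j)) = if i ∈ s then f i else 0 := by
  simp [coeff_u]

theorem exists_finset_eq_sum [FiniteDimensional k 𝔤] (φ : 𝔤 →ₗ[k] Lg) :
    ∃ s : Finset ℤ, ∀ y, φ y = ∑ i ∈ s, u i (hu.coeff i (φ y)) := by
  classical
  let b := Module.finBasis k 𝔤
  let s : Finset ℤ := Finset.univ.biUnion fun j => (hu.coeffEquiv (φ (b j))).support
  refine ⟨s, fun y => ?_⟩
  have : φ = (∑ i ∈ s, u i ∘ₗ hu.coeff i) ∘ₗ φ := b.ext fun j => by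
    refine hu.ext_coeff fun i => ?_
    simp only [LinearMap.comp_apply, LinearMap.sum_apply]
    rw [hu.coeff_sum]
    split_ifs with hi
    · rfl
    · by_contra h
      exact hi (Finset.mem_biUnion.2 ⟨j, Finset.mem_univ j, Finsupp.mem_support_iff.2 h⟩)
  simpa using LinearMap.congr_fun this y

include hu in
theorem eq_zero_of_forall_lie_eq_zero [LieAlgebra.IsSimple k 𝔤] {l : Lg}
    (h : ∀ l' : Lg, ⁅l, l'⁆ = 0) : l = 0 := by
  refine hu.ext_coeff fun i => ?_
  rw [map_zero]
  refine LieAlgebra.IsSimple.eq_zero_of_forall_lie_eq_zero k fun y => ?_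
  rw [← lie_skew, ← hu.coeff_lie, ← lie_skew, h, neg_zero, map_zero, neg_zero]

/-- Multiplication by `sⁿ`. -/
def shift (n : ℤ) : Module.End k Lg :=
  Finsupp.lsum k (fun p => u (p + n)) ∘ₗ hu.coeffEquiv.toLinearMap

@[simp]
theorem shift_u (n p : ℤ) (y : 𝔤) : hu.shift n (u p y) = u (p + n) y := by
  simp [shift]

/-- The action of the Laurent polynomials on the loop algebra by multiplication. -/
def mul : k[T;T⁻¹] →ₐ[k] Module.End k Lg :=
  AddMonoidAlgebra.lift k (Module.End k Lg) ℤ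
    { toFun := fun n => hu.shift n.toAdd
      map_one' := hu.hom_ext fun p y => by simp
      map_mul' := fun m n => hu.hom_ext fun p y => by simp [add_assoc, add_comm m.toAdd] }

theorem mul_T (n : ℤ) : hu.mul (T n) = hu.shift n := by
  rw [mul, T, AddMonoidAlgebra.lift_single, one_smul]
  rfl

@[simp]
theorem mul_T_u (n p : ℤ) (y : 𝔤) : hu.mul (T n) (u p y) = u (p + n) y := by
  rw [mul_T, shift_u]

theorem coeff_mul_u (f : k[T;T⁻¹]) (i : ℤ) (y : 𝔤) :
    hu.coeff i (hu.mul f (u 0 y)) = f.coeff i • y := by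
  induction f using LaurentPolynomial.induction_on' with
  | add p q hp hq => simp [hp, hq, add_smul]
  | C_mul_T n a =>
    rw [← LaurentPolynomial.smul_eq_C_mul]
    simp [coeff_u, T_apply]

theorem mul_injective [Nontrivial 𝔤] : Function.Injective hu.mul := by
  intro f g h
  obtain ⟨y, hy⟩ := exists_ne (0 : 𝔤)
  ext i
  apply smul_left_injective k hy
  simp only [← hu.coeff_mul_u, h]

theorem mul_lie (f : k[T;T⁻¹]) (x y : Lg) : hu.mul f ⁅x, y⁆ = ⁅x, hu.mul f y⁆ := by
  induction f using LaurentPolynomial.induction_on' with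
  | add p q hp hq => simp [hp, hq]
  | C_mul_T n a =>
    rw [← LaurentPolynomial.smul_eq_C_mul, map_smul, LinearMap.smul_apply, LinearMap.smul_apply,
      lie_smul]
    congr 1
    induction x using hu.induction with
    | add x x' hx hx' => simp [hx, hx']
    | single p x =>
      induction y using hu.induction with
      | add y y' hy hy' => simp [hy, hy']
      | single q y => simp [hu.lie, add_assoc]

theorem mul_lie' (f : k[T;T⁻¹]) (x y : Lg) : hu.mul f ⁅x, y⁆ = ⁅hu.mul f x, y⁆ := by
  rw [← lie_skew, map_neg, mul_lie, lie_skew]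

/-- The centroid of the loop algebra consists of the multiplications by Laurent polynomials. -/
theorem exists_eq_mul_of_map_lie [IsAlgClosed k] [FiniteDimensional k 𝔤]
    [LieAlgebra.IsSimple k 𝔤] (χ : Module.End k Lg) (h : ∀ x y : Lg, χ ⁅x, y⁆ = ⁅x, χ y⁆) :
    ∃ f, χ = hu.mul f := by
  have hχ (i : ℤ) : ∃ a : k, ∀ y, hu.coeff i (χ (u 0 y)) = a • y :=
    LieAlgebra.IsSimple.exists_eq_smul_of_map_lie (hu.coeff i ∘ₗ χ ∘ₗ u 0) fun x y => by
      simp only [LinearMap.comp_apply]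
      rw [← hu.coeff_lie, ← h, hu.lie, add_zero]
  choose a ha using hχ
  obtain ⟨s, hs⟩ := hu.exists_finset_eq_sum (χ ∘ₗ u 0)
  have h0 (y : 𝔤) : χ (u 0 y) = hu.mul (∑ i ∈ s, a i • T i) (u 0 y) := by
    simpa [ha] using hs y
  refine ⟨∑ i ∈ s, a i • T i, hu.hom_ext_lie fun p x y => ?_⟩
  rw [h, h0, mul_lie]

/-- The degree derivation `s d/ds`. -/
def degree : Module.End k Lg :=
  Finsupp.lsum k (fun p : ℤ => (p : k) • u p) ∘ₗ hu.coeffEquiv.toLinearMap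

@[simp]
theorem degree_u (p : ℤ) (y : 𝔤) : hu.degree (u p y) = (p : k) • u p y := by
  simp [degree]

theorem degree_lie (x y : Lg) : hu.degree ⁅x, y⁆ = ⁅hu.degree x, y⁆ + ⁅x, hu.degree y⁆ := by
  induction x using hu.induction with
  | add x x' hx hx' => simp only [add_lie, map_add, hx, hx']; abel
  | single p x =>
    induction y using hu.induction with
    | add y y' hy hy' => simp only [lie_add, map_add, hy, hy']; abel
    | single q y => simp [hu.lie, add_smul]

theorem degree_mul_T (n : ℤ) :
    hu.degree * hu.mul (T n) - hu.mul (T n) * hu.degree = (n : k) • hu.mul (T n) := by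
  refine hu.hom_ext fun p y => ?_
  simp [add_smul]

/-- Derivations normalise the centroid. -/
theorem exists_commutator_eq_mul [IsAlgClosed k] [FiniteDimensional k 𝔤]
    [LieAlgebra.IsSimple k 𝔤] (δ : Module.End k Lg)
    (hδ : ∀ x y : Lg, δ ⁅x, y⁆ = ⁅δ x, y⁆ + ⁅x, δ y⁆) (f : k[T;T⁻¹]) :
    ∃ g, δ * hu.mul f - hu.mul f * δ = hu.mul g := by
  refine hu.exists_eq_mul_of_map_lie _ fun x y => ?_
  simp only [LinearMap.sub_apply, Module.End.mul_apply, hu.mul_lie, hδ, map_add, lie_sub]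
  abel

theorem commute_mul_T {δ : Module.End k Lg} (h : Commute δ (hu.mul (T 1))) (n : ℤ) :
    Commute δ (hu.mul (T n)) := by
  have hinv : Commute δ (hu.mul (T (-1))) := by
    let v : (Module.End k Lg)ˣ :=
      ⟨hu.mul (T 1), hu.mul (T (-1)), by rw [← map_mul, ← T_add]; simp,
        by rw [← map_mul, ← T_add]; simp⟩
    exact Commute.units_inv_right (u := v) h
  induction n with
  | zero => simp
  | succ i hi =>
    rw [T_add, map_mul]
    exact hi.mul_right h
  | pred i hi =>
    rw [sub_eq_add_neg, T_add, map_mul]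
    exact hi.mul_right hinv

/-- Derivations of the loop algebra over the Laurent polynomials are inner. -/
theorem exists_eq_lie_of_commute [CharZero k] [FiniteDimensional k 𝔤]
    [LieAlgebra.IsSimple k 𝔤] (δ : Module.End k Lg)
    (hδ : ∀ x y : Lg, δ ⁅x, y⁆ = ⁅δ x, y⁆ + ⁅x, δ y⁆) (h : ∀ n, Commute δ (hu.mul (T n))) :
    ∃ x : Lg, ∀ l, δ l = ⁅x, l⁆ := by
  have hD (i : ℤ) : ∃ x : 𝔤, ∀ y, hu.coeff i (δ (u 0 y)) = ⁅x, y⁆ := by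
    let D : LieDerivation k 𝔤 𝔤 :=
      { toLinearMap := hu.coeff i ∘ₗ δ ∘ₗ u 0
        leibniz' := fun a b => by
          have := hδ (u 0 a) (u 0 b)
          rw [hu.lie, add_zero] at this
          simp only [LinearMap.comp_apply]
          rw [this, map_add, hu.coeff_lie, ← lie_skew, map_neg, hu.coeff_lie]
          abel }
    obtain ⟨x, hx⟩ := LieDerivation.IsKilling.exists_eq_ad D
    exact ⟨x, fun y =>
      (LieDerivation.congr_fun hx y).symm.trans (LieDerivation.ad_apply_apply k 𝔤 x y)⟩
  choose x hx using hD
  obtain ⟨s, hs⟩ := hu.exists_finset_eq_sum (δ ∘ₗ u 0)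
  refine ⟨∑ i ∈ s, u i (x i), fun l => ?_⟩
  induction l using hu.induction with
  | add l l' hl hl' => rw [map_add, hl, hl', lie_add]
  | single p y =>
    have hp := LinearMap.congr_fun (h p) (u 0 y)
    have h0 := hs y
    simp only [LinearMap.comp_apply, hx] at h0
    simp only [Module.End.mul_apply, mul_T_u, zero_add, h0, map_sum] at hp
    rw [hp, sum_lie]
    simp only [hu.lie]

/-- The conjugate of the degree derivation by an automorphism of the loop algebra is, up to an inner
derivation, a nonzero scalar multiple of the degree derivation. -/
theorem exists_conj_degree_eq [IsAlgClosed k] [CharZero k] [FiniteDimensional k 𝔤]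
    [LieAlgebra.IsSimple k 𝔤] (ψ : Lg ≃ₗ⁅k⁆ Lg) :
    ∃ (x : Lg) (a : k), a ≠ 0 ∧ ∀ l, ψ (hu.degree (ψ.symm l)) = ⁅x, l⁆ + a • hu.degree l := by
  have := LieAlgebra.IsSimple.nontrivial k 𝔤
  let P := ψ.toLinearEquiv.conjAlgEquiv k
  have hP (χ : Module.End k Lg) (l : Lg) : P χ l = ψ (χ (ψ.symm l)) := rfl
  have hmul (f : k[T;T⁻¹]) : ∃ g, P (hu.mul f) = hu.mul g := by
    refine hu.exists_eq_mul_of_map_lie _ fun x y => ?_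
    rw [hP, hP, LieEquiv.map_lie, hu.mul_lie, LieEquiv.map_lie, LieEquiv.apply_symm_apply]
  set δ := P hu.degree with hδdef
  have hδ (x y : Lg) : δ ⁅x, y⁆ = ⁅δ x, y⁆ + ⁅x, δ y⁆ := by
    rw [hP, hP, hP, LieEquiv.map_lie, hu.degree_lie, map_add, LieEquiv.map_lie, LieEquiv.map_lie,
      LieEquiv.apply_symm_apply, LieEquiv.apply_symm_apply]
  obtain ⟨h, hh⟩ := hmul (T 1)
  obtain ⟨h', hh'⟩ := hmul (T (-1))
  have hunit : h * h' = 1 := hu.mul_injective <| by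
    rw [map_mul, ← hh, ← hh', ← map_mul, ← map_mul, ← T_add]
    simp
  obtain ⟨a, n, rfl⟩ := LaurentPolynomial.exists_eq_smul_T_of_mul_eq_one hunit
  have ha : a ≠ 0 := by
    rintro rfl
    simp at hunit
  obtain ⟨g, hg⟩ := hu.exists_commutator_eq_mul δ hδ (T 1)
  obtain ⟨f, rfl⟩ : ∃ f, g = f * T 1 := ⟨g * T (-1), by rw [mul_assoc, ← T_add]; simp⟩
  have hcomm (m : ℤ) : hu.mul f * hu.degree * hu.mul (T m) - hu.mul (T m) * (hu.mul f * hu.degree)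
      = (m : k) • hu.mul (f * T m) := by
    rw [← mul_assoc (hu.mul (T m)), ← map_mul, mul_comm (T m) f, map_mul, mul_assoc, mul_assoc,
      ← mul_sub, degree_mul_T, mul_smul_comm]
  have hcommT := hu.commute_mul_T (δ := δ - hu.mul f * hu.degree) <| by
    rw [commute_iff_eq, ← sub_eq_zero, sub_mul, mul_sub, sub_sub_sub_comm, hg, hcomm]
    simp
  obtain ⟨x, hx⟩ := hu.exists_eq_lie_of_commute _ (fun x y => by
    simp only [LinearMap.sub_apply, Module.End.mul_apply, hδ, hu.degree_lie, map_add, sub_lie,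
      lie_sub]
    rw [← hu.mul_lie, ← hu.mul_lie']
    abel) hcommT
  have hn : (n : k) • (f * T n) = T n := hu.mul_injective <| by
    have h1 := congrArg P (hu.degree_mul_T 1)
    rw [map_sub, map_mul, map_mul, map_smul, hh, ← hδdef, map_smul, mul_smul_comm, smul_mul_assoc,
      ← smul_sub, Int.cast_one, one_smul] at h1
    have h2 := (hcommT n).eq
    rw [← sub_eq_zero, sub_mul, mul_sub, sub_sub_sub_comm, hcomm, sub_eq_zero] at h2
    rw [map_smul, ← h2]
    exact smul_right_injective _ ha h1
  have hn' : (n : k) • f = 1 := by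
    have := congrArg (· * T (-n)) hn
    rwa [smul_mul_assoc, mul_assoc, ← T_add, add_neg_cancel, T_zero, mul_one] at this
  have hn0 : (n : k) ≠ 0 := by
    intro h0
    simp [h0] at hn'
  have hfn : f = (n : k)⁻¹ • (1 : k[T;T⁻¹]) := by
    rw [← hn', inv_smul_smul₀ hn0]
  refine ⟨x, (n : k)⁻¹, inv_ne_zero hn0, fun l => ?_⟩
  have := hx l
  rw [LinearMap.sub_apply, Module.End.mul_apply, hfn, map_smul, map_one, LinearMap.smul_apply,
    Module.End.one_apply, sub_eq_iff_eq_add] at this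
  exact this

end IsLoopRealization

/-- An automorphism descends along a surjection whose kernel is the centre. -/
theorem LieEquiv.exists_descend_of_ker_eq_center {k A B : Type*} [CommRing k] [LieRing A]
    [LieAlgebra k A] [LieRing B] [LieAlgebra k B] (π : A →ₗ⁅k⁆ B) (σ : B →ₗ[k] A)
    (hσ : ∀ b, π (σ b) = b) (hker : ∀ w : A, π w = 0 ↔ ∀ v : A, ⁅w, v⁆ = 0) (ψ : A ≃ₗ⁅k⁆ A) :
    ∃ ψ' : B ≃ₗ⁅k⁆ B, ∀ w, ψ' (π w) = π (ψ w) := by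
  have key (θ : A ≃ₗ⁅k⁆ A) (w : A) : π (θ (σ (π w))) = π (θ w) := by
    rw [← sub_eq_zero, ← map_sub, ← map_sub, hker]
    intro v
    have h := (hker (σ (π w) - w)).1 (by rw [map_sub, hσ, sub_self]) (θ.symm v)
    rw [← θ.apply_symm_apply v, ← LieEquiv.map_lie, h, map_zero]
  let F (θ : A ≃ₗ⁅k⁆ A) : B →ₗ[k] B := π.toLinearMap ∘ₗ θ.toLinearEquiv.toLinearMap ∘ₗ σ
  have hF (θ : A ≃ₗ⁅k⁆ A) (b : B) : F θ b = π (θ (σ b)) := rfl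
  let E : B ≃ₗ[k] B := LinearEquiv.ofLinearMap (F ψ) (F ψ.symm)
    (LinearMap.ext fun b => by
      simp only [LinearMap.comp_apply, hF, LinearMap.id_apply, key, LieEquiv.apply_symm_apply, hσ])
    (LinearMap.ext fun b => by
      simp only [LinearMap.comp_apply, hF, LinearMap.id_apply, key, LieEquiv.symm_apply_apply, hσ])
  refine ⟨{ E with map_lie' := ?_ }, fun w => key ψ w⟩
  intro x y
  change F ψ ⁅x, y⁆ = ⁅F ψ x, F ψ y⁆
  rw [hF, hF, hF, ← LieHom.map_lie, ← LieEquiv.map_lie, ← key ψ ⁅σ x, σ y⁆, LieHom.map_lie, hσ,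
    hσ]

/-- The Lie algebra `Lhat` is `Lg ⊕ kc ⊕ kd`, with the bracket of the affine Kac–Moody algebra. -/
structure IsAffineRealization {k 𝔤 Lg Lhat : Type*} [Field k] [LieRing 𝔤] [LieAlgebra k 𝔤]
    [LieRing Lg] [LieAlgebra k Lg] [LieRing Lhat] [LieAlgebra k Lhat] (u : ℤ → 𝔤 →ₗ[k] Lg)
    (c d : Lhat) (ι : Lg →ₗ[k] Lhat) : Prop extends IsLoopRealization u where
  lie_c : ∀ z : Lhat, ⁅c, z⁆ = 0
  lie_d : ∀ (p : ℤ) (y : 𝔤), ⁅d, ι (u p y)⁆ = (p : k) • ι (u p y)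
  lie_ι_u : ∀ (p q : ℤ) (y z : 𝔤), ⁅ι (u p y), ι (u q z)⁆ = ι (u (p + q) ⁅y, z⁆) +
    (if p + q = 0 then (p : k) * killingForm k 𝔤 y z else 0) • c
  decomp : ∀ z : Lhat, ∃ (l : Lg) (a b : k), z = ι l + a • c + b • d
  unique : ∀ (l : Lg) (a b : k), ι l + a • c + b • d = 0 → l = 0 ∧ a = 0 ∧ b = 0

namespace IsAffineRealization

variable {k 𝔤 Lg Lhat Ltil : Type*} [Field k] [LieRing 𝔤] [LieAlgebra k 𝔤]
  [LieRing Lg] [LieAlgebra k Lg] [LieRing Lhat] [LieAlgebra k Lhat]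
  [LieRing Ltil] [LieAlgebra k Ltil] {u : ℤ → 𝔤 →ₗ[k] Lg} {c d : Lhat} {ι : Lg →ₗ[k] Lhat}
  (h : IsAffineRealization u c d ι)

include h

theorem lie_d_ι (l : Lg) : ⁅d, ι l⁆ = ι (h.degree l) := by
  induction l using h.induction with
  | single p y => rw [h.lie_d, h.degree_u, map_smul]
  | add l l' hl hl' => simp only [map_add, lie_add, hl, hl']

theorem lie_c' (z : Lhat) : ⁅z, c⁆ = 0 := by rw [← lie_skew, h.lie_c, neg_zero]

theorem exists_lie_ι (l l' : Lg) : ∃ a : k, ⁅ι l, ι l'⁆ = ι ⁅l, l'⁆ + a • c := by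
  induction l using h.induction with
  | add x y hx hy =>
    obtain ⟨a, ha⟩ := hx
    obtain ⟨b, hb⟩ := hy
    refine ⟨a + b, ?_⟩
    simp only [map_add, add_lie, ha, hb, add_smul]
    abel
  | single p y =>
    induction l' using h.induction with
    | add x y hx hy =>
      obtain ⟨a, ha⟩ := hx
      obtain ⟨b, hb⟩ := hy
      refine ⟨a + b, ?_⟩
      simp only [map_add, lie_add, ha, hb, add_smul]
      abel
    | single q z => exact ⟨_, by rw [h.lie_ι_u, h.lie]⟩

/-- Every element of the core `Lg ⊕ kc` is of the form `σ l + a c₀`, where `l` is its image under the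
projection `π` to the loop algebra. -/
theorem exists_core_splitting (ιt : Ltil →ₗ⁅k⁆ Lhat) (hinj : Function.Injective ιt)
    (hrange : ∀ z : Lhat, (∃ w : Ltil, ιt w = z) ↔
      z ∈ (LinearMap.range ι ⊔ Submodule.span k {c} : Submodule k Lhat)) :
    ∃ (σ : Lg →ₗ[k] Ltil) (π : Ltil →ₗ⁅k⁆ Lg) (c₀ : Ltil), (∀ l, ιt (σ l) = ι l) ∧ ιt c₀ = c ∧
      (∀ l, π (σ l) = l) ∧ ∀ w, ∃ a : k, w = σ (π w) + a • c₀ := by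
  obtain ⟨c₀, hc₀⟩ := (hrange c).2 (Submodule.mem_sup_right (Submodule.mem_span_singleton_self c))
  choose s hs using fun l =>
    (hrange (ι l)).2 (Submodule.mem_sup_left (LinearMap.mem_range_self ι l))
  let σ : Lg →ₗ[k] Ltil :=
    { toFun := s
      map_add' := fun x y => hinj (by simp [hs])
      map_smul' := fun a x => hinj (by simp [hs]) }
  have hσ (l : Lg) : ιt (σ l) = ι l := hs l
  have hdec (w : Ltil) : ∃ l, ∃ a : k, w = σ l + a • c₀ := by
    obtain ⟨_, ⟨l, rfl⟩, _, hz, hw⟩ := Submodule.mem_sup.1 ((hrange (ιt w)).1 ⟨w, rfl⟩)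
    obtain ⟨a, rfl⟩ := Submodule.mem_span_singleton.1 hz
    exact ⟨l, a, hinj (by simp [hσ, hc₀, hw])⟩
  have huniq {l l' : Lg} {a a' : k} (hl : σ l + a • c₀ = σ l' + a' • c₀) : l = l' := by
    have := congrArg ιt hl
    simp only [map_add, map_smul, hσ, hc₀] at this
    refine sub_eq_zero.1 (h.unique (l - l') (a - a') 0 ?_).1
    rw [map_sub, sub_smul, zero_smul, add_zero, sub_add_sub_comm, this, sub_self]
  choose p a hp using hdec
  have hpσ (l : Lg) (b : k) : p (σ l + b • c₀) = l := (huniq (hp (σ l + b • c₀))).symm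
  refine ⟨σ, { toFun := p, map_add' := ?_, map_smul' := ?_, map_lie' := ?_ }, c₀, hσ, hc₀,
    fun l => ?_, fun w => ⟨a w, hp w⟩⟩
  · intro v w
    have : v + w = σ (p v + p w) + (a v + a w) • c₀ := by
      conv_lhs => rw [hp v, hp w]
      rw [map_add, add_smul]
      abel
    rw [this, hpσ]
  · intro b w
    have : b • w = σ (b • p w) + (b * a w) • c₀ := by
      conv_lhs => rw [hp w]
      rw [map_smul, smul_add, mul_smul]
    rw [this, hpσ]
    rfl
  · intro v w
    obtain ⟨b, hb⟩ := h.exists_lie_ι (p v) (p w)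
    have : ⁅v, w⁆ = σ ⁅p v, p w⁆ + b • c₀ := by
      apply hinj
      conv_lhs => rw [hp v, hp w]
      simp [hσ, hc₀, h.lie_c, h.lie_c', hb]
    change p ⁅v, w⁆ = _
    rw [this, hpσ]
  · simpa using hpσ l 0

/-- The core is perfect. -/
theorem eq_zero_of_map_lie_eq_zero [CharZero k] [FiniteDimensional k 𝔤] [LieAlgebra.IsSimple k 𝔤]
    {ιt : Ltil →ₗ⁅k⁆ Lhat} (hinj : Function.Injective ιt) {σ : Lg →ₗ[k] Ltil} {c₀ : Ltil}
    (hσ : ∀ l, ιt (σ l) = ι l) (hc₀ : ιt c₀ = c) (hdec : ∀ w, ∃ l, ∃ a : k, w = σ l + a • c₀)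
    {V : Type*} [AddCommGroup V] [Module k V] (Φ : Ltil →ₗ[k] V)
    (hΦ : ∀ v w : Ltil, Φ ⁅v, w⁆ = 0) : Φ = 0 := by
  have hbr (p q : ℤ) (y z : 𝔤) : ⁅σ (u p y), σ (u q z)⁆ = σ (u (p + q) ⁅y, z⁆) +
      (if p + q = 0 then (p : k) * killingForm k 𝔤 y z else 0) • c₀ := by
    apply hinj
    rw [LieHom.map_lie, map_add, map_smul, hσ, hσ, hσ, hc₀, h.lie_ι_u]
  have hΦσ : Φ ∘ₗ σ = 0 := h.hom_ext_lie fun p a b => by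
    have := hbr p 0 a b
    rw [ite_eq_right_iff.2 (by rintro hp; simp [show p = 0 by simpa using hp]), zero_smul,
      add_zero (σ _)] at this
    rw [h.lie, LinearMap.comp_apply, ← this, hΦ, LinearMap.zero_apply]
  obtain ⟨y, z, hyz⟩ := LieAlgebra.IsSimple.exists_killingForm_ne_zero (k := k) (𝔤 := 𝔤)
  have hΦc : Φ c₀ = 0 := by
    have := congrArg Φ (hbr 1 (-1) y z)
    rw [hΦ, map_add, map_smul, ← LinearMap.comp_apply, hΦσ] at this
    simpa [hyz] using this.symm
  ext w
  obtain ⟨l, a, rfl⟩ := hdec w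
  rw [map_add, map_smul, hΦc, ← LinearMap.comp_apply, hΦσ]
  simp

/-- The core is an ideal of codimension one, complemented by any element with a nonzero component
along `d`. -/
theorem bijective_core_add_smul {ιt : Ltil →ₗ⁅k⁆ Lhat} (hinj : Function.Injective ιt)
    (hrange : ∀ z : Lhat, (∃ w : Ltil, ιt w = z) ↔
      z ∈ (LinearMap.range ι ⊔ Submodule.span k {c} : Submodule k Lhat))
    {v : Ltil} {a : k} (ha : a ≠ 0) {e : Lhat} (he : e = ιt v + a • d) :
    Function.Bijective (ιt.toLinearMap.coprod (LinearMap.toSpanSingleton k Lhat e)) := by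
  constructor
  · refine (injective_iff_map_eq_zero _).2 ?_
    rintro ⟨w, b⟩ hw
    have hw : ιt w + b • e = 0 := hw
    obtain ⟨_, ⟨l, rfl⟩, _, hz, hl⟩ := Submodule.mem_sup.1 ((hrange _).1 ⟨w + b • v, rfl⟩)
    obtain ⟨a', rfl⟩ := Submodule.mem_span_singleton.1 hz
    have h0 := h.unique l a' (b * a) <| by
      rw [hl, ← hw, he, map_add, map_smul, smul_add, smul_smul, add_assoc]
    have hb : b = 0 := (mul_eq_zero.1 h0.2.2).resolve_right ha
    subst hb
    rw [zero_smul, add_zero] at hw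
    rw [Prod.mk_eq_zero]
    exact ⟨hinj (by rw [hw, map_zero]), rfl⟩
  · intro z
    obtain ⟨l, b, b', hz⟩ := h.decomp z
    obtain ⟨w, hw⟩ := (hrange (ι l + b • c)).2 <| add_mem
      (Submodule.mem_sup_left (LinearMap.mem_range_self ι l))
      (Submodule.mem_sup_right (Submodule.smul_mem _ _ (Submodule.mem_span_singleton_self c)))
    refine ⟨(w - (b' * a⁻¹) • v, b' * a⁻¹), ?_⟩
    change ιt (w - (b' * a⁻¹) • v) + (b' * a⁻¹) • e = z
    rw [hz, ← hw, he, map_sub, map_smul, smul_add, smul_smul, inv_mul_cancel_right₀ ha]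
    abel

/-- The adjoint action of `d` on the core. -/
theorem exists_core_derivation {ιt : Ltil →ₗ⁅k⁆ Lhat} (hinj : Function.Injective ιt)
    (hrange : ∀ z : Lhat, (∃ w : Ltil, ιt w = z) ↔
      z ∈ (LinearMap.range ι ⊔ Submodule.span k {c} : Submodule k Lhat)) :
    ∃ D : Ltil →ₗ[k] Ltil, ∀ w, ιt (D w) = ⁅d, ιt w⁆ := by
  have hD (w : Ltil) : ∃ v, ιt v = ⁅d, ιt w⁆ := by
    obtain ⟨_, ⟨l, rfl⟩, _, hz, hl⟩ := Submodule.mem_sup.1 ((hrange _).1 ⟨w, rfl⟩)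
    obtain ⟨a', rfl⟩ := Submodule.mem_span_singleton.1 hz
    rw [← hl, lie_add, lie_smul, h.lie_c', smul_zero, add_zero, h.lie_d_ι, hrange]
    exact Submodule.mem_sup_left (LinearMap.mem_range_self ι _)
  choose D hD using hD
  exact ⟨{ toFun := D
           map_add' := fun x y => hinj (by simp [hD])
           map_smul' := fun a x => hinj (by simp [hD]) }, hD⟩

/-- An automorphism of the core carries the action of `d` to that of some `x + a d`, with `x` in the
core and `a ≠ 0`. -/
theorem exists_lie_eq_conj [IsAlgClosed k] [CharZero k] [FiniteDimensional k 𝔤]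
    [LieAlgebra.IsSimple k 𝔤] {ιt : Ltil →ₗ⁅k⁆ Lhat} (hinj : Function.Injective ιt)
    (hrange : ∀ z : Lhat, (∃ w : Ltil, ιt w = z) ↔
      z ∈ (LinearMap.range ι ⊔ Submodule.span k {c} : Submodule k Lhat))
    {D : Ltil →ₗ[k] Ltil} (hD : ∀ w, ιt (D w) = ⁅d, ιt w⁆) (ψ : Ltil ≃ₗ⁅k⁆ Ltil) :
    ∃ (v : Ltil) (a : k), a ≠ 0 ∧ ∀ w, ιt (ψ (D w)) = ⁅ιt v + a • d, ιt (ψ w)⁆ := by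
  obtain ⟨σ, π, c₀, hσ, hc₀, hπσ, hdec⟩ := h.exists_core_splitting ιt hinj hrange
  have hker (w : Ltil) : π w = 0 ↔ ∀ v : Ltil, ⁅w, v⁆ = 0 := by
    constructor
    · intro hw v
      obtain ⟨a, ha⟩ := hdec w
      apply hinj
      rw [ha, hw, LieHom.map_lie]
      simp [hc₀, h.lie_c]
    · intro hw
      refine h.eq_zero_of_forall_lie_eq_zero fun l => ?_
      rw [← hπσ l, ← LieHom.map_lie, hw, map_zero]
  have hDlie (v w : Ltil) : D ⁅v, w⁆ = ⁅D v, w⁆ + ⁅v, D w⁆ := hinj (by simp [hD])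
  have hπD (w : Ltil) : π (D w) = h.degree (π w) := by
    obtain ⟨a, ha⟩ := hdec w
    rw [← hπσ (h.degree (π w))]
    congr 1
    apply hinj
    conv_lhs => rw [hD, ha]
    simp [hσ, hc₀, h.lie_c', h.lie_d_ι]
  obtain ⟨ψ', hψ'⟩ := LieEquiv.exists_descend_of_ker_eq_center π σ hπσ hker ψ
  obtain ⟨x, a, ha, hx⟩ := h.exists_conj_degree_eq ψ'
  refine ⟨σ x, a, ha, ?_⟩
  have hψsymm (w : Ltil) : ψ'.symm (π w) = π (ψ.symm w) := by
    rw [← ψ'.symm_apply_apply (π (ψ.symm w)), hψ', LieEquiv.apply_symm_apply]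
  let Δ : Ltil →ₗ[k] Ltil := ψ.toLinearEquiv.toLinearMap ∘ₗ D ∘ₗ ψ.symm.toLinearEquiv.toLinearMap -
    LieAlgebra.ad k Ltil (σ x) - a • D
  have hΔ (w : Ltil) : Δ w = ψ (D (ψ.symm w)) - ⁅σ x, w⁆ - a • D w := rfl
  have hΔlie (v w : Ltil) : Δ ⁅v, w⁆ = ⁅Δ v, w⁆ + ⁅v, Δ w⁆ := by
    simp only [hΔ, LieEquiv.map_lie, hDlie, map_add, LieEquiv.apply_symm_apply, sub_lie, lie_sub,
      smul_add, smul_lie, lie_smul, lie_lie]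
    rw [leibniz_lie]
    abel
  have hΔπ (w : Ltil) : π (Δ w) = 0 := by
    rw [hΔ, map_sub, map_sub, ← hψ', hπD, ← hψsymm, hx, LieHom.map_lie, hπσ, map_smul, hπD]
    abel
  have hΔc (v w : Ltil) : ⁅Δ v, w⁆ = 0 := (hker _).1 (hΔπ v) w
  have hΔ0 : Δ = 0 := h.eq_zero_of_map_lie_eq_zero hinj hσ hc₀ (fun w => ⟨_, hdec w⟩) Δ
    fun v w => by rw [hΔlie, hΔc, ← lie_skew, hΔc, neg_zero, add_zero]
  intro w
  have := LinearMap.congr_fun hΔ0 (ψ w)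
  rw [hΔ, LieEquiv.symm_apply_apply, LinearMap.zero_apply, sub_sub, sub_eq_zero] at this
  rw [this, map_add, LieHom.map_lie, map_smul, hD, add_lie, smul_lie]

theorem exists_extension [IsAlgClosed k] [CharZero k] [FiniteDimensional k 𝔤]
    [LieAlgebra.IsSimple k 𝔤] {ιt : Ltil →ₗ⁅k⁆ Lhat} (hinj : Function.Injective ιt)
    (hrange : ∀ z : Lhat, (∃ w : Ltil, ιt w = z) ↔
      z ∈ (LinearMap.range ι ⊔ Submodule.span k {c} : Submodule k Lhat)) (ψ : Ltil ≃ₗ⁅k⁆ Ltil) :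
    ∃ φ : Lhat ≃ₗ⁅k⁆ Lhat, ∀ w, φ (ιt w) = ιt (ψ w) := by
  obtain ⟨D, hD⟩ := h.exists_core_derivation hinj hrange
  obtain ⟨v, a, ha, hv⟩ := h.exists_lie_eq_conj hinj hrange hD ψ
  set e := ιt v + a • d with he
  let G := LinearEquiv.ofBijective _
    (h.bijective_core_add_smul hinj hrange (v := 0) (e := d) one_ne_zero (by simp))
  let G' := LinearEquiv.ofBijective _ (h.bijective_core_add_smul hinj hrange ha he)
  let φ : Lhat ≃ₗ[k] Lhat :=
    G.symm ≪≫ₗ (ψ.toLinearEquiv.prodCongr (LinearEquiv.refl k k)) ≪≫ₗ G'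
  have hφ (w : Ltil) (b : k) : φ (ιt w + b • d) = ιt (ψ w) + b • e := by
    change G' (ψ.toLinearEquiv.prodCongr (LinearEquiv.refl k k) (G.symm (G (w, b)))) = _
    rw [LinearEquiv.symm_apply_apply]
    rfl
  have hφ0 (w : Ltil) : φ (ιt w) = ιt (ψ w) := by simpa using hφ w 0
  refine ⟨{ φ with map_lie' := ?_ }, hφ0⟩
  intro y z
  change φ ⁅y, z⁆ = ⁅φ y, φ z⁆
  obtain ⟨⟨w, b⟩, rfl⟩ := G.surjective y
  obtain ⟨⟨w', b'⟩, rfl⟩ := G.surjective z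
  change φ ⁅ιt w + b • d, ιt w' + b' • d⁆ = ⁅φ (ιt w + b • d), φ (ιt w' + b' • d)⁆
  have hbr : ⁅ιt w + b • d, ιt w' + b' • d⁆ = ιt (⁅w, w'⁆ + b • D w' - b' • D w) := by
    simp only [add_lie, lie_add, smul_lie, lie_smul, lie_self, smul_zero, add_zero, map_add,
      map_sub, map_smul, LieHom.map_lie, hD]
    rw [← lie_skew d (ιt w), smul_neg]
    abel
  rw [hbr, hφ0, hφ, hφ]
  simp only [add_lie, lie_add, smul_lie, lie_smul, lie_self, smul_zero, add_zero, map_add,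
    map_sub, map_smul, LieHom.map_lie, LieEquiv.map_lie, hv]
  rw [← lie_skew e (ιt (ψ w)), smul_neg]
  abel

end IsAffineRealization

/-- The restriction map
`τ : Aut_{k-Lie}(L̂(𝔤)_S) → Aut_{k-Lie}(L̃(𝔤)_S)` is surjective: every `k`-Lie
automorphism of `L̃(𝔤)_S` extends to one of `L̂(𝔤)_S`. -/
theorem restriction_to_core_surjective
    -- the base field
    (k : Type) [Field k] [IsAlgClosed k] [CharZero k]
    -- the simple finite-dimensional Lie algebra 𝔤
    (𝔤 : Type) [LieRing 𝔤] [LieAlgebra k 𝔤] [FiniteDimensional k 𝔤]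
    [LieAlgebra.IsSimple k 𝔤]
    -- the loop algebra L(𝔤)_S = 𝔤 ⊗_k S, S = k[s^{±1}]; `u p y` represents `y ⊗ sᵖ`
    (Lg : Type) [LieRing Lg] [LieAlgebra k Lg]
    (u : ℤ → 𝔤 →ₗ[k] Lg)
    (hu_bracket : ∀ (p q : ℤ) (y z : 𝔤), ⁅u p y, u q z⁆ = u (p + q) ⁅y, z⁆)
    (hu_span : ∀ l : Lg, ∃ f : ℤ →₀ 𝔤, l = f.sum fun i yi => u i yi)
    (hu_ind : ∀ f : ℤ →₀ 𝔤, (f.sum fun i yi => u i yi) = 0 → f = 0)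
    -- the split affine Kac–Moody algebra L̂(𝔤)_S = L(𝔤)_S ⊕ kc ⊕ kd
    (Lhat : Type) [LieRing Lhat] [LieAlgebra k Lhat]
    (c d : Lhat) (ι : Lg →ₗ[k] Lhat)
    (hc : ∀ z : Lhat, ⁅c, z⁆ = 0)
    (hd : ∀ (p : ℤ) (y : 𝔤), ⁅d, ι (u p y)⁆ = (p : k) • ι (u p y))
    (hbr : ∀ (p q : ℤ) (y z : 𝔤),
      ⁅ι (u p y), ι (u q z)⁆ =
        ι (u (p + q) ⁅y, z⁆) +
          (if p + q = 0 then (p : k) * killingForm k 𝔤 y z else 0) • c)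
    (hdec : ∀ z : Lhat, ∃ (l : Lg) (a b : k), z = ι l + a • c + b • d)
    (huniq : ∀ (l : Lg) (a b : k), ι l + a • c + b • d = 0 → l = 0 ∧ a = 0 ∧ b = 0)
    -- the derived subalgebra L̃(𝔤)_S = L(𝔤)_S ⊕ kc, presented as an abstract Lie
    -- algebra together with its embedding into L̂(𝔤)_S
    (Ltil : Type) [LieRing Ltil] [LieAlgebra k Ltil]
    (ιt : Ltil →ₗ⁅k⁆ Lhat) (hιt_inj : Function.Injective ιt)
    (hιt_range : ∀ z : Lhat, (∃ w : Ltil, ιt w = z) ↔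
      z ∈ (LinearMap.range ι ⊔ Submodule.span k {c} : Submodule k Lhat))
    :
    ∀ ψ : Ltil ≃ₗ⁅k⁆ Ltil, ∃ φ : Lhat ≃ₗ⁅k⁆ Lhat,
      ∀ z : Ltil, φ (ιt z) = ιt (ψ z) := by
  exact IsAffineRealization.exists_extension
    ⟨⟨hu_bracket, hu_span, hu_ind⟩, hc, hd, hbr, hdec, huniq⟩ hιt_inj hιt_range
end
end

section
/- The centre of L̃(𝔤)_S is kc, and the map λ: Aut_{k-Lie}(L̃(𝔤)_S) → Aut_{k-Lie}(L(𝔤)_S) induced by the projection L̃(𝔤)_S → L̃(𝔤)_S/kc ≅ L(𝔤)_S (i.e. λ(φ)(x) is the L(𝔤)_S-component of φ(x) for x ∈ L(𝔤)_S ⊆ L̃(𝔤)_S) is a group isomorphism. -/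
open LaurentPolynomial TensorProduct

noncomputable section

section LoopExtension

open LieAlgebra

section Simple

theorem LieAlgebra.eq_zero_of_lie_eq_zero (k : Type*) {𝔤 : Type*} [CommRing k] [LieRing 𝔤]
    [LieAlgebra k 𝔤] [HasTrivialRadical k 𝔤] (x : 𝔤) (h : ∀ y : 𝔤, ⁅x, y⁆ = 0) : x = 0 := by
  have hx : x ∈ center k 𝔤 := (LieModule.mem_maxTrivSubmodule _ _ _ x).mpr fun y => by
    rw [← lie_skew, h, neg_zero]
  rwa [center_eq_bot, LieSubmodule.mem_bot] at hx

theorem LieAlgebra.IsSimple.span_lie_eq_top_s16 (k 𝔤 : Type*) [CommRing k] [LieRing 𝔤]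
    [LieAlgebra k 𝔤] [LieAlgebra.IsSimple k 𝔤] :
    Submodule.span k {z : 𝔤 | ∃ x y : 𝔤, ⁅x, y⁆ = z} = ⊤ := by
  have key := LieSubmodule.lieIdeal_oper_eq_linear_span' (R := k) (L := 𝔤) (M := 𝔤)
    (N := ⊤) (I := ⊤)
  simp only [LieSubmodule.mem_top, true_and] at key
  rw [← key]
  rcases IsSimple.eq_bot_or_eq_top (R := k) ⁅(⊤ : LieIdeal k 𝔤), (⊤ : LieIdeal k 𝔤)⁆ with h | h
  · refine absurd ⟨fun x y => ?_⟩ (IsSimple.non_abelian k (L := 𝔤))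
    have := LieSubmodule.lie_mem_lie (LieSubmodule.mem_top (R := k) (L := 𝔤) x)
      (LieSubmodule.mem_top (R := k) (L := 𝔤) y)
    rwa [h, LieSubmodule.mem_bot] at this
  · rw [h, LieSubmodule.top_toSubmodule]

theorem LieAlgebra.IsSimple.exists_killingForm_ne_zero_s16 (k 𝔤 : Type*) [Field k] [CharZero k]
    [LieRing 𝔤] [LieAlgebra k 𝔤] [FiniteDimensional k 𝔤] [LieAlgebra.IsSimple k 𝔤] :
    ∃ x y : 𝔤, killingForm k 𝔤 x y ≠ 0 := by
  by_contra! h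
  refine IsSimple.non_abelian k (L := 𝔤) ?_
  have : Subsingleton 𝔤 := subsingleton_of_forall_eq 0 fun x =>
    (IsKilling.killingForm_nondegenerate k 𝔤).1 x (h x)
  infer_instance

theorem LieAlgebra.IsSimple.exists_eq_smul_killingForm {k 𝔤 : Type*} [Field k] [CharZero k]
    [IsAlgClosed k] [LieRing 𝔤] [LieAlgebra k 𝔤] [FiniteDimensional k 𝔤] [LieAlgebra.IsSimple k 𝔤]
    (B : 𝔤 →ₗ[k] 𝔤 →ₗ[k] k)
    (hB : ∀ x y z : 𝔤, B ⁅x, y⁆ z + B y ⁅x, z⁆ = 0) :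
    ∃ a : k, ∀ x y, B x y = a * killingForm k 𝔤 x y := by
  have hnd := IsKilling.killingForm_nondegenerate k 𝔤
  let T : Module.End k 𝔤 :=
    (LinearMap.BilinForm.toDual (killingForm k 𝔤) hnd).symm.toLinearMap ∘ₗ B
  have hT (x y : 𝔤) : killingForm k 𝔤 (T x) y = B x y :=
    LinearMap.BilinForm.apply_toDual_symm_apply (hB := hnd) (B x) y
  have hT_lie (x y : 𝔤) : T ⁅x, y⁆ = ⁅x, T y⁆ := by
    rw [← sub_eq_zero]
    refine hnd.1 _ fun z => ?_
    rw [map_sub, LinearMap.sub_apply, hT, ← lie_skew x (T y), map_neg, LinearMap.neg_apply,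
      LieModule.traceForm_apply_lie_apply, hT, sub_neg_eq_add, hB]
  have : Nontrivial 𝔤 := not_subsingleton_iff_nontrivial.mp fun _ =>
    IsSimple.non_abelian k (L := 𝔤) inferInstance
  obtain ⟨a, ha⟩ := Module.End.exists_eigenvalue T
  let I : LieIdeal k 𝔤 :=
    { T.eigenspace a with
      lie_mem := fun {x y} hy => by
        have hy : T y = a • y := Module.End.mem_eigenspace_iff.mp hy
        exact Module.End.mem_eigenspace_iff.mpr (by rw [hT_lie, hy, lie_smul]) }
  have hI : I = ⊤ := (IsSimple.eq_bot_or_eq_top I).resolve_left fun h => ha <| by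
    rw [eq_bot_iff]
    intro x hx
    have hx : x ∈ I := hx
    rwa [h, LieSubmodule.mem_bot] at hx
  refine ⟨a, fun x y => ?_⟩
  have hx : x ∈ I := hI ▸ LieSubmodule.mem_top x
  have hx : T x = a • x := Module.End.mem_eigenspace_iff.mp hx
  rw [← hT, hx, map_smul, LinearMap.smul_apply, smul_eq_mul]

theorem LieAlgebra.IsKilling.exists_eq_killingForm_lie {k 𝔤 : Type*} [Field k] [LieRing 𝔤]
    [LieAlgebra k 𝔤] [FiniteDimensional k 𝔤] [IsKilling k 𝔤] (D : 𝔤 →ₗ[k] 𝔤 →ₗ[k] k)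
    (hD : ∀ x y z : 𝔤, D x ⁅y, z⁆ = D ⁅x, y⁆ z + D y ⁅x, z⁆) :
    ∃ w : 𝔤, ∀ x y, D x y = killingForm k 𝔤 w ⁅x, y⁆ := by
  have hnd := IsKilling.killingForm_nondegenerate k 𝔤
  let T : 𝔤 →ₗ[k] 𝔤 := (LinearMap.BilinForm.toDual (killingForm k 𝔤) hnd).symm.toLinearMap ∘ₗ D
  have hT (x y : 𝔤) : killingForm k 𝔤 (T x) y = D x y :=
    LinearMap.BilinForm.apply_toDual_symm_apply (hB := hnd) (D x) y
  let δ : LieDerivation k 𝔤 𝔤 :=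
    { T with
      leibniz' := fun x y => by
        change T ⁅x, y⁆ = ⁅x, T y⁆ - ⁅y, T x⁆
        rw [← sub_eq_zero, ← lie_skew x (T y), ← lie_skew y (T x)]
        refine hnd.1 _ fun z => ?_
        simp only [map_sub, map_neg, LinearMap.sub_apply, LinearMap.neg_apply, hT,
          LieModule.traceForm_apply_lie_apply, hD x y z]
        ring }
  obtain ⟨w, hw⟩ := LieDerivation.IsKilling.exists_eq_ad δ
  refine ⟨w, fun x y => ?_⟩
  rw [← LieModule.traceForm_apply_lie_apply, ← hT]
  have : T x = ⁅w, x⁆ := by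
    rw [← LieDerivation.ad_apply_apply (R := k), hw]
    rfl
  rw [this]

end Simple

/-- Antisymmetric solutions of the cocycle equation on the exponents. -/
theorem int_cocycle_eq {k : Type*} [Field k] [CharZero k] (b : ℤ → ℤ → k)
    (hb_skew : ∀ p q, b q p = -b p q) (hb : ∀ p q r, b p (q + r) = b (p + q) r - b q (p + r))
    (p q : ℤ) : b p q = b 1 (-1) * if p + q = 0 then (p : k) else 0 := by
  let g (n : ℤ) : ℤ →+ k := AddMonoidHom.mk' (fun p => b p (n - p)) fun p q => by
    have := hb p q (n - (p + q))
    rw [show q + (n - (p + q)) = n - p by ring, show p + (n - (p + q)) = n - q by ring] at this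
    rw [this]; ring
  have hg (n p : ℤ) : b p (n - p) = p * b 1 (n - 1) := by
    have := map_zsmul (g n) p 1
    simpa [g] using this
  have hpq := hg (p + q) p
  rw [add_sub_cancel_left] at hpq
  rw [hpq]
  split_ifs with h
  · rw [h, zero_sub, mul_comm]
  · have h₁ := hg (p + q) (p + q)
    have h₂ := hg (p + q) 0
    rw [sub_self] at h₁
    rw [sub_zero, Int.cast_zero, zero_mul] at h₂
    rw [hb_skew, h₂, neg_zero, eq_comm, mul_eq_zero] at h₁
    rw [h₁.resolve_left (Int.cast_ne_zero.mpr h)]; simp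

section Extension

variable {k L M : Type*} [CommRing k] [LieRing L] [LieAlgebra k L] [LieRing M] [LieAlgebra k M]
  {ω : L →ₗ[k] L →ₗ[k] k} {e : (L × k) ≃ₗ[k] M}

/-- `e` presents `M` as the one-dimensional central extension of `L` by the cocycle `ω`. -/
def IsCocycleExtension (ω : L →ₗ[k] L →ₗ[k] k) (e : (L × k) ≃ₗ[k] M) : Prop :=
  ∀ X Y : L × k, ⁅e X, e Y⁆ = e (⁅X.1, Y.1⁆, ω X.1 Y.1)

namespace IsCocycleExtension

theorem self_eq_zero (he : IsCocycleExtension ω e) (x : L) : ω x x = 0 := by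
  have h := he (x, 0) (x, 0)
  rw [lie_self, eq_comm, e.map_eq_zero_iff] at h
  exact congrArg Prod.snd h

theorem leibniz (he : IsCocycleExtension ω e) (x y z : L) :
    ω x ⁅y, z⁆ = ω ⁅x, y⁆ z + ω y ⁅x, z⁆ := by
  have h := leibniz_lie (e (x, 0)) (e (y, 0)) (e (z, 0))
  simp only [he _ _] at h
  rw [← map_add, e.injective.eq_iff] at h
  exact congrArg Prod.snd h

theorem forall_lie_eq_zero_iff (he : IsCocycleExtension ω e)
    (hL : ∀ x : L, (∀ y : L, ⁅x, y⁆ = 0) → x = 0) (z : M) :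
    (∀ w : M, ⁅z, w⁆ = 0) ↔ (e.symm z).1 = 0 := by
  obtain ⟨X, rfl⟩ := e.surjective z
  rw [e.symm_apply_apply]
  constructor
  · refine fun h => hL _ fun y => ?_
    have := h (e (y, 0))
    rw [he, e.map_eq_zero_iff] at this
    exact congrArg Prod.fst this
  · intro h w
    obtain ⟨Y, rfl⟩ := e.surjective w
    rw [he, h, zero_lie, map_zero, LinearMap.zero_apply, ← Prod.zero_eq_mk, map_zero]

/-- The projection of a central extension onto its base. -/
def proj (he : IsCocycleExtension ω e) : M →ₗ⁅k⁆ L :=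
  { LinearMap.fst k L k ∘ₗ e.symm.toLinearMap with
    map_lie' := fun {z w} => by
      obtain ⟨X, rfl⟩ := e.surjective z
      obtain ⟨Y, rfl⟩ := e.surjective w
      simp [he X Y] }

theorem proj_apply (he : IsCocycleExtension ω e) (X : L × k) : he.proj (e X) = X.1 := by
  change (e.symm (e X)).1 = X.1
  rw [e.symm_apply_apply]

theorem proj_eq_zero_iff (he : IsCocycleExtension ω e)
    (hL : ∀ x : L, (∀ y : L, ⁅x, y⁆ = 0) → x = 0) (z : M) :
    he.proj z = 0 ↔ ∀ w : M, ⁅z, w⁆ = 0 :=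
  (he.forall_lie_eq_zero_iff hL z).symm

theorem proj_map_eq_zero (he : IsCocycleExtension ω e)
    (hL : ∀ x : L, (∀ y : L, ⁅x, y⁆ = 0) → x = 0) (φ : M ≃ₗ⁅k⁆ M) {z : M} (hz : he.proj z = 0) :
    he.proj (φ z) = 0 := by
  rw [he.proj_eq_zero_iff hL] at hz ⊢
  intro w
  rw [← φ.apply_symm_apply w, ← LieEquiv.map_lie, hz, map_zero]

theorem proj_map_section (he : IsCocycleExtension ω e)
    (hL : ∀ x : L, (∀ y : L, ⁅x, y⁆ = 0) → x = 0) (φ : M ≃ₗ⁅k⁆ M) (z : M) :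
    he.proj (φ (e (he.proj z, 0))) = he.proj (φ z) := by
  rw [← sub_eq_zero, ← map_sub, ← map_sub]
  refine he.proj_map_eq_zero hL φ ?_
  rw [map_sub, proj_apply, sub_self]

/-- The automorphism of the base induced by an automorphism of a central extension of a
Lie algebra with trivial centre. -/
def autProj (he : IsCocycleExtension ω e)
    (hL : ∀ x : L, (∀ y : L, ⁅x, y⁆ = 0) → x = 0) (φ : M ≃ₗ⁅k⁆ M) : L ≃ₗ⁅k⁆ L :=
  { he.proj.toLinearMap ∘ₗ (φ : M →ₗ⁅k⁆ M).toLinearMap ∘ₗ e.toLinearMap ∘ₗ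
      LinearMap.inl k L k with
    map_lie' := fun {x y} => by
      change he.proj (φ (e (⁅x, y⁆, 0))) = ⁅he.proj (φ (e (x, 0))), he.proj (φ (e (y, 0)))⁆
      rw [← LieHom.map_lie, ← LieEquiv.map_lie, he,
        ← he.proj_map_section hL φ (e (_, ω x y)), proj_apply]
    invFun := fun x => he.proj (φ.symm (e (x, 0)))
    left_inv := fun x => by
      change he.proj (φ.symm (e (he.proj (φ (e (x, 0))), 0))) = x
      rw [he.proj_map_section hL, φ.symm_apply_apply, proj_apply]
    right_inv := fun x => by
      change he.proj (φ (e (he.proj (φ.symm (e (x, 0))), 0))) = x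
      rw [he.proj_map_section hL, φ.apply_symm_apply, proj_apply] }

variable (he : IsCocycleExtension ω e) (hL : ∀ x : L, (∀ y : L, ⁅x, y⁆ = 0) → x = 0)

theorem autProj_apply (φ : M ≃ₗ⁅k⁆ M) (x : L) :
    he.autProj hL φ x = he.proj (φ (e (x, 0))) := rfl

theorem autProj_proj (φ : M ≃ₗ⁅k⁆ M) (z : M) :
    he.autProj hL φ (he.proj z) = he.proj (φ z) :=
  he.proj_map_section hL φ z

theorem autProj_trans (φ ψ : M ≃ₗ⁅k⁆ M) :
    he.autProj hL (φ.trans ψ) = (he.autProj hL φ).trans (he.autProj hL ψ) := by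
  ext x
  change he.proj (ψ (φ (e (x, 0)))) = he.autProj hL ψ (he.proj (φ (e (x, 0))))
  rw [autProj_proj]

theorem autProj_injective (hM : Submodule.span k {z : M | ∃ x y : M, ⁅x, y⁆ = z} = ⊤) :
    Function.Injective (he.autProj hL) := by
  intro φ ψ h
  have hsub (z : M) : ∀ w : M, ⁅φ z - ψ z, w⁆ = 0 := by
    rw [← he.proj_eq_zero_iff hL, map_sub, ← he.autProj_proj hL, h, autProj_proj, sub_self]
  have heq : Set.EqOn (φ : M →ₗ⁅k⁆ M).toLinearMap (ψ : M →ₗ⁅k⁆ M).toLinearMap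
      {z : M | ∃ x y : M, ⁅x, y⁆ = z} := by
    rintro _ ⟨x, y, rfl⟩
    change φ ⁅x, y⁆ = ψ ⁅x, y⁆
    have h₁ : ⁅φ x, φ y⁆ = ⁅ψ x, φ y⁆ := sub_eq_zero.mp (by rw [← sub_lie, hsub])
    have h₂ : ⁅φ y, ψ x⁆ = ⁅ψ y, ψ x⁆ := sub_eq_zero.mp (by rw [← sub_lie, hsub])
    rw [LieEquiv.map_lie, LieEquiv.map_lie, h₁, ← lie_skew, h₂, lie_skew]
  ext z
  exact LinearMap.congr_fun (LinearMap.ext_on hM heq) z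

theorem autProj_surjective (hω : ∀ σ : L ≃ₗ⁅k⁆ L, ∃ a : kˣ, ∃ f : L →ₗ[k] k,
      ∀ x y, ω (σ x) (σ y) = a * ω x y + f ⁅x, y⁆) :
    Function.Surjective (he.autProj hL) := by
  intro σ
  obtain ⟨a, f, haf⟩ := hω σ
  let E : (L × k) ≃ₗ[k] (L × k) :=
    LinearEquiv.skewProd σ.toLinearEquiv (LinearEquiv.smulOfUnit a) f
  let φ : M ≃ₗ⁅k⁆ M :=
    { e.symm.trans (E.trans e) with
      map_lie' := fun {z w} => by
        obtain ⟨X, rfl⟩ := e.surjective z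
        obtain ⟨Y, rfl⟩ := e.surjective w
        change e (E (e.symm ⁅e X, e Y⁆)) = ⁅e (E (e.symm (e X))), e (E (e.symm (e Y)))⁆
        simp only [he X Y, e.symm_apply_apply, he _ _]
        congr 1
        ext
        · exact LieEquiv.map_lie σ _ _
        · exact (haf _ _).symm }
  refine ⟨φ, LieEquiv.ext fun x => ?_⟩
  change he.proj (e (E (e.symm (e (x, 0))))) = σ x
  rw [proj_apply, e.symm_apply_apply]
  rfl

end IsCocycleExtension

end Extension

section Loop

variable {k 𝔤 L : Type*} [Field k] [LieRing 𝔤] [LieAlgebra k 𝔤] [LieRing L] [LieAlgebra k L]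
  {U : (ℤ →₀ 𝔤) ≃ₗ[k] L}

/-- `U` presents `L` as the loop algebra of `𝔤`, with `U (single p y)` in the role of `y ⊗ sᵖ`. -/
def IsLoopPresentation (U : (ℤ →₀ 𝔤) ≃ₗ[k] L) : Prop :=
  ∀ (p q : ℤ) (y z : 𝔤), ⁅U (.single p y), U (.single q z)⁆ = U (.single (p + q) ⁅y, z⁆)

/-- `ω` is the affine cocycle on the loop algebra presented by `U`. -/
def IsAffineCocycle (U : (ℤ →₀ 𝔤) ≃ₗ[k] L) (ω : L →ₗ[k] L →ₗ[k] k) : Prop :=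
  ∀ (p q : ℤ) (y z : 𝔤), ω (U (.single p y)) (U (.single q z)) =
    if p + q = 0 then (p : k) * killingForm k 𝔤 y z else 0

namespace IsLoopPresentation

theorem linearMap_ext {N : Type*} [AddCommGroup N] [Module k N] {F G : L →ₗ[k] N}
    (h : ∀ (p : ℤ) (y : 𝔤), F (U (.single p y)) = G (U (.single p y))) : F = G := by
  have : F ∘ₗ U.toLinearMap = G ∘ₗ U.toLinearMap := Finsupp.lhom_ext h
  ext x
  simpa using LinearMap.congr_fun this (U.symm x)

theorem bilin_ext {N : Type*} [AddCommGroup N] [Module k N] {F G : L →ₗ[k] L →ₗ[k] N}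
    (h : ∀ (p q : ℤ) (y z : 𝔤),
      F (U (.single p y)) (U (.single q z)) = G (U (.single p y)) (U (.single q z))) : F = G :=
  linearMap_ext (U := U) fun p y => linearMap_ext (U := U) fun q z => h p q y z

theorem eq_zero_of_lie_eq_zero [HasTrivialRadical k 𝔤] (hU : IsLoopPresentation U) (x : L)
    (h : ∀ y : L, ⁅x, y⁆ = 0) : x = 0 := by
  obtain ⟨f, rfl⟩ := U.surjective x
  have key (y : 𝔤) : (LieAlgebra.ad k L (U (.single 0 y))) ∘ₗ U.toLinearMap =
      U.toLinearMap ∘ₗ Finsupp.mapRange.linearMap (LieAlgebra.ad k 𝔤 y) := by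
    refine Finsupp.lhom_ext fun p z => ?_
    simp [hU _ _ _ _]
  suffices f = 0 by rw [this, map_zero]
  ext p
  refine LieAlgebra.eq_zero_of_lie_eq_zero k _ fun y => ?_
  have hy := LinearMap.congr_fun (key y) f
  have h0 : ⁅U (.single 0 y), U f⁆ = 0 := by rw [← lie_skew, h, neg_zero]
  simp only [LinearMap.comp_apply, LinearEquiv.coe_coe, ad_apply, h0] at hy
  have := DFunLike.congr_fun (U.map_eq_zero_iff.mp hy.symm) p
  rw [← lie_skew, neg_eq_zero]
  simpa using this

variable [CharZero k] [FiniteDimensional k 𝔤] [LieAlgebra.IsSimple k 𝔤]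

/-- A cocycle on a loop algebra is cohomologous to one that vanishes on `𝔤 ⊗ 1`. -/
theorem exists_eq_on_constants (hU : IsLoopPresentation U) (β : L →ₗ[k] L →ₗ[k] k)
    (hβ : ∀ x y z : L, β x ⁅y, z⁆ = β ⁅x, y⁆ z + β y ⁅x, z⁆) :
    ∃ f : L →ₗ[k] k, ∀ (p : ℤ) (y z : 𝔤),
      β (U (.single 0 y)) (U (.single p z)) = f ⁅U (.single 0 y), U (.single p z)⁆ := by
  have h (p : ℤ) : ∃ w : 𝔤, ∀ y z : 𝔤,
      β (U (.single 0 y)) (U (.single p z)) = killingForm k 𝔤 w ⁅y, z⁆ := by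
    refine IsKilling.exists_eq_killingForm_lie
      (β.compl₁₂ (U.toLinearMap ∘ₗ Finsupp.lsingle 0) (U.toLinearMap ∘ₗ Finsupp.lsingle p))
      fun x y z => ?_
    have := hβ (U (.single 0 x)) (U (.single 0 y)) (U (.single p z))
    simpa [hU _ _ _ _] using this
  choose w hw using h
  refine ⟨Finsupp.lsum k (fun p => killingForm k 𝔤 (w p)) ∘ₗ U.symm.toLinearMap, fun p y z => ?_⟩
  rw [hw, hU]
  simp

/-- An alternating cocycle on a loop algebra that vanishes on `𝔤 ⊗ 1` is a multiple of the affine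
cocycle. -/
theorem eq_smul_of_vanish_on_constants [IsAlgClosed k] (hU : IsLoopPresentation U)
    {ω : L →ₗ[k] L →ₗ[k] k} (hω : IsAffineCocycle U ω) (β : L →ₗ[k] L →ₗ[k] k)
    (hβ_self : ∀ x, β x x = 0) (hβ : ∀ x y z : L, β x ⁅y, z⁆ = β ⁅x, y⁆ z + β y ⁅x, z⁆)
    (hβ₀ : ∀ (p : ℤ) (y z : 𝔤), β (U (.single 0 y)) (U (.single p z)) = 0) :
    ∃ a : k, β = a • ω := by
  have h (p q : ℤ) : ∃ b : k, ∀ y z : 𝔤,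
      β (U (.single p y)) (U (.single q z)) = b * killingForm k 𝔤 y z := by
    refine IsSimple.exists_eq_smul_killingForm
      (β.compl₁₂ (U.toLinearMap ∘ₗ Finsupp.lsingle p) (U.toLinearMap ∘ₗ Finsupp.lsingle q))
      fun x y z => ?_
    have := hβ (U (.single 0 x)) (U (.single p y)) (U (.single q z))
    rw [hU, hβ₀, hU, hU, zero_add, zero_add] at this
    simpa using this.symm
  choose b hb using h
  have hskew (x y : L) : β y x = -β x y := by
    have := hβ_self (x + y)
    simp only [map_add, LinearMap.add_apply, hβ_self, zero_add, add_zero] at this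
    exact eq_neg_of_add_eq_zero_left this
  obtain ⟨x₀, y₀, h₀⟩ := IsSimple.exists_killingForm_ne_zero_s16 k 𝔤
  have hb_skew (p q : ℤ) : b q p = -b p q := by
    have := hskew (U (.single p y₀)) (U (.single q x₀))
    rw [hb, hb, LieModule.traceForm_comm k 𝔤 𝔤 y₀ x₀, ← neg_mul] at this
    exact mul_right_cancel₀ h₀ this
  obtain ⟨x₁, y₁, z₁, h₁⟩ : ∃ x y z : 𝔤, killingForm k 𝔤 x ⁅y, z⁆ ≠ 0 := by
    by_contra! h
    refine h₀ ?_
    have : killingForm k 𝔤 x₀ = 0 := LinearMap.ext_on (IsSimple.span_lie_eq_top_s16 k 𝔤) <| by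
      rintro _ ⟨y, z, rfl⟩
      exact h x₀ y z
    rw [this, LinearMap.zero_apply]
  have hb_cocycle (p q r : ℤ) : b p (q + r) = b (p + q) r - b q (p + r) := by
    have := hβ (U (.single p x₁)) (U (.single q y₁)) (U (.single r z₁))
    rw [hU, hU, hU, hb, hb, hb, LieModule.traceForm_apply_lie_apply,
      ← LieModule.traceForm_apply_lie_apply k 𝔤 𝔤 y₁, ← lie_skew y₁ x₁, map_neg,
      LinearMap.neg_apply, LieModule.traceForm_apply_lie_apply] at this
    refine mul_right_cancel₀ h₁ ?_
    rw [this]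
    ring
  refine ⟨b 1 (-1), bilin_ext (U := U) fun p q y z => ?_⟩
  rw [hb, int_cocycle_eq b hb_skew hb_cocycle, LinearMap.smul_apply, LinearMap.smul_apply, hω,
    smul_eq_mul]
  split_ifs <;> ring

/-- Every alternating cocycle on a loop algebra is cohomologous to a multiple of the affine
cocycle. -/
theorem exists_eq_smul_add_coboundary [IsAlgClosed k] (hU : IsLoopPresentation U)
    {ω : L →ₗ[k] L →ₗ[k] k} (hω : IsAffineCocycle U ω) (β : L →ₗ[k] L →ₗ[k] k)
    (hβ_self : ∀ x, β x x = 0) (hβ : ∀ x y z : L, β x ⁅y, z⁆ = β ⁅x, y⁆ z + β y ⁅x, z⁆) :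
    ∃ (a : k) (f : L →ₗ[k] k), ∀ x y, β x y = a * ω x y + f ⁅x, y⁆ := by
  obtain ⟨f, hf⟩ := hU.exists_eq_on_constants β hβ
  let γ : L →ₗ[k] L →ₗ[k] k := β - LinearMap.mk₂ k (fun x y => f ⁅x, y⁆)
    (by simp) (by simp) (by simp) (by simp)
  have hγ (x y : L) : γ x y = β x y - f ⁅x, y⁆ := rfl
  obtain ⟨a, ha⟩ := hU.eq_smul_of_vanish_on_constants hω γ
    (fun x => by rw [hγ, hβ_self, lie_self, map_zero, sub_zero])
    (fun x y z => by rw [hγ, hγ, hγ, hβ, leibniz_lie, map_add]; ring)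
    (fun p y z => by rw [hγ, hf, sub_self])
  refine ⟨a, f, fun x y => ?_⟩
  rw [← sub_eq_iff_eq_add, ← hγ, ha]
  rfl

theorem not_coboundary (hU : IsLoopPresentation U) {ω : L →ₗ[k] L →ₗ[k] k}
    (hω : IsAffineCocycle U ω) (f : L →ₗ[k] k) : ¬ ∀ x y, ω x y = f ⁅x, y⁆ := by
  intro h
  obtain ⟨x, y, hxy⟩ := IsSimple.exists_killingForm_ne_zero_s16 k 𝔤
  have h₀ := h (U (.single 0 x)) (U (.single 0 y))
  have h₁ := h (U (.single 1 x)) (U (.single (-1) y))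
  rw [hU, hω] at h₀ h₁
  rw [add_neg_cancel, ← add_zero (0 : ℤ), ← h₀] at h₁
  simp [hxy] at h₁

theorem exists_aut_cocycle_eq [IsAlgClosed k] (hU : IsLoopPresentation U)
    {ω : L →ₗ[k] L →ₗ[k] k} (hω : IsAffineCocycle U ω) (hω_self : ∀ x, ω x x = 0)
    (hω_leibniz : ∀ x y z : L, ω x ⁅y, z⁆ = ω ⁅x, y⁆ z + ω y ⁅x, z⁆) (σ : L ≃ₗ⁅k⁆ L) :
    ∃ a : kˣ, ∃ f : L →ₗ[k] k, ∀ x y, ω (σ x) (σ y) = a * ω x y + f ⁅x, y⁆ := by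
  obtain ⟨a, f, h⟩ := hU.exists_eq_smul_add_coboundary hω
    (ω.compl₁₂ (σ : L →ₗ⁅k⁆ L).toLinearMap (σ : L →ₗ⁅k⁆ L).toLinearMap)
    (fun x => hω_self (σ x)) (fun x y z => by
      change ω (σ x) (σ ⁅y, z⁆) = ω (σ ⁅x, y⁆) (σ z) + ω (σ y) (σ ⁅x, z⁆)
      rw [LieEquiv.map_lie, LieEquiv.map_lie, LieEquiv.map_lie, hω_leibniz])
  have ha : a ≠ 0 := by
    rintro rfl
    refine hU.not_coboundary hω (f ∘ₗ (σ.symm : L →ₗ⁅k⁆ L).toLinearMap) fun x y => ?_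
    have := h (σ.symm x) (σ.symm y)
    change ω (σ (σ.symm x)) (σ (σ.symm y)) = _ at this
    rw [σ.apply_symm_apply, σ.apply_symm_apply, zero_mul, zero_add, ← LieEquiv.map_lie] at this
    exact this
  exact ⟨Units.mk0 a ha, f, h⟩

theorem span_lie_eq_top_s16 (hU : IsLoopPresentation U) {M : Type*} [LieRing M] [LieAlgebra k M]
    {ω : L →ₗ[k] L →ₗ[k] k} (hω : IsAffineCocycle U ω) {e : (L × k) ≃ₗ[k] M}
    (he : IsCocycleExtension ω e) :
    Submodule.span k {z : M | ∃ x y : M, ⁅x, y⁆ = z} = ⊤ := by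
  set P := Submodule.span k {z : M | ∃ x y : M, ⁅x, y⁆ = z}
  have hP (p q : ℤ) (x y : 𝔤) : e (U (.single (p + q) ⁅x, y⁆),
      if p + q = 0 then (p : k) * killingForm k 𝔤 x y else 0) ∈ P :=
    Submodule.subset_span ⟨e (U (.single p x), 0), e (U (.single q y), 0), by rw [he, hU, hω]⟩
  have hc : LinearMap.range (e.toLinearMap ∘ₗ LinearMap.inr k L k) ≤ P := by
    obtain ⟨x, y, hxy⟩ := IsSimple.exists_killingForm_ne_zero_s16 k 𝔤
    have h := P.sub_mem (hP 1 (-1) x y) (hP 0 0 x y)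
    rw [← map_sub] at h
    rintro _ ⟨t, rfl⟩
    convert P.smul_mem (t / killingForm k 𝔤 x y) h using 1
    simp [← map_smul, hxy]
  have hl : LinearMap.range (e.toLinearMap ∘ₗ LinearMap.inl k L k) ≤ P := by
    have h (p : ℤ) (y : 𝔤) : e (U (.single p y), 0) ∈ P := by
      have : y ∈ Submodule.span k {z : 𝔤 | ∃ x y : 𝔤, ⁅x, y⁆ = z} := by
        rw [IsSimple.span_lie_eq_top_s16]; trivial
      induction this using Submodule.span_induction with
      | mem y hy =>
        obtain ⟨x, z, rfl⟩ := hy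
        simpa using hP 0 p x z
      | zero => simp [← Prod.zero_eq_mk]
      | add y z _ _ hy hz => simpa [← map_add] using P.add_mem hy hz
      | smul a y _ hy => simpa [← map_smul] using P.smul_mem a hy
    rintro _ ⟨x, rfl⟩
    obtain ⟨f, rfl⟩ := U.surjective x
    induction f using Finsupp.induction_linear with
    | zero => simp [← Prod.zero_eq_mk]
    | add f g hf hg => simpa [← map_add] using P.add_mem hf hg
    | single p y => exact h p y
  rw [eq_top_iff]
  intro z _
  obtain ⟨⟨x, t⟩, rfl⟩ := e.surjective z
  have := P.add_mem (hl ⟨x, rfl⟩) (hc ⟨t, rfl⟩)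
  simpa [← map_add] using this

end IsLoopPresentation

end Loop

end LoopExtension

/-- The centre of `L̃(𝔤)_S` is `kc`, and the map
`λ : Aut_{k-Lie}(L̃(𝔤)_S) → Aut_{k-Lie}(L(𝔤)_S)` induced by the projection
`L̃(𝔤)_S → L̃(𝔤)_S/kc ≅ L(𝔤)_S` is a group isomorphism. -/
theorem centre_and_projection_iso
    -- the base field
    (k : Type) [Field k] [IsAlgClosed k] [CharZero k]
    -- the simple finite-dimensional Lie algebra 𝔤
    (𝔤 : Type) [LieRing 𝔤] [LieAlgebra k 𝔤] [FiniteDimensional k 𝔤]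
    [LieAlgebra.IsSimple k 𝔤]
    -- the loop algebra L(𝔤)_S = 𝔤 ⊗_k S, S = k[s^{±1}]; `u p y` represents `y ⊗ sᵖ`
    (Lg : Type) [LieRing Lg] [LieAlgebra k Lg]
    (u : ℤ → 𝔤 →ₗ[k] Lg)
    (hu_bracket : ∀ (p q : ℤ) (y z : 𝔤), ⁅u p y, u q z⁆ = u (p + q) ⁅y, z⁆)
    (hu_span : ∀ l : Lg, ∃ f : ℤ →₀ 𝔤, l = f.sum fun i yi => u i yi)
    (hu_ind : ∀ f : ℤ →₀ 𝔤, (f.sum fun i yi => u i yi) = 0 → f = 0)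
    -- the split affine Kac–Moody algebra L̂(𝔤)_S = L(𝔤)_S ⊕ kc ⊕ kd
    (Lhat : Type) [LieRing Lhat] [LieAlgebra k Lhat]
    (c d : Lhat) (ι : Lg →ₗ[k] Lhat)
    (hc : ∀ z : Lhat, ⁅c, z⁆ = 0)
    (hd : ∀ (p : ℤ) (y : 𝔤), ⁅d, ι (u p y)⁆ = (p : k) • ι (u p y))
    (hbr : ∀ (p q : ℤ) (y z : 𝔤),
      ⁅ι (u p y), ι (u q z)⁆ =
        ι (u (p + q) ⁅y, z⁆) +
          (if p + q = 0 then (p : k) * killingForm k 𝔤 y z else 0) • c)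
    (hdec : ∀ z : Lhat, ∃ (l : Lg) (a b : k), z = ι l + a • c + b • d)
    (huniq : ∀ (l : Lg) (a b : k), ι l + a • c + b • d = 0 → l = 0 ∧ a = 0 ∧ b = 0)
    -- the derived subalgebra L̃(𝔤)_S = L(𝔤)_S ⊕ kc, presented as an abstract Lie
    -- algebra together with its embedding into L̂(𝔤)_S
    (Ltil : Type) [LieRing Ltil] [LieAlgebra k Ltil]
    (ιt : Ltil →ₗ⁅k⁆ Lhat) (hιt_inj : Function.Injective ιt)
    (hιt_range : ∀ z : Lhat, (∃ w : Ltil, ιt w = z) ↔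
      z ∈ (LinearMap.range ι ⊔ Submodule.span k {c} : Submodule k Lhat))
    -- the canonical copy of L(𝔤)_S inside L̃(𝔤)_S
    (ι' : Lg →ₗ[k] Ltil) (hι' : ∀ l : Lg, ιt (ι' l) = ι l) :
    (∀ z : Ltil, (∀ w : Ltil, ⁅z, w⁆ = 0) ↔ ∃ a : k, ιt z = a • c) ∧
    ∃ Λ : (Ltil ≃ₗ⁅k⁆ Ltil) ≃ (Lg ≃ₗ⁅k⁆ Lg),
      (∀ ψ₁ ψ₂ : Ltil ≃ₗ⁅k⁆ Ltil, Λ (ψ₁.trans ψ₂) = (Λ ψ₁).trans (Λ ψ₂)) ∧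
      (∀ (ψ : Ltil ≃ₗ⁅k⁆ Ltil) (l : Lg),
        ∃ μ : k, ιt (ψ (ι' l)) = ι ((Λ ψ) l) + μ • c) := by
  let U : (ℤ →₀ 𝔤) ≃ₗ[k] Lg := LinearEquiv.ofBijective (Finsupp.lsum k u)
    ⟨(injective_iff_map_eq_zero _).mpr hu_ind, fun l => (hu_span l).imp fun _ h => h.symm⟩
  have hU_single (p : ℤ) (y : 𝔤) : U (.single p y) = u p y :=
    Finsupp.lsum_single k u p y
  have hU : IsLoopPresentation U := fun p q y z => by simp only [hU_single, hu_bracket]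
  obtain ⟨ct, hct⟩ := (hιt_range c).mpr
    (Submodule.mem_sup_right (Submodule.mem_span_singleton_self c))
  have hct_lie (w : Ltil) : ⁅ct, w⁆ = 0 := hιt_inj (by rw [LieHom.map_lie, hct, hc, map_zero])
  have hlie_ct (w : Ltil) : ⁅w, ct⁆ = 0 := by rw [← lie_skew, hct_lie, neg_zero]
  let e₀ : Lg × k →ₗ[k] Ltil := ι'.coprod (LinearMap.toSpanSingleton k Ltil ct)
  have he₀ (X : Lg × k) : ιt (e₀ X) = ι X.1 + X.2 • c := by simp [e₀, hι', hct]
  have he₀_bij : Function.Bijective e₀ := by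
    refine ⟨(injective_iff_map_eq_zero _).mpr fun X hX => ?_, fun w => ?_⟩
    · have h := he₀ X
      rw [hX, map_zero] at h
      obtain ⟨h₁, h₂, -⟩ := huniq X.1 X.2 0 (by rw [← h, zero_smul, zero_add])
      exact Prod.ext h₁ h₂
    · obtain ⟨_, ⟨l, rfl⟩, _, ha, h⟩ := Submodule.mem_sup.mp ((hιt_range (ιt w)).mp ⟨w, rfl⟩)
      obtain ⟨a, rfl⟩ := Submodule.mem_span_singleton.mp ha
      exact ⟨(l, a), hιt_inj (by rw [he₀, h])⟩
  let e : (Lg × k) ≃ₗ[k] Ltil := LinearEquiv.ofBijective e₀ he₀_bij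
  have he_apply (X : Lg × k) : e X = ι' X.1 + X.2 • ct := by simp [e, e₀]
  have hιt_e (X : Lg × k) : ιt (e X) = ι X.1 + X.2 • c := he₀ X
  have hbr' (p q : ℤ) (y z : 𝔤) : ⁅ι' (u p y), ι' (u q z)⁆ =
      e (⁅u p y, u q z⁆, if p + q = 0 then (p : k) * killingForm k 𝔤 y z else 0) :=
    hιt_inj (by rw [LieHom.map_lie, hι', hι', hbr, hιt_e, hu_bracket])
  let B : Lg →ₗ[k] Lg →ₗ[k] Lg × k := LinearMap.mk₂ k (fun x y => e.symm ⁅ι' x, ι' y⁆)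
    (by simp) (by simp) (by simp) (by simp)
  have hB (x y : Lg) : B x y = e.symm ⁅ι' x, ι' y⁆ := rfl
  let ω : Lg →ₗ[k] Lg →ₗ[k] k := B.compr₂ (LinearMap.snd k Lg k)
  have hB_single (p q : ℤ) (y z : 𝔤) : B (U (.single p y)) (U (.single q z)) =
      (⁅U (.single p y), U (.single q z)⁆,
        if p + q = 0 then (p : k) * killingForm k 𝔤 y z else 0) := by
    rw [hU_single, hU_single, hB, hbr', e.symm_apply_apply]
  have hω : IsAffineCocycle U ω := fun p q y z => congrArg Prod.snd (hB_single p q y z)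
  have hB_fst : B.compr₂ (LinearMap.fst k Lg k) = LinearMap.mk₂ k (fun x y : Lg => ⁅x, y⁆)
      (by simp) (by simp) (by simp) (by simp) :=
    IsLoopPresentation.bilin_ext (U := U) fun p q y z =>
      congrArg Prod.fst (hB_single p q y z)
  have he : IsCocycleExtension ω e := fun X Y => by
    have h : B X.1 Y.1 = (⁅X.1, Y.1⁆, ω X.1 Y.1) :=
      Prod.ext (LinearMap.congr_fun₂ hB_fst X.1 Y.1) rfl
    rw [← h, hB, e.apply_symm_apply, he_apply, he_apply]
    simp [hct_lie, hlie_ct]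
  have hL := hU.eq_zero_of_lie_eq_zero
  have hbij : Function.Bijective (he.autProj hL) :=
    ⟨he.autProj_injective hL (hU.span_lie_eq_top_s16 hω he),
      he.autProj_surjective hL (hU.exists_aut_cocycle_eq hω he.self_eq_zero he.leibniz)⟩
  refine ⟨fun z => ?_, Equiv.ofBijective _ hbij, he.autProj_trans hL, fun ψ l => ?_⟩
  · rw [he.forall_lie_eq_zero_iff hL]
    obtain ⟨⟨l, a⟩, rfl⟩ := e.surjective z
    simp only [e.symm_apply_apply, hιt_e]
    refine ⟨fun h => ⟨a, by rw [h, map_zero, zero_add]⟩, fun ⟨b, h⟩ => ?_⟩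
    refine (huniq l (a - b) 0 ?_).1
    rw [zero_smul, add_zero, sub_smul, ← add_sub_assoc, h, sub_self]
  · obtain ⟨X, hX⟩ := e.surjective (ψ (e (l, 0)))
    refine ⟨X.2, ?_⟩
    have h : ι' l = e (l, 0) := by simp [he_apply]
    rw [h, ← hX, hιt_e, Equiv.ofBijective_apply, he.autProj_apply, ← hX, he.proj_apply]
end
end

section
/- For every k-Lie algebra automorphism φ of the loop algebra L(𝔤)_S there is a unique k-algebra automorphism θ of S such that φ(a·l) = θ(a)·φ(l) for all a ∈ S and l ∈ L(𝔤)_S. Consequently the assignment φ ↦ θ is a split surjective group homomorphism Aut_{k-Lie}(L(𝔤)_S) → Aut_{k-alg}(S) with kernel the group Aut_{S-Lie}(L(𝔤)_S) of S-linear Lie automorphisms, so that Aut_{k-Lie}(L(𝔤)_S) ≅ Aut_{S-Lie}(L(𝔤)_S) ⋊ Aut_{k-alg}(S). -/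
open LaurentPolynomial TensorProduct

noncomputable section

namespace LieAlgebra

/-- Schur's lemma for the adjoint representation: over an algebraically closed field the centroid
of a finite-dimensional simple Lie algebra consists of the scalars. -/
theorem IsSimple.exists_eq_smul_of_map_lie_s17 {k 𝔤 : Type*} [Field k] [IsAlgClosed k] [LieRing 𝔤]
    [LieAlgebra k 𝔤] [FiniteDimensional k 𝔤] [IsSimple k 𝔤] (f : 𝔤 →ₗ[k] 𝔤)
    (hf : ∀ x y : 𝔤, f ⁅x, y⁆ = ⁅x, f y⁆) : ∃ c : k, ∀ y, f y = c • y := by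
  have := IsSimple.nontrivial k 𝔤
  obtain ⟨c, hc⟩ := Module.End.exists_eigenvalue f
  let I : LieIdeal k 𝔤 :=
    { Module.End.eigenspace f c with
      lie_mem := by
        intro x m hm
        have hm' : f m = c • m := Module.End.mem_eigenspace_iff.mp hm
        exact Module.End.mem_eigenspace_iff.mpr (by rw [hf, hm', lie_smul]) }
  have hI : ∀ y, y ∈ I ↔ f y = c • y := fun y ↦ Module.End.mem_eigenspace_iff
  refine ⟨c, fun y ↦ (hI y).mp ?_⟩
  rcases IsSimple.eq_bot_or_eq_top (R := k) I with h | h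
  · obtain ⟨v, hv⟩ := hc.exists_hasEigenvector
    have hvI : v ∈ I := (hI v).mpr hv.apply_eq_smul
    rw [h, LieSubmodule.mem_bot] at hvI
    exact absurd hvI hv.2
  · rw [h]
    exact LieSubmodule.mem_top y

/-- A simple Lie algebra is spanned by brackets. -/
theorem IsSimple.span_lie_eq_top_s17 (k 𝔤 : Type*) [Field k] [LieRing 𝔤] [LieAlgebra k 𝔤]
    [IsSimple k 𝔤] :
    Submodule.span k {z : 𝔤 | ∃ x y : 𝔤, ⁅x, y⁆ = z} = ⊤ := by
  have h : ⁅(⊤ : LieIdeal k 𝔤), (⊤ : LieIdeal k 𝔤)⁆ = ⊤ := by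
    refine (IsSimple.eq_bot_or_eq_top (R := k) _).resolve_left fun h ↦ ?_
    refine IsSimple.non_abelian k (L := 𝔤) ⟨fun x y ↦ ?_⟩
    exact (LieSubmodule.lie_eq_bot_iff _ _).mp h x (LieSubmodule.mem_top x) y
      (LieSubmodule.mem_top y)
  have h' := LieSubmodule.lieIdeal_oper_eq_linear_span' (⊤ : LieIdeal k 𝔤) (⊤ : LieIdeal k 𝔤)
  rw [h] at h'
  simpa using h'.symm

end LieAlgebra

/-- The maps `u p : y ↦ y ⊗ sᵖ` exhibit `Lg` as the loop algebra of `𝔤`. -/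
structure IsLoopAlgebra {k 𝔤 Lg : Type*} [Field k] [LieRing 𝔤] [LieAlgebra k 𝔤] [LieRing Lg]
    [LieAlgebra k[T;T⁻¹] Lg] [LieAlgebra k Lg] (u : ℤ → 𝔤 →ₗ[k] Lg) : Prop where
  lie : ∀ (p q : ℤ) (y z : 𝔤), ⁅u p y, u q z⁆ = u (p + q) ⁅y, z⁆
  T_one_smul : ∀ (p : ℤ) (y : 𝔤), (T 1 : k[T;T⁻¹]) • u p y = u (p + 1) y
  span : ∀ l : Lg, ∃ f : ℤ →₀ 𝔤, l = f.sum fun i yi => u i yi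
  ind : ∀ f : ℤ →₀ 𝔤, (f.sum fun i yi => u i yi) = 0 → f = 0

namespace IsLoopAlgebra

variable {k 𝔤 Lg : Type*} [Field k] [LieRing 𝔤] [LieAlgebra k 𝔤] [LieRing Lg]
  [LieAlgebra k[T;T⁻¹] Lg] [LieAlgebra k Lg] {u : ℤ → 𝔤 →ₗ[k] Lg}

/-- The coefficients of an element of the loop algebra. -/
def coeff (hu : IsLoopAlgebra u) : Lg ≃ₗ[k] (ℤ →₀ 𝔤) :=
  (LinearEquiv.ofBijective (Finsupp.lsum k u)
    ⟨(injective_iff_map_eq_zero _).mpr fun f hf ↦ hu.ind f hf,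
      fun l ↦ (hu.span l).imp fun _ hf ↦ hf.symm⟩).symm

theorem coeff_symm_apply (hu : IsLoopAlgebra u) (f : ℤ →₀ 𝔤) :
    hu.coeff.symm f = f.sum fun i yi => u i yi := rfl

@[simp]
theorem coeff_apply (hu : IsLoopAlgebra u) (p : ℤ) (y : 𝔤) :
    hu.coeff (u p y) = Finsupp.single p y := by
  rw [← LinearEquiv.eq_symm_apply, coeff_symm_apply]
  exact (Finsupp.sum_single_index (h := fun i yi ↦ u i yi) (map_zero (u p))).symm

theorem T_smul (hu : IsLoopAlgebra u) (n p : ℤ) (y : 𝔤) :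
    (T n : k[T;T⁻¹]) • u p y = u (p + n) y := by
  induction n generalizing p with
  | zero => simp
  | succ n ih => rw [T_add, mul_smul, hu.T_one_smul, ih]; congr 2; ring
  | pred n ih =>
    have h : u p y = (T 1 : k[T;T⁻¹]) • u (p - 1) y := by rw [hu.T_one_smul, sub_add_cancel]
    rw [h, smul_smul, ← T_add, sub_add_cancel, ih]
    congr 2; ring

theorem induction (hu : IsLoopAlgebra u) {P : Lg → Prop} (zero : P 0)
    (add : ∀ l m, P l → P m → P (l + m)) (gen : ∀ p y, P (u p y)) (l : Lg) : P l := by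
  obtain ⟨f, rfl⟩ := hu.span l
  exact Finset.sum_induction _ P add zero fun i _ ↦ gen i _

variable [IsScalarTower k k[T;T⁻¹] Lg]

theorem C_mul_T_smul (hu : IsLoopAlgebra u) (c : k) (n p : ℤ) (y : 𝔤) :
    (C c * T n : k[T;T⁻¹]) • u p y = u (p + n) (c • y) := by
  rw [mul_smul, hu.T_smul, C_eq_algebraMap, algebraMap_smul, map_smul]

theorem coeff_smul_apply (hu : IsLoopAlgebra u) (a : k[T;T⁻¹]) (y : 𝔤) (i : ℤ) :
    hu.coeff (a • u 0 y) i = a.coeff i • y := by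
  induction a using LaurentPolynomial.induction_on' with
  | add p q hp hq => simp [add_smul, hp, hq]
  | C_mul_T n c =>
    rw [hu.C_mul_T_smul, zero_add, coeff_apply, ← single_eq_C_mul_T, AddMonoidAlgebra.coeff_single]
    by_cases h : n = i <;> simp [h]

/-- The scalars act faithfully on the loop algebra. -/
theorem eq_of_smul_eq [Nontrivial 𝔤] (hu : IsLoopAlgebra u) {a b : k[T;T⁻¹]}
    (h : ∀ l : Lg, a • l = b • l) : a = b := by
  obtain ⟨y, hy⟩ := exists_ne (0 : 𝔤)
  ext i
  refine smul_left_injective k hy ?_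
  simp only [← hu.coeff_smul_apply, h]

/-- The centroid of the loop algebra of a simple Lie algebra consists of the scalars. -/
theorem exists_eq_smul_of_map_lie_s17 [IsAlgClosed k] [FiniteDimensional k 𝔤]
    [LieAlgebra.IsSimple k 𝔤] (hu : IsLoopAlgebra u) (χ : Lg →ₗ[k] Lg)
    (hχ : ∀ x y : Lg, χ ⁅x, y⁆ = ⁅x, χ y⁆) : ∃ a : k[T;T⁻¹], ∀ l, χ l = a • l := by
  have := LieAlgebra.IsSimple.nontrivial k 𝔤
  have coeff_lie : ∀ (x : 𝔤) (l : Lg) (i : ℤ), hu.coeff ⁅u 0 x, l⁆ i = ⁅x, hu.coeff l i⁆ := by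
    intro x l i
    induction l using hu.induction with
    | zero => simp
    | add l m hl hm => simp [hl, hm]
    | gen p y =>
      rw [hu.lie, zero_add, coeff_apply, coeff_apply]
      by_cases h : p = i <;> simp [h]
  have hscal : ∀ i : ℤ, ∃ c : k, ∀ y, hu.coeff (χ (u 0 y)) i = c • y := fun i ↦
    LieAlgebra.IsSimple.exists_eq_smul_of_map_lie_s17
      (Finsupp.lapply i ∘ₗ hu.coeff.toLinearMap ∘ₗ χ ∘ₗ u 0) fun x y ↦ by
        have h : u 0 ⁅x, y⁆ = ⁅u 0 x, u 0 y⁆ := by rw [hu.lie, add_zero]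
        simp [h, hχ, coeff_lie]
  choose c hc using hscal
  obtain ⟨y₀, hy₀⟩ := exists_ne (0 : 𝔤)
  let a : k[T;T⁻¹] := .ofCoeff <| Finsupp.ofSupportFinite c <|
    (hu.coeff (χ (u 0 y₀))).support.finite_toSet.subset fun i hi ↦ by
      simpa [hc, hy₀] using hi
  have h0 : ∀ y, χ (u 0 y) = a • u 0 y := fun y ↦ by
    refine hu.coeff.injective (Finsupp.ext fun i ↦ ?_)
    rw [hc, hu.coeff_smul_apply]
    rfl
  refine ⟨a, fun l ↦ ?_⟩
  induction l using hu.induction with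
  | zero => simp
  | add l m hl hm => rw [map_add, hl, hm, smul_add]
  | gen p y =>
    have hy : y ∈ Submodule.span k {z : 𝔤 | ∃ x y : 𝔤, ⁅x, y⁆ = z} := by
      rw [LieAlgebra.IsSimple.span_lie_eq_top_s17]
      trivial
    induction hy using Submodule.span_induction with
    | mem z hz =>
      obtain ⟨x, y, rfl⟩ := hz
      have h : u p ⁅x, y⁆ = ⁅u p x, u 0 y⁆ := by rw [hu.lie, add_zero]
      rw [h, hχ, h0, lie_smul]
    | zero => simp
    | add y z _ _ hy hz => rw [map_add, map_add, hy, hz, smul_add]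
    | smul c y _ hy =>
      rw [map_smul, map_smul, hy, ← algebraMap_smul k[T;T⁻¹] c (a • u p y),
        ← algebraMap_smul k[T;T⁻¹] c (u p y), smul_comm]

theorem exists_semilinear [IsAlgClosed k] [FiniteDimensional k 𝔤]
    [LieAlgebra.IsSimple k 𝔤] (hu : IsLoopAlgebra u) (φ : Lg ≃ₗ⁅k⁆ Lg) :
    ∃ θ : k[T;T⁻¹] ≃ₐ[k] k[T;T⁻¹], ∀ a l, φ (a • l) = θ a • φ l := by
  have := LieAlgebra.IsSimple.nontrivial k 𝔤
  have key : ∀ (ψ : Lg ≃ₗ⁅k⁆ Lg) (a : k[T;T⁻¹]), ∃ b : k[T;T⁻¹], ∀ l, ψ (a • l) = b • ψ l := by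
    intro ψ a
    let χ : Lg →ₗ[k] Lg :=
      { toFun l := ψ (a • ψ.symm l)
        map_add' l m := by rw [map_add, smul_add, map_add]
        map_smul' c l := by
          rw [map_smul ψ.symm c l, ← algebraMap_smul k[T;T⁻¹] c (ψ.symm l), smul_comm,
            algebraMap_smul, map_smul ψ c, RingHom.id_apply] }
    obtain ⟨b, hb⟩ := hu.exists_eq_smul_of_map_lie_s17 χ fun x y ↦ by
      change ψ (a • ψ.symm ⁅x, y⁆) = ⁅x, ψ (a • ψ.symm y)⁆
      rw [LieEquiv.map_lie, ← lie_smul, LieEquiv.map_lie, LieEquiv.apply_symm_apply]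
    refine ⟨b, fun l ↦ ?_⟩
    have h := hb (ψ l)
    change ψ (a • ψ.symm (ψ l)) = _ at h
    rwa [LieEquiv.symm_apply_apply] at h
  choose m hm using key
  have faithful : ∀ (ψ : Lg ≃ₗ⁅k⁆ Lg) {a b : k[T;T⁻¹]}, (∀ l, a • ψ l = b • ψ l) → a = b :=
    fun ψ _ _ h ↦ hu.eq_of_smul_eq fun l ↦ by simpa using h (ψ.symm l)
  have inv : ∀ (ψ : Lg ≃ₗ⁅k⁆ Lg) a, m ψ.symm (m ψ a) = a := fun ψ a ↦
    hu.eq_of_smul_eq fun l ↦ by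
      have h := hm ψ.symm (m ψ a) (ψ l)
      rwa [← hm, LieEquiv.symm_apply_apply, LieEquiv.symm_apply_apply, eq_comm] at h
  refine ⟨{ toFun := m φ
            invFun := m φ.symm
            left_inv := inv φ
            right_inv := inv φ.symm
            map_mul' := fun a b ↦ ?_
            map_add' := fun a b ↦ ?_
            commutes' := fun c ↦ ?_ }, hm φ⟩
  · refine faithful φ fun l ↦ ?_
    rw [← hm, mul_smul, mul_smul, hm, hm]
  · refine faithful φ fun l ↦ ?_
    rw [← hm, add_smul, add_smul, map_add, hm, hm]
  · refine faithful φ fun l ↦ ?_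
    rw [← hm, algebraMap_smul, algebraMap_smul, map_smul]

/-- The `k`-linear endomorphism `1 ⊗ θ` of the loop algebra. -/
def mapScalars (hu : IsLoopAlgebra u) (θ : k[T;T⁻¹] ≃ₐ[k] k[T;T⁻¹]) : Lg →ₗ[k] Lg :=
  Finsupp.lsum k (fun i ↦
    { toFun y := θ (T i) • u 0 y
      map_add' y z := by rw [map_add, smul_add]
      map_smul' c y := by
        rw [map_smul, ← algebraMap_smul k[T;T⁻¹] c (u 0 y), smul_comm, algebraMap_smul,
          RingHom.id_apply] : 𝔤 →ₗ[k] Lg }) ∘ₗ hu.coeff.toLinearMap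

theorem mapScalars_apply (hu : IsLoopAlgebra u) (θ : k[T;T⁻¹] ≃ₐ[k] k[T;T⁻¹]) (p : ℤ) (y : 𝔤) :
    hu.mapScalars θ (u p y) = θ (T p) • u 0 y := by
  simp [mapScalars]

theorem mapScalars_smul_zero (hu : IsLoopAlgebra u) (θ : k[T;T⁻¹] ≃ₐ[k] k[T;T⁻¹])
    (a : k[T;T⁻¹]) (y : 𝔤) : hu.mapScalars θ (a • u 0 y) = θ a • u 0 y := by
  induction a using LaurentPolynomial.induction_on' with
  | add p q hp hq => simp [add_smul, hp, hq]
  | C_mul_T n c =>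
    rw [mul_smul, C_eq_algebraMap, algebraMap_smul, map_smul, hu.T_smul, zero_add,
      mapScalars_apply, map_mul, AlgEquiv.commutes, mul_smul, algebraMap_smul]

theorem mapScalars_smul (hu : IsLoopAlgebra u) (θ : k[T;T⁻¹] ≃ₐ[k] k[T;T⁻¹])
    (a : k[T;T⁻¹]) (l : Lg) : hu.mapScalars θ (a • l) = θ a • hu.mapScalars θ l := by
  induction l using hu.induction with
  | zero => simp
  | add l m hl hm => rw [smul_add, map_add, map_add, hl, hm, smul_add]
  | gen p y =>
    have h : u p y = (T p : k[T;T⁻¹]) • u 0 y := by rw [hu.T_smul, zero_add]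
    rw [h, smul_smul, mapScalars_smul_zero, mapScalars_smul_zero, map_mul, mul_smul]

theorem mapScalars_lie (hu : IsLoopAlgebra u) (θ : k[T;T⁻¹] ≃ₐ[k] k[T;T⁻¹]) (l m : Lg) :
    hu.mapScalars θ ⁅l, m⁆ = ⁅hu.mapScalars θ l, hu.mapScalars θ m⁆ := by
  induction l using hu.induction with
  | zero => simp
  | add l l' hl hl' => simp [hl, hl']
  | gen p y =>
    induction m using hu.induction with
    | zero => simp
    | add l l' hl hl' => simp [hl, hl']
    | gen q z =>
      rw [hu.lie, mapScalars_apply, mapScalars_apply, mapScalars_apply, smul_lie, lie_smul,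
        hu.lie, add_zero, smul_smul, T_add, map_mul]

theorem mapScalars_trans (hu : IsLoopAlgebra u) (θ₁ θ₂ : k[T;T⁻¹] ≃ₐ[k] k[T;T⁻¹]) (l : Lg) :
    hu.mapScalars (θ₁.trans θ₂) l = hu.mapScalars θ₂ (hu.mapScalars θ₁ l) := by
  induction l using hu.induction with
  | zero => simp
  | add l m hl hm => simp [hl, hm]
  | gen p y =>
    rw [mapScalars_apply, mapScalars_apply, mapScalars_smul_zero, AlgEquiv.trans_apply]

theorem mapScalars_refl (hu : IsLoopAlgebra u) (l : Lg) :
    hu.mapScalars AlgEquiv.refl l = l := by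
  induction l using hu.induction with
  | zero => simp
  | add l m hl hm => rw [map_add, hl, hm]
  | gen p y => rw [mapScalars_apply, AlgEquiv.coe_refl, id, hu.T_smul, zero_add]

/-- The `k`-Lie automorphism `1 ⊗ θ` of the loop algebra. -/
def mapScalarsEquiv (hu : IsLoopAlgebra u) (θ : k[T;T⁻¹] ≃ₐ[k] k[T;T⁻¹]) : Lg ≃ₗ⁅k⁆ Lg :=
  { hu.mapScalars θ with
    map_lie' := hu.mapScalars_lie θ _ _
    invFun := hu.mapScalars θ.symm
    left_inv := fun l ↦ by
      change hu.mapScalars θ.symm (hu.mapScalars θ l) = l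
      rw [← mapScalars_trans, AlgEquiv.self_trans_symm, mapScalars_refl]
    right_inv := fun l ↦ by
      change hu.mapScalars θ (hu.mapScalars θ.symm l) = l
      rw [← mapScalars_trans, AlgEquiv.symm_trans_self, mapScalars_refl] }

end IsLoopAlgebra

/-- Every `k`-Lie automorphism `φ` of the loop algebra `L(𝔤)_S` is
`θ`-semilinear for a unique `k`-algebra automorphism `θ` of `S = k[s^{±1}]`; the
assignment `φ ↦ θ` is a split surjective group homomorphism with kernel the `S`-linear
automorphisms, so `Aut_{k-Lie}(L(𝔤)_S) ≅ Aut_{S-Lie}(L(𝔤)_S) ⋊ Aut_{k-alg}(S)`. -/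
theorem loop_automorphisms_semilinear
    -- the base field
    (k : Type) [Field k] [IsAlgClosed k] [CharZero k]
    -- the simple finite-dimensional Lie algebra 𝔤
    (𝔤 : Type) [LieRing 𝔤] [LieAlgebra k 𝔤] [FiniteDimensional k 𝔤]
    [LieAlgebra.IsSimple k 𝔤]
    -- the loop algebra L(𝔤)_S = 𝔤 ⊗_k S, an S-Lie algebra for S = k[s^{±1}];
    -- `u p y` represents `y ⊗ sᵖ`
    (Lg : Type) [LieRing Lg] [LieAlgebra (LaurentPolynomial k) Lg]
    [LieAlgebra k Lg] [IsScalarTower k (LaurentPolynomial k) Lg]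
    (u : ℤ → 𝔤 →ₗ[k] Lg)
    (hu_bracket : ∀ (p q : ℤ) (y z : 𝔤), ⁅u p y, u q z⁆ = u (p + q) ⁅y, z⁆)
    (hu_s : ∀ (p : ℤ) (y : 𝔤), (T 1 : LaurentPolynomial k) • u p y = u (p + 1) y)
    (hu_span : ∀ l : Lg, ∃ f : ℤ →₀ 𝔤, l = f.sum fun i yi => u i yi)
    (hu_ind : ∀ f : ℤ →₀ 𝔤, (f.sum fun i yi => u i yi) = 0 → f = 0) :
    ∃ Θ : (Lg ≃ₗ⁅k⁆ Lg) → (LaurentPolynomial k ≃ₐ[k] LaurentPolynomial k),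
      (∀ (φ : Lg ≃ₗ⁅k⁆ Lg) (a : LaurentPolynomial k) (l : Lg),
        φ (a • l) = Θ φ a • φ l) ∧
      (∀ (φ : Lg ≃ₗ⁅k⁆ Lg) (θ' : LaurentPolynomial k ≃ₐ[k] LaurentPolynomial k),
        (∀ (a : LaurentPolynomial k) (l : Lg), φ (a • l) = θ' a • φ l) → θ' = Θ φ) ∧
      (∀ φ₁ φ₂ : Lg ≃ₗ⁅k⁆ Lg, Θ (φ₁.trans φ₂) = (Θ φ₁).trans (Θ φ₂)) ∧
      (∃ sec : (LaurentPolynomial k ≃ₐ[k] LaurentPolynomial k) → (Lg ≃ₗ⁅k⁆ Lg),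
        (∀ θ₁ θ₂, sec (θ₁.trans θ₂) = (sec θ₁).trans (sec θ₂)) ∧
        ∀ θ, Θ (sec θ) = θ) ∧
      (∀ φ : Lg ≃ₗ⁅k⁆ Lg,
        Θ φ = AlgEquiv.refl ↔
          ∀ (a : LaurentPolynomial k) (l : Lg), φ (a • l) = a • φ l) := by
  have hu : IsLoopAlgebra u := ⟨hu_bracket, hu_s, hu_span, hu_ind⟩
  have := LieAlgebra.IsSimple.nontrivial k 𝔤
  choose Θ hΘ using fun φ : Lg ≃ₗ⁅k⁆ Lg ↦ hu.exists_semilinear φ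
  have uniq : ∀ (φ : Lg ≃ₗ⁅k⁆ Lg) (θ' : LaurentPolynomial k ≃ₐ[k] LaurentPolynomial k),
      (∀ (a : LaurentPolynomial k) (l : Lg), φ (a • l) = θ' a • φ l) → θ' = Θ φ := by
    intro φ θ' h
    refine AlgEquiv.ext fun a ↦ hu.eq_of_smul_eq fun l ↦ ?_
    have h' := (h a (φ.symm l)).symm.trans (hΘ φ a (φ.symm l))
    rwa [LieEquiv.apply_symm_apply] at h'
  refine ⟨Θ, hΘ, uniq, fun φ₁ φ₂ ↦ ?_, ⟨hu.mapScalarsEquiv, fun θ₁ θ₂ ↦ ?_, fun θ ↦ ?_⟩,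
    fun φ ↦ ⟨fun h a l ↦ ?_, fun h ↦ (uniq φ _ h).symm⟩⟩
  · refine (uniq _ _ fun a l ↦ ?_).symm
    rw [LieEquiv.trans_apply, LieEquiv.trans_apply, hΘ, hΘ, AlgEquiv.trans_apply]
  · exact LieEquiv.ext fun l ↦ hu.mapScalars_trans θ₁ θ₂ l
  · exact (uniq _ _ fun a l ↦ hu.mapScalars_smul θ a l).symm
  · rw [hΘ, h, AlgEquiv.coe_refl, id]
end
end

section
/- Every R-linear Lie algebra automorphism of the twisted loop algebra lifts to the twisted affine Kac–Moody algebra: for every automorphism f of L(𝔤,σ) as an R-Lie algebra, there exists a k-Lie algebra automorphism φ of L̂(𝔤,σ) such that φ restricts to an automorphism of the derived subalgebra L̃(𝔤,σ) = L(𝔤,σ) ⊕ kc and the automorphism of L(𝔤,σ) ≅ L̃(𝔤,σ)/kc induced by this restriction equals f. -/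
open LaurentPolynomial TensorProduct

noncomputable section

/-- Over an algebraically closed field of characteristic zero, a linear map of finite order dividing
`m` admits a basis of eigenvectors whose eigenvalues are powers of a primitive `m`-th root of
unity. -/
theorem exists_eigenbasis_of_iterate_eq {k V : Type*} [Field k] [IsAlgClosed k] [CharZero k]
    [AddCommGroup V] [Module k V] [FiniteDimensional k V] {m : ℕ} (hm : 0 < m)
    (A : Module.End k V) (hA : ∀ y, (⇑A)^[m] y = y) {ζ : k} (hζ : IsPrimitiveRoot ζ m) :
    ∃ (n : ℕ) (b : Module.Basis (Fin n) k V) (p : Fin n → ℤ), ∀ i, A (b i) = ζ ^ p i • b i := by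
  have hpow : A ^ m = 1 := by
    ext y
    simpa [Module.End.pow_apply] using hA y
  have hss : A.IsSemisimple := by
    refine Module.End.isSemisimple_of_squarefree_aeval_eq_zero (p := Polynomial.X ^ m - 1) ?_ ?_
    · refine Polynomial.Separable.squarefree ?_
      exact Polynomial.separable_X_pow_sub_C 1 (by exact_mod_cast hm.ne') one_ne_zero
    · simp [hpow]
  have htop : ⨆ μ, A.eigenspace μ = ⊤ := by
    rw [← Module.End.iSup_maxGenEigenspace_eq_top A]
    simp_rw [hss.isFinitelySemisimple.maxGenEigenspace_eq_eigenspace]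
  let s : Set V := {v | ∃ i : ℤ, A v = ζ ^ i • v}
  have hs : ⊤ ≤ Submodule.span k s := by
    rw [← htop, iSup_le_iff]
    intro μ v hv
    rcases eq_or_ne v 0 with rfl | hv0
    · exact zero_mem _
    · have hiter : (A ^ m) v = μ ^ m • v := by
        have hev : A.HasEigenvector μ v := ⟨hv, hv0⟩
        exact hev.pow_apply m
      rw [hpow, Module.End.one_apply] at hiter
      have hμ : μ ^ m = 1 := by
        by_contra h
        have : (μ ^ m - 1) • v = 0 := by rw [sub_smul, ← hiter, one_smul, sub_self]
        exact (smul_eq_zero.mp this).elim (fun h' => h (sub_eq_zero.mp h')) hv0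
      have : NeZero m := ⟨hm.ne'⟩
      obtain ⟨i, -, hi⟩ := hζ.eq_pow_of_pow_eq_one hμ
      refine Submodule.subset_span ⟨i, ?_⟩
      rw [zpow_natCast, hi]
      exact Module.End.mem_eigenspace_iff.mp hv
  let b₀ := Module.Basis.ofSpan hs
  have : Finite ↑((linearIndepOn_empty k id).extend (Set.empty_subset s)) :=
    Module.Finite.finite_basis b₀
  obtain ⟨n, ⟨e⟩⟩ := Finite.exists_equiv_fin
    ↑((linearIndepOn_empty k id).extend (Set.empty_subset s))
  have hb : ∀ i, b₀ i ∈ s := fun i => Module.Basis.ofSpan_subset hs ⟨i, rfl⟩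
  choose p hp using hb
  exact ⟨n, b₀.reindex e, fun i => p (e.symm i), fun i => by simpa using hp (e.symm i)⟩

/-- If the Killing form of a finite free Lie algebra over a commutative ring admits a basis with a
dual family, then every derivation is inner. -/
theorem LieDerivation.exists_eq_lie_of_killingForm_dual {R L ι : Type*} [CommRing R] [LieRing L]
    [LieAlgebra R L] [Fintype ι] [DecidableEq ι] (e : Module.Basis ι R L) (e' : ι → L)
    (he : ∀ i j, killingForm R L (e' i) (e j) = if i = j then 1 else 0)
    (δ : LieDerivation R L L) : ∃ z : L, ∀ x, δ x = ⁅z, x⁆ := by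
  have hlie : ∀ (δ : LieDerivation R L L) (x : L),
      LieAlgebra.ad R L (δ x) =
        (δ : L →ₗ[R] L) * LieAlgebra.ad R L x - LieAlgebra.ad R L x * (δ : L →ₗ[R] L) := by
    intro δ x
    ext y
    simp
  have hmap : ∀ x y : L, LieAlgebra.ad R L ⁅x, y⁆ =
      LieAlgebra.ad R L x * LieAlgebra.ad R L y - LieAlgebra.ad R L y * LieAlgebra.ad R L x :=
    fun x y => by ext; simp
  have hzero : ∀ δ : LieDerivation R L L,
      (∀ x, LinearMap.trace R L ((δ : L →ₗ[R] L) * LieAlgebra.ad R L x) = 0) →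
      ∀ x, δ x = 0 := by
    intro δ hδ x
    have hB : ∀ y, killingForm R L y (δ x) = 0 := by
      intro y
      have : LinearMap.trace R L (LieAlgebra.ad R L (δ x) * LieAlgebra.ad R L y) =
          LinearMap.trace R L ((δ : L →ₗ[R] L) * LieAlgebra.ad R L ⁅x, y⁆) := by
        rw [hlie, hmap, sub_mul, mul_sub, map_sub, map_sub,
          ← mul_assoc, ← mul_assoc, LinearMap.trace_mul_cycle R (LieAlgebra.ad R L x)]
        rw [LinearMap.trace_mul_comm R _ (δ : L →ₗ[R] L), mul_assoc, mul_assoc]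
      rw [LieModule.traceForm_comm, killingForm_apply_apply]
      exact this.trans (hδ _)
    rw [← e.sum_repr (δ x)]
    refine Finset.sum_eq_zero fun j _ => ?_
    have h := hB (e' j)
    rw [← e.sum_repr (δ x)] at h
    simp only [map_sum, map_smul, he, smul_eq_mul, mul_ite, mul_one, mul_zero,
      Finset.sum_ite_eq, Finset.mem_univ, if_true] at h
    rw [h, zero_smul]
  let τ : L → R := fun x => LinearMap.trace R L ((δ : L →ₗ[R] L) * LieAlgebra.ad R L x)
  let z : L := ∑ i, τ (e i) • e' i
  have hz : ∀ x, killingForm R L z x = τ x := by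
    let τ' : L →ₗ[R] R :=
      LinearMap.trace R L ∘ₗ LinearMap.mulLeft R (δ : L →ₗ[R] L) ∘ₗ (LieAlgebra.ad R L : L →ₗ[R] _)
    have : killingForm R L z = τ' := by
      refine e.ext fun j => ?_
      simp [z, he, τ, τ']
    exact fun x => LinearMap.congr_fun this x
  refine ⟨z, fun x => ?_⟩
  have := hzero (δ - LieDerivation.ad R L z) (fun x => ?_) x
  · simpa [sub_eq_zero] using this
  · have h := hz x
    rw [killingForm_apply_apply] at h
    have h2 : (((δ - LieDerivation.ad R L z : LieDerivation R L L) : L →ₗ[R] L)) =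
      (δ : L →ₗ[R] L) - LieAlgebra.ad R L z := by ext; simp
    rw [h2, sub_mul, map_sub, sub_eq_zero]
    exact h.symm

/-- Lifting an automorphism `f` of a Lie algebra `L` to the extension `L ⊕ kc ⊕ kd` determined by a
derivation `D` and an invariant symmetric bilinear form `β` preserved by `f`, provided that
`f⁻¹ D f` differs from `D` by an inner derivation. -/
theorem LieEquiv.exists_lift_of_conj_eq_add_inner {k L E : Type*} [CommRing k]
    [LieRing L] [LieAlgebra k L] [LieRing E] [LieAlgebra k E]
    {c d : E} {ι : L →ₗ[k] E} {D : L →ₗ[k] L} {β : L →ₗ[k] L →ₗ[k] k}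
    (hc : ∀ x : E, ⁅c, x⁆ = 0)
    (hd : ∀ x, ⁅d, ι x⁆ = ι (D x))
    (hι : ∀ x y, ⁅ι x, ι y⁆ = ι ⁅x, y⁆ + β (D x) y • c)
    (hdec : ∀ x : E, ∃ (l : L) (a b : k), x = ι l + a • c + b • d)
    (huniq : ∀ (l : L) (a b : k), ι l + a • c + b • d = 0 → l = 0 ∧ a = 0 ∧ b = 0)
    (hinv : ∀ x y z, β ⁅x, y⁆ z = β x ⁅y, z⁆)
    (hsymm : ∀ x y, β x y = β y x)
    (f : L ≃ₗ⁅k⁆ L) (hf : ∀ x y, β (f x) (f y) = β x y)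
    (z : L) (hz : ∀ x, D (f x) = f (D x + ⁅z, x⁆)) :
    ∃ φ : E ≃ₗ⁅k⁆ E,
      (∀ x ∈ (LinearMap.range ι ⊔ Submodule.span k {c} : Submodule k E),
        φ x ∈ (LinearMap.range ι ⊔ Submodule.span k {c} : Submodule k E)) ∧
      ∀ l : L, ∃ μ : k, φ (ι l) = ι (f l) + μ • c := by
  have hself : ∀ x, β (D x) x = 0 := by
    intro x
    have h := hι x x
    rw [lie_self, lie_self, map_zero, zero_add] at h
    exact (huniq 0 (β (D x) x) 0 (by simp [← h])).2.1
  have hskew : ∀ x y, β (D x) y = - β x (D y) := by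
    intro x y
    have h := hself (x + y)
    simp only [map_add, LinearMap.add_apply, hself, zero_add, add_zero] at h
    rw [hsymm x]
    linear_combination h
  let ε₀ : (L × k × k) →ₗ[k] E :=
    ι.coprod ((LinearMap.toSpanSingleton k E c).coprod (LinearMap.toSpanSingleton k E d))
  have hε₀ : ∀ l a b, ε₀ (l, a, b) = ι l + a • c + b • d := by
    intro l a b
    simp [ε₀, add_assoc]
  let ε : (L × k × k) ≃ₗ[k] E := LinearEquiv.ofBijective ε₀ ⟨by
      rw [injective_iff_map_eq_zero]
      rintro ⟨l, a, b⟩ h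
      rw [hε₀] at h
      obtain ⟨rfl, rfl, rfl⟩ := huniq l a b h
      rfl, fun x => by
      obtain ⟨l, a, b, rfl⟩ := hdec x
      exact ⟨(l, a, b), hε₀ l a b⟩⟩
  have hε : ∀ l a b, ε (l, a, b) = ι l + a • c + b • d := hε₀
  have hc' : ∀ x : E, ⁅x, c⁆ = 0 := fun x => by rw [← lie_skew, hc, neg_zero]
  have hd' : ∀ x, ⁅ι x, d⁆ = - ι (D x) := fun x => by rw [← lie_skew, hd]
  have hbr : ∀ l a b l' a' b', ⁅ε (l, a, b), ε (l', a', b')⁆ =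
      ε (⁅l, l'⁆ + b • D l' - b' • D l, β (D l) l', 0) := by
    intro l a b l' a' b'
    simp only [hε, add_lie, lie_add, smul_lie, lie_smul, hc, hc', hd, hd', hι, lie_self, map_add,
      map_sub, map_smul]
    module
  let w : L := -f z
  have hw : ∀ x, f (D x) = D (f x) + ⁅w, f x⁆ := by
    intro x
    simp only [w, hz, map_add, LieEquiv.map_lie, neg_lie, add_neg_cancel_right]
  let F : (L × k × k) ≃ₗ[k] (L × k × k) :=
    { toFun := fun x => (f x.1 + x.2.2 • w, x.2.1 + β z x.1, x.2.2)
      map_add' := by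
        rintro ⟨l, a, b⟩ ⟨l', a', b'⟩
        simp only [Prod.mk_add_mk, map_add, Prod.mk.injEq, and_true]
        exact ⟨by module, by ring⟩
      map_smul' := by
        rintro r ⟨l, a, b⟩
        simp only [Prod.smul_mk, map_smul, RingHom.id_apply, Prod.mk.injEq, and_true, smul_eq_mul]
        exact ⟨by module, by ring⟩
      invFun := fun x =>
        (f.symm (x.1 - x.2.2 • w), x.2.1 - β z (f.symm (x.1 - x.2.2 • w)), x.2.2)
      left_inv := by
        rintro ⟨l, a, b⟩
        simp
      right_inv := by
        rintro ⟨l, a, b⟩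
        simp }
  have hF : ∀ l a b, F (l, a, b) = (f l + b • w, a + β z l, b) := fun _ _ _ => rfl
  let φ : E ≃ₗ⁅k⁆ E :=
    { ε.symm.trans (F.trans ε) with
      map_lie' := by
        intro x y
        obtain ⟨⟨l, a, b⟩, rfl⟩ := ε.surjective x
        obtain ⟨⟨l', a', b'⟩, rfl⟩ := ε.surjective y
        have h1 : D w = - f (D z) := by simp [w, hz]
        have h2 : β z (D l') = - β (D z) l' := by rw [hskew, neg_neg]
        have h3 : β z (D l) = β (D l) z := hsymm _ _
        have h4 : β ⁅z, l⁆ z = 0 := by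
          rw [hinv, ← lie_skew, map_neg, ← hinv, lie_self, map_zero, LinearMap.zero_apply, neg_zero]
        have h5 : β (D w) w = 0 := hself w
        have h6 : β (D w) (f l') = - β (D z) l' := by
          rw [h1, map_neg, LinearMap.neg_apply, hf]
        have h7 : β (D (f l)) w = - β (D l) z := by
          simp only [w]
          rw [map_neg, hz, hf, map_add, LinearMap.add_apply, h4, add_zero]
        have h8 : β (D (f l)) (f l') = β (D l) l' + β z ⁅l, l'⁆ := by
          rw [hz, hf, map_add, LinearMap.add_apply, hinv]
        simp only [LinearEquiv.coe_coe, AddHom.toFun_eq_coe, LinearMap.coe_toAddHom,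
          LinearEquiv.trans_apply, LinearEquiv.symm_apply_apply, hbr, hF]
        congr 1
        refine Prod.ext ?_ (Prod.ext ?_ rfl)
        · simp only [map_add, map_sub, map_smul, hw, LieEquiv.map_lie, add_lie, lie_add, smul_lie,
            lie_smul, lie_self, zero_smul, add_zero, smul_zero]
          rw [← lie_skew w (f l)]
          module
        · simp only [map_add, map_sub, map_smul, LinearMap.add_apply, LinearMap.smul_apply,
            smul_eq_mul, h2, h3, h5, h6, h7, h8]
          ring }
  have hφ : ∀ l a b, φ (ε (l, a, b)) = ε (f l + b • w, a + β z l, b) := by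
    intro l a b
    change ε (F (ε.symm (ε (l, a, b)))) = _
    rw [LinearEquiv.symm_apply_apply, hF]
  have hφι : ∀ l a, φ (ι l + a • c) = ι (f l) + (a + β z l) • c := by
    intro l a
    have h := hφ l a 0
    simpa [hε] using h
  refine ⟨φ, fun x hx => ?_, fun l => ⟨β z l, by simpa using hφι l 0⟩⟩
  obtain ⟨_, ⟨l, rfl⟩, y, hy, rfl⟩ := Submodule.mem_sup.mp hx
  obtain ⟨a, rfl⟩ := Submodule.mem_span_singleton.mp hy
  rw [hφι]
  exact Submodule.add_mem_sup ⟨_, rfl⟩ (Submodule.smul_mem _ _ (Submodule.mem_span_singleton_self c))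

theorem LaurentPolynomial.coeff_C_mul_T {k : Type*} [Semiring k] (a : k) (n q : ℤ) :
    (C a * T n : LaurentPolynomial k).coeff q = if n = q then a else 0 := by
  rw [← single_eq_C_mul_T, AddMonoidAlgebra.coeff_single, Finsupp.single_apply]

/-- `u` realizes the Lie algebra `M` over `R = k[T;T⁻¹]` as the twisted loop algebra of `(𝔤, σ)`:
`u p y` stands for `y ⊗ sᵖ` when `σ y = ζ ^ p • y`, and `T 1` acts as multiplication by `sᵐ`. -/
structure IsTwistedLoopRealization {k 𝔤 M : Type*} [Field k] [LieRing 𝔤] [LieAlgebra k 𝔤]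
    [LieRing M] [LieAlgebra (LaurentPolynomial k) M] [LieAlgebra k M]
    (m : ℕ) (σ : 𝔤 ≃ₗ⁅k⁆ 𝔤) (ζ : k) (u : ℤ → 𝔤 →ₗ[k] M) : Prop where
  lie : ∀ (p q : ℤ) (y z : 𝔤), σ y = ζ ^ p • y → σ z = ζ ^ q • z →
    ⁅u p y, u q z⁆ = u (p + q) ⁅y, z⁆
  T_one_smul : ∀ (p : ℤ) (y : 𝔤), σ y = ζ ^ p • y →
    (T 1 : LaurentPolynomial k) • u p y = u (p + (m : ℤ)) y
  span : ∀ l : M, ∃ f : ℤ →₀ 𝔤, (∀ i, σ (f i) = ζ ^ i • f i) ∧ l = f.sum fun i yi => u i yi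
  ind : ∀ f : ℤ →₀ 𝔤, (∀ i, σ (f i) = ζ ^ i • f i) → (f.sum fun i yi => u i yi) = 0 → f = 0

theorem zpow_add_mul_eq {k : Type*} [Field k] {m : ℕ} (hm : 0 < m) {ζ : k}
    (hζ : IsPrimitiveRoot ζ m) (p n : ℤ) : ζ ^ (p + n * m) = ζ ^ p := by
  rw [zpow_add₀ (hζ.ne_zero hm.ne'), (hζ.zpow_eq_one_iff_dvd _).mpr (dvd_mul_left _ _), mul_one]

theorem IsPrimitiveRoot.dvd_sub_of_zpow_eq {k : Type*} [Field k] {m : ℕ} (hm : 0 < m) {ζ : k}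
    (hζ : IsPrimitiveRoot ζ m) {p q : ℤ} (h : ζ ^ p = ζ ^ q) : (m : ℤ) ∣ p - q := by
  rw [← hζ.zpow_eq_one_iff_dvd, zpow_sub₀ (hζ.ne_zero hm.ne'), h,
    div_self (zpow_ne_zero _ (hζ.ne_zero hm.ne'))]

/-- A nonzero coordinate of an eigenvector in an eigenbasis belongs to the same eigenvalue. -/
theorem dvd_sub_of_repr_ne_zero {k V ι : Type*} [Field k] [AddCommGroup V] [Module k V]
    {m : ℕ} (hm : 0 < m) {ζ : k} (hζ : IsPrimitiveRoot ζ m) [Fintype ι]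
    {b : Module.Basis ι k V} {p : ι → ℤ} {A : V →ₗ[k] V} (hb : ∀ i, A (b i) = ζ ^ p i • b i)
    {r : ℤ} {x : V} (hx : A x = ζ ^ r • x) {i : ι} (hi : b.repr x i ≠ 0) :
    (m : ℤ) ∣ r - p i := by
  refine hζ.dvd_sub_of_zpow_eq hm (mul_right_cancel₀ hi ?_)
  have h1 : b.coord i ∘ₗ A = ζ ^ p i • b.coord i := by
    classical
    refine b.ext fun j => ?_
    simp only [LinearMap.comp_apply, hb, map_smul, LinearMap.smul_apply, Module.Basis.coord_apply,
      Module.Basis.repr_self, smul_eq_mul, Finsupp.single_apply]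
    split_ifs with h
    · rw [h]
    · simp
  have h2 := LinearMap.congr_fun h1 x
  simp only [LinearMap.comp_apply, hx, map_smul, LinearMap.smul_apply, Module.Basis.coord_apply,
    smul_eq_mul] at h2
  exact h2

namespace IsTwistedLoopRealization

variable {k 𝔤 M : Type*} [Field k] [LieRing 𝔤] [LieAlgebra k 𝔤] [LieRing M]
  [LieAlgebra (LaurentPolynomial k) M] [LieAlgebra k M]
  {m : ℕ} {σ : 𝔤 ≃ₗ⁅k⁆ 𝔤} {ζ : k} {u : ℤ → 𝔤 →ₗ[k] M}

theorem induction (hu : IsTwistedLoopRealization m σ ζ u) {P : M → Prop} (zero : P 0)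
    (add : ∀ x y, P x → P y → P (x + y)) (mem : ∀ p y, σ y = ζ ^ p • y → P (u p y)) (l : M) :
    P l := by
  obtain ⟨f, hf, rfl⟩ := hu.span l
  exact Finset.sum_induction _ P add zero fun i _ => mem i _ (hf i)

theorem T_smul (hu : IsTwistedLoopRealization m σ ζ u) (hm : 0 < m) (hζ : IsPrimitiveRoot ζ m)
    (n p : ℤ) {y : 𝔤} (hy : σ y = ζ ^ p • y) :
    (T n : LaurentPolynomial k) • u p y = u (p + n * m) y := by
  have hy' : ∀ n : ℤ, σ y = ζ ^ (p + n * m) • y := fun n => by rw [zpow_add_mul_eq hm hζ, hy]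
  induction n using Int.induction_on with
  | zero => simp
  | succ i ih =>
    rw [add_comm (i : ℤ) 1, T_add, mul_smul, ih, hu.T_one_smul _ _ (hy' _)]
    congr 2
    ring
  | pred i ih =>
    have h := hu.T_one_smul _ _ (hy' (-i - 1))
    rw [show p + (-(i : ℤ) - 1) * m + m = p + -i * m by ring, ← ih] at h
    rw [sub_eq_add_neg, add_comm, T_add, mul_smul, ← h, ← mul_smul, ← T_add]
    simp [sub_eq_add_neg, add_comm]

variable [IsScalarTower k (LaurentPolynomial k) M]

theorem C_mul_T_smul (hu : IsTwistedLoopRealization m σ ζ u) (hm : 0 < m)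
    (hζ : IsPrimitiveRoot ζ m) (a : k) (n p : ℤ) {y : 𝔤} (hy : σ y = ζ ^ p • y) :
    (C a * T n : LaurentPolynomial k) • u p y = u (p + n * m) (a • y) := by
  rw [mul_smul, hu.T_smul hm hζ n p hy, map_smul, C_eq_algebraMap, algebraMap_smul]

section Basis

variable {ι : Type*} [Fintype ι] {b : Module.Basis ι k 𝔤} {p : ι → ℤ}

theorem apply_eq_sum (hu : IsTwistedLoopRealization m σ ζ u) (hm : 0 < m)
    (hζ : IsPrimitiveRoot ζ m) (hb : ∀ i, σ (b i) = ζ ^ p i • b i) {r : ℤ} {x : 𝔤}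
    (hx : σ x = ζ ^ r • x) :
    u r x = ∑ i, (C (b.repr x i) * T ((r - p i) / m) : LaurentPolynomial k) • u (p i) (b i) := by
  conv_lhs => rw [← b.sum_repr x]
  rw [map_sum]
  refine Finset.sum_congr rfl fun i _ => ?_
  rw [hu.C_mul_T_smul hm hζ _ _ _ (hb i)]
  by_cases hi : b.repr x i = 0
  · simp [hi]
  · rw [Int.ediv_mul_cancel (dvd_sub_of_repr_ne_zero (A := (σ : 𝔤 →ₗ[k] 𝔤)) hm hζ hb hx hi),
      add_sub_cancel]

variable [DecidableEq ι]

theorem linearIndependent (hu : IsTwistedLoopRealization m σ ζ u) (hm : 0 < m)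
    (hζ : IsPrimitiveRoot ζ m) (hb : ∀ i, σ (b i) = ζ ^ p i • b i) :
    LinearIndependent (LaurentPolynomial k) fun i => u (p i) (b i) := by
  rw [Fintype.linearIndependent_iff]
  intro g hg i₀
  let Ψ : ι → LaurentPolynomial k → ℤ →₀ 𝔤 := fun i r =>
    r.coeff.sum fun n a => Finsupp.single (p i + n * m) (a • b i)
  have hzero : ∀ i (n : ℤ), Finsupp.single (p i + n * m) ((0 : k) • b i) = 0 := by simp
  have hadd : ∀ i (n : ℤ) (a a' : k), Finsupp.single (p i + n * m) ((a + a') • b i) =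
      Finsupp.single (p i + n * m) (a • b i) + Finsupp.single (p i + n * m) (a' • b i) := by
    intro i n a a'
    rw [add_smul, Finsupp.single_add]
  have hΨadd : ∀ i r r', Ψ i (r + r') = Ψ i r + Ψ i r' := fun i r r' =>
    Finsupp.sum_add_index' (hzero i) (hadd i)
  have hΨ : ∀ i n a, Ψ i (C a * T n) = Finsupp.single (p i + n * m) (a • b i) := by
    intro i n a
    rw [← single_eq_C_mul_T]
    exact Finsupp.sum_single_index (hzero i n)
  have hhom : ∀ i r q, σ (Ψ i r q) = ζ ^ q • Ψ i r q := by
    intro i r q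
    induction r using LaurentPolynomial.induction_on' with
    | add r r' hr hr' => rw [hΨadd, Finsupp.add_apply, map_add, hr, hr', smul_add]
    | C_mul_T n a =>
      rw [hΨ, Finsupp.single_apply]
      split_ifs with h
      · rw [← h, zpow_add_mul_eq hm hζ, map_smul, hb, smul_comm]
      · simp
  have hsum : ∀ i r, Finsupp.lsum k u (Ψ i r) = r • u (p i) (b i) := by
    intro i r
    induction r using LaurentPolynomial.induction_on' with
    | add r r' hr hr' => rw [hΨadd, map_add, hr, hr', add_smul]
    | C_mul_T n a => rw [hΨ, hu.C_mul_T_smul hm hζ _ _ _ (hb i)]; simp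
  have hcoord : ∀ i r j (n : ℤ), b.repr (Ψ i r (p j + n * m)) j = if i = j then r.coeff n else 0 := by
    intro i r j n
    induction r using LaurentPolynomial.induction_on' with
    | add r r' hr hr' =>
      rw [hΨadd, Finsupp.add_apply, map_add, Finsupp.add_apply, hr, hr']
      split_ifs <;> simp
    | C_mul_T n' a =>
      rw [hΨ, Finsupp.single_apply]
      by_cases hij : i = j
      · subst hij
        have hiff : p i + n' * m = p i + n * m ↔ n' = n := by
          rw [add_right_inj, mul_left_inj' (by exact_mod_cast hm.ne')]
        simp only [hiff, if_true, LaurentPolynomial.coeff_C_mul_T]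
        split_ifs <;> simp
      · split_ifs <;> simp [hij]
  have hF : ∑ i, Ψ i (g i) = 0 := by
    refine hu.ind _ (fun q => ?_) ?_
    · simp only [Finsupp.finsetSum_apply, map_sum, hhom, Finset.smul_sum]
    · change Finsupp.lsum k u (∑ i, Ψ i (g i)) = 0
      rw [map_sum]
      simp only [hsum]
      exact hg
  ext n
  have h := congrArg (fun F : ℤ →₀ 𝔤 => b.repr (F (p i₀ + n * m)) i₀) hF
  simpa [Finsupp.finsetSum_apply, hcoord] using h

/-- The basis of the twisted loop algebra over `k[T;T⁻¹]` attached to an eigenbasis of `σ`. -/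
def basis (hu : IsTwistedLoopRealization m σ ζ u) (hm : 0 < m) (hζ : IsPrimitiveRoot ζ m)
    (hb : ∀ i, σ (b i) = ζ ^ p i • b i) : Module.Basis ι (LaurentPolynomial k) M :=
  Module.Basis.mk (hu.linearIndependent hm hζ hb) fun l _ => by
    refine hu.induction (zero_mem _) (fun _ _ => add_mem) (fun r x hx => ?_) l
    rw [hu.apply_eq_sum hm hζ hb hx]
    exact sum_mem fun i _ => Submodule.smul_mem _ _ (Submodule.subset_span ⟨i, rfl⟩)

@[simp]
theorem basis_apply (hu : IsTwistedLoopRealization m σ ζ u) (hm : 0 < m) (hζ : IsPrimitiveRoot ζ m)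
    (hb : ∀ i, σ (b i) = ζ ^ p i • b i) (i : ι) : hu.basis hm hζ hb i = u (p i) (b i) := by
  simp [basis]

theorem basis_repr_apply (hu : IsTwistedLoopRealization m σ ζ u) (hm : 0 < m)
    (hζ : IsPrimitiveRoot ζ m) (hb : ∀ i, σ (b i) = ζ ^ p i • b i) {r : ℤ} {x : 𝔤}
    (hx : σ x = ζ ^ r • x) (i : ι) :
    (hu.basis hm hζ hb).repr (u r x) i = C (b.repr x i) * T ((r - p i) / m) := by
  rw [hu.apply_eq_sum hm hζ hb hx]
  simp only [← hu.basis_apply hm hζ hb]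
  rw [Module.Basis.repr_sum_self]

theorem killingForm_apply (hu : IsTwistedLoopRealization m σ ζ u) (hm : 0 < m)
    (hζ : IsPrimitiveRoot ζ m) (hb : ∀ i, σ (b i) = ζ ^ p i • b i) {r s : ℤ} {x y : 𝔤}
    (hx : σ x = ζ ^ r • x) (hy : σ y = ζ ^ s • y) :
    killingForm (LaurentPolynomial k) M (u r x) (u s y) =
      C (killingForm k 𝔤 x y) * T ((r + s) / m) := by
  have hlie : ∀ {r s : ℤ} {x y : 𝔤}, σ x = ζ ^ r • x → σ y = ζ ^ s • y →
      σ ⁅x, y⁆ = ζ ^ (r + s) • ⁅x, y⁆ := by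
    intro r s x y hx hy
    rw [LieEquiv.map_lie, hx, hy, smul_lie, lie_smul, smul_smul, zpow_add₀ (hζ.ne_zero hm.ne')]
  rw [killingForm_apply_apply, killingForm_apply_apply,
    LinearMap.trace_eq_matrix_trace _ (hu.basis hm hζ hb), LinearMap.trace_eq_matrix_trace _ b,
    Matrix.trace, Matrix.trace, map_sum, Finset.sum_mul]
  refine Finset.sum_congr rfl fun i _ => ?_
  simp only [Matrix.diag_apply, LinearMap.toMatrix_apply, LinearMap.comp_apply,
    LieAlgebra.ad_apply, basis_apply]
  rw [hu.lie _ _ _ _ hy (hb i), hu.lie _ _ _ _ hx (hlie hy (hb i)),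
    hu.basis_repr_apply hm hζ hb (hlie hx (hlie hy (hb i)))]
  congr 3
  ring

end Basis

end IsTwistedLoopRealization

theorem LieAlgebra.zpow_add_eq_one_of_killingForm_ne_zero {k 𝔤 : Type*} [Field k] [LieRing 𝔤]
    [LieAlgebra k 𝔤] (σ : 𝔤 ≃ₗ⁅k⁆ 𝔤) {ζ : k} (hζ : ζ ≠ 0) {r s : ℤ} {x y : 𝔤}
    (hx : σ x = ζ ^ r • x) (hy : σ y = ζ ^ s • y) (h : killingForm k 𝔤 x y ≠ 0) :
    ζ ^ (r + s) = 1 := by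
  have h1 := LieAlgebra.killingForm_of_equiv_apply σ x y
  rw [hx, hy, map_smul, map_smul, LinearMap.smul_apply, smul_eq_mul, smul_eq_mul, ← mul_assoc,
    ← zpow_add₀ hζ, add_comm] at h1
  exact mul_right_cancel₀ h (by rw [h1, one_mul])

/-- A Killing-dual family to an eigenbasis consists of eigenvectors for the inverse eigenvalues. -/
theorem LieAlgebra.IsKilling.apply_dualBasis_eq_zpow_neg_smul {k 𝔤 ι : Type*} [Field k]
    [LieRing 𝔤] [LieAlgebra k 𝔤] [Fintype ι] [DecidableEq ι]
    (hκ : (killingForm k 𝔤).Nondegenerate) (σ : 𝔤 ≃ₗ⁅k⁆ 𝔤) {ζ : k} (hζ : ζ ≠ 0)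
    {b : Module.Basis ι k 𝔤} {p : ι → ℤ} (hb : ∀ i, σ (b i) = ζ ^ p i • b i)
    {b' : ι → 𝔤} (hb' : ∀ i j, killingForm k 𝔤 (b' i) (b j) = if i = j then 1 else 0) (i : ι) :
    σ (b' i) = ζ ^ (-p i) • b' i := by
  have hinj : Function.Injective (killingForm k 𝔤) := 
    LinearMap.ker_eq_bot.mp (LinearMap.separatingLeft_iff_ker_eq_bot.mp hκ.1)
  refine hinj (b.ext fun j => ?_)
  have h := LieAlgebra.killingForm_of_equiv_apply σ (b' i) (b j)
  rw [hb, map_smul, smul_eq_mul, hb'] at h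
  refine mul_left_cancel₀ (zpow_ne_zero (p j) hζ) (h.trans ?_)
  rw [map_smul, LinearMap.smul_apply, hb', smul_eq_mul]
  split_ifs with hij
  · rw [hij, mul_one, ← zpow_add₀ hζ, add_neg_cancel, zpow_zero]
  · simp

namespace IsTwistedLoopRealization

variable {k 𝔤 M : Type*} [Field k] [LieRing 𝔤] [LieAlgebra k 𝔤] [LieRing M]
  [LieAlgebra (LaurentPolynomial k) M] [LieAlgebra k M] [IsScalarTower k (LaurentPolynomial k) M]
  {m : ℕ} {σ : 𝔤 ≃ₗ⁅k⁆ 𝔤} {ζ : k} {u : ℤ → 𝔤 →ₗ[k] M}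

/-- Derivations of a twisted loop algebra that are linear over the Laurent polynomials are
inner. -/
theorem exists_eq_lie [IsAlgClosed k] [CharZero k] [FiniteDimensional k 𝔤]
    (hκ : (killingForm k 𝔤).Nondegenerate)
    (hu : IsTwistedLoopRealization m σ ζ u) (hm : 0 < m) (hσ : ∀ y : 𝔤, (⇑σ)^[m] y = y)
    (hζ : IsPrimitiveRoot ζ m) (δ : LieDerivation (LaurentPolynomial k) M M) :
    ∃ z : M, ∀ x, δ x = ⁅z, x⁆ := by
  obtain ⟨n, b, p, hb⟩ := exists_eigenbasis_of_iterate_eq hm (σ : 𝔤 →ₗ[k] 𝔤) hσ hζ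
  replace hb : ∀ i, σ (b i) = ζ ^ p i • b i := hb
  let b' := LinearMap.BilinForm.dualBasis (killingForm k 𝔤) hκ b
  have hb' : ∀ i j, killingForm k 𝔤 (b' i) (b j) = if i = j then 1 else 0 := by
    intro i j
    rw [LinearMap.BilinForm.apply_dualBasis_left]
    simp only [eq_comm]
  have hσb' : ∀ i, σ (b' i) = ζ ^ (-p i) • b' i :=
    LieAlgebra.IsKilling.apply_dualBasis_eq_zpow_neg_smul hκ σ (hζ.ne_zero hm.ne') hb hb'
  refine LieDerivation.exists_eq_lie_of_killingForm_dual (hu.basis hm hζ hb)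
    (fun i => u (-p i) (b' i)) (fun i j => ?_) δ
  rw [basis_apply, hu.killingForm_apply hm hζ hb (hσb' i) (hb j), hb']
  split_ifs with hij <;> simp [hij]

/-- The constant coefficient of the Killing form of a twisted loop algebra. -/
theorem coeff_zero_killingForm [IsAlgClosed k] [CharZero k] [FiniteDimensional k 𝔤]
    (hu : IsTwistedLoopRealization m σ ζ u) (hm : 0 < m) (hσ : ∀ y : 𝔤, (⇑σ)^[m] y = y)
    (hζ : IsPrimitiveRoot ζ m) {r s : ℤ} {x y : 𝔤}
    (hx : σ x = ζ ^ r • x) (hy : σ y = ζ ^ s • y) :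
    (killingForm (LaurentPolynomial k) M (u r x) (u s y)).coeff 0 =
      if r + s = 0 then killingForm k 𝔤 x y else 0 := by
  obtain ⟨n, b, p, hb⟩ := exists_eigenbasis_of_iterate_eq hm (σ : 𝔤 →ₗ[k] 𝔤) hσ hζ
  replace hb : ∀ i, σ (b i) = ζ ^ p i • b i := hb
  rw [hu.killingForm_apply hm hζ hb hx hy, LaurentPolynomial.coeff_C_mul_T]
  by_cases h : killingForm k 𝔤 x y = 0
  · simp [h]
  · have hdvd := (hζ.zpow_eq_one_iff_dvd _).mp
      (LieAlgebra.zpow_add_eq_one_of_killingForm_ne_zero σ (hζ.ne_zero hm.ne') hx hy h)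
    have hiff : (r + s) / (m : ℤ) = 0 ↔ r + s = 0 :=
      ⟨fun h0 => by rw [← Int.ediv_mul_cancel hdvd, h0, zero_mul], fun h0 => by simp [h0]⟩
    simp only [hiff]

/-- If `D` is a derivation of a twisted loop algebra with `D (u p y) = p • u p y`, then conjugating
`D` by an automorphism that is linear over the Laurent polynomials changes it by an inner
derivation. -/
theorem exists_conj_eq_add_lie [IsAlgClosed k] [CharZero k] [FiniteDimensional k 𝔤]
    (hκ : (killingForm k 𝔤).Nondegenerate)
    (hu : IsTwistedLoopRealization m σ ζ u) (hm : 0 < m) (hσ : ∀ y : 𝔤, (⇑σ)^[m] y = y)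
    (hζ : IsPrimitiveRoot ζ m) (D : LieDerivation k M M)
    (hD : ∀ (p : ℤ) (y : 𝔤), σ y = ζ ^ p • y → D (u p y) = (p : k) • u p y)
    (f : M ≃ₗ⁅LaurentPolynomial k⁆ M) : ∃ z : M, ∀ x, D (f x) = f (D x + ⁅z, x⁆) := by
  have hfk : ∀ (a : k) x, f (a • x) = a • f x := fun a x => by
    rw [← algebraMap_smul (LaurentPolynomial k) a x, map_smul, algebraMap_smul]
  have hT : ∀ (n : ℤ) x, D ((T n : LaurentPolynomial k) • x) =
      (T n : LaurentPolynomial k) • ((n * m : k) • x + D x) := by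
    intro n x
    refine hu.induction (P := fun x => D ((T n : LaurentPolynomial k) • x) =
      (T n : LaurentPolynomial k) • ((n * m : k) • x + D x)) ?_ (fun x y hx hy => ?_)
      (fun p y hy => ?_) x
    · simp
    · rw [smul_add, map_add, hx, hy, map_add, ← smul_add]
      congr 1
      module
    · have hy' : σ y = ζ ^ (p + n * m) • y := by rw [zpow_add_mul_eq hm hζ, hy]
      rw [hu.T_smul hm hζ n p hy, hD _ _ hy', hD _ _ hy, ← add_smul,
        ← algebraMap_smul (LaurentPolynomial k) (_ : k) (u p y), smul_comm, algebraMap_smul,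
        hu.T_smul hm hζ n p hy]
      push_cast
      rw [add_comm]
  let δ₀ : M → M := fun x => f.symm (D (f x)) - D x
  have hδ₀ : ∀ (a : k) (n : ℤ) x, δ₀ ((C a * T n : LaurentPolynomial k) • x) =
      (C a * T n : LaurentPolynomial k) • δ₀ x := by
    intro a n x
    have hCk : ∀ y : M, (C a : LaurentPolynomial k) • y = a • y := fun y => algebraMap_smul _ a y
    have hcomm : ∀ y : M, D ((C a : LaurentPolynomial k) • y) = (C a : LaurentPolynomial k) • D y :=
      fun y => by rw [hCk, hCk, map_smul]
    simp only [δ₀, mul_smul, map_smul, hcomm, hT, map_add, ← hfk, LieEquiv.symm_apply_apply]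
    rw [← smul_sub, ← smul_sub]
    congr 2
    abel
  have hδadd : ∀ x y, δ₀ (x + y) = δ₀ x + δ₀ y := by
    intro x y
    simp only [δ₀, map_add]
    abel
  let δ : LieDerivation (LaurentPolynomial k) M M :=
    { toFun := δ₀
      map_add' := hδadd
      map_smul' := by
        intro r x
        change δ₀ (r • x) = r • δ₀ x
        induction r using LaurentPolynomial.induction_on' with
        | add r r' hr hr' => rw [add_smul, hδadd, hr, hr', add_smul]
        | C_mul_T n a => exact hδ₀ a n x
      leibniz' := by
        intro x y
        change δ₀ ⁅x, y⁆ = ⁅x, δ₀ y⁆ - ⁅y, δ₀ x⁆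
        simp only [δ₀, LieEquiv.map_lie, LieDerivation.apply_lie_eq_sub, map_sub, lie_sub,
          LieEquiv.symm_apply_apply]
        abel }
  obtain ⟨z, hz⟩ := hu.exists_eq_lie hκ hm hσ hζ δ
  refine ⟨z, fun x => ?_⟩
  rw [← hz x]
  change D (f x) = f (D x + (f.symm (D (f x)) - D x))
  rw [add_sub_cancel, LieEquiv.apply_symm_apply]

end IsTwistedLoopRealization

/-- Every `R`-linear automorphism `f` of the twisted loop algebra
`L(𝔤,σ)` lifts to a `k`-Lie automorphism `φ` of `L̂(𝔤,σ)` preserving the derived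
subalgebra `L̃(𝔤,σ) = L(𝔤,σ) ⊕ kc` and inducing `f` on `L(𝔤,σ) ≅ L̃(𝔤,σ)/kc`. -/
theorem lift_R_automorphism
    -- the base field
    (k : Type) [Field k] [IsAlgClosed k] [CharZero k]
    -- the simple finite-dimensional Lie algebra 𝔤
    (𝔤 : Type) [LieRing 𝔤] [LieAlgebra k 𝔤] [FiniteDimensional k 𝔤]
    [LieAlgebra.IsSimple k 𝔤]
    -- the order m of σ and a primitive m-th root of unity ζ
    (m : ℕ) (hm : 0 < m)
    (σ : 𝔤 ≃ₗ⁅k⁆ 𝔤) (hσ : ∀ y : 𝔤, (⇑σ)^[m] y = y)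
    (ζ : k) (hζ : IsPrimitiveRoot ζ m)
    -- the twisted loop algebra L(𝔤,σ) = ⊕_{i∈ℤ} 𝔤_ī ⊗ sⁱ, an R-Lie algebra for
    -- R = k[t^{±1}] = LaurentPolynomial k (with t = sᵐ);
    -- `u p y` represents `y ⊗ sᵖ` for `y ∈ 𝔤_p̄`, i.e. `σ y = ζ^p • y`
    (Lg : Type) [LieRing Lg] [LieAlgebra (LaurentPolynomial k) Lg]
    [LieAlgebra k Lg] [IsScalarTower k (LaurentPolynomial k) Lg]
    (u : ℤ → 𝔤 →ₗ[k] Lg)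
    (hu_bracket : ∀ (p q : ℤ) (y z : 𝔤), σ y = ζ ^ p • y → σ z = ζ ^ q • z →
      ⁅u p y, u q z⁆ = u (p + q) ⁅y, z⁆)
    (hu_t : ∀ (p : ℤ) (y : 𝔤), σ y = ζ ^ p • y →
      (T 1 : LaurentPolynomial k) • u p y = u (p + (m : ℤ)) y)
    (hu_span : ∀ l : Lg, ∃ f : ℤ →₀ 𝔤, (∀ i, σ (f i) = ζ ^ i • f i) ∧
      l = f.sum fun i yi => u i yi)
    (hu_ind : ∀ f : ℤ →₀ 𝔤, (∀ i, σ (f i) = ζ ^ i • f i) →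
      (f.sum fun i yi => u i yi) = 0 → f = 0)
    -- the twisted affine Kac–Moody algebra L̂(𝔤,σ) = L(𝔤,σ) ⊕ kc ⊕ kd
    (Lhat : Type) [LieRing Lhat] [LieAlgebra k Lhat]
    (c d : Lhat) (ι : Lg →ₗ[k] Lhat)
    (hc : ∀ z : Lhat, ⁅c, z⁆ = 0)
    (hd : ∀ (p : ℤ) (y : 𝔤), σ y = ζ ^ p • y →
      ⁅d, ι (u p y)⁆ = (p : k) • ι (u p y))
    (hbr : ∀ (p q : ℤ) (y z : 𝔤), σ y = ζ ^ p • y → σ z = ζ ^ q • z →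
      ⁅ι (u p y), ι (u q z)⁆ =
        ι (u (p + q) ⁅y, z⁆) +
          (if p + q = 0 then (p : k) * killingForm k 𝔤 y z else 0) • c)
    (hdec : ∀ z : Lhat, ∃ (l : Lg) (a b : k), z = ι l + a • c + b • d)
    (huniq : ∀ (l : Lg) (a b : k), ι l + a • c + b • d = 0 → l = 0 ∧ a = 0 ∧ b = 0)
    -- an automorphism of L(𝔤,σ) as an R-Lie algebra
    (f : Lg ≃ₗ⁅LaurentPolynomial k⁆ Lg) :
    ∃ φ : Lhat ≃ₗ⁅k⁆ Lhat,
      (∀ z ∈ (LinearMap.range ι ⊔ Submodule.span k {c} : Submodule k Lhat),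
        φ z ∈ (LinearMap.range ι ⊔ Submodule.span k {c} : Submodule k Lhat)) ∧
      ∀ l : Lg, ∃ μ : k, φ (ι l) = ι (f l) + μ • c := by
  have hu : IsTwistedLoopRealization m σ ζ u := ⟨hu_bracket, hu_t, hu_span, hu_ind⟩
  have hκ : (killingForm k 𝔤).Nondegenerate := LieAlgebra.IsKilling.killingForm_nondegenerate k 𝔤
  have hιinj : Function.Injective ι := (injective_iff_map_eq_zero ι).mpr fun l hl =>
    (huniq l 0 0 (by simp [hl])).1
  have hdι : ∀ l, ∃ x, ι x = ⁅d, ι l⁆ := fun l => by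
    refine hu.induction (P := fun l => ∃ x, ι x = ⁅d, ι l⁆) ⟨0, by simp⟩ ?_
      (fun p y hy => ⟨(p : k) • u p y, by rw [hd p y hy, map_smul]⟩) l
    rintro x y ⟨x', hx⟩ ⟨y', hy⟩
    exact ⟨x' + y', by rw [map_add, hx, hy, map_add, lie_add]⟩
  choose D₀ hD₀ using hdι
  let D₁ : Lg →ₗ[k] Lg :=
    { toFun := D₀
      map_add' := fun x y => hιinj (by rw [hD₀, map_add, map_add, hD₀, hD₀, lie_add])
      map_smul' := fun a x => hιinj (by
        rw [hD₀, map_smul, RingHom.id_apply, map_smul, hD₀, lie_smul]) }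
  have hD₁ : ∀ l, ⁅d, ι l⁆ = ι (D₁ l) := fun l => (hD₀ l).symm
  have hD₁u : ∀ (p : ℤ) (y : 𝔤), σ y = ζ ^ p • y → D₁ (u p y) = (p : k) • u p y :=
    fun p y hy => hιinj (by rw [← hD₁, hd p y hy, map_smul])
  have hB : ∀ (a : k) (x y : Lg), killingForm k[T;T⁻¹] Lg (a • x) y =
      a • killingForm k[T;T⁻¹] Lg x y := fun a x y => by
    rw [← algebraMap_smul k[T;T⁻¹] a x, map_smul, LinearMap.smul_apply, algebraMap_smul]
  let β : Lg →ₗ[k] Lg →ₗ[k] k :=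
    LinearMap.mk₂ k (fun x y => (killingForm k[T;T⁻¹] Lg x y).coeff 0)
      (fun x x' y => by simp) (fun a x y => by rw [hB]; simp)
      (fun x y y' => by simp) (fun a x y => by
        rw [LieModule.traceForm_comm, hB, LieModule.traceForm_comm]; simp)
  have hβ : ∀ x y, β x y = (killingForm k[T;T⁻¹] Lg x y).coeff 0 := fun _ _ => rfl
  have hι : ∀ x y, ⁅ι x, ι y⁆ = ι ⁅x, y⁆ + β (D₁ x) y • c := by
    intro x y
    refine hu.induction (P := fun x => ⁅ι x, ι y⁆ = ι ⁅x, y⁆ + β (D₁ x) y • c) (by simp) ?_ ?_ x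
    · intro x x' h h'
      simp only [map_add, add_lie, LinearMap.add_apply, h, h']
      module
    intro p x hx
    refine hu.induction (P := fun y => ⁅ι (u p x), ι y⁆ = ι ⁅u p x, y⁆ + β (D₁ (u p x)) y • c)
      (by simp) ?_ ?_ y
    · intro y y' h h'
      simp only [map_add, lie_add, h, h']
      module
    intro q y hy
    rw [hbr p q x y hx hy, hu_bracket p q x y hx hy, hD₁u p x hx, map_smul, LinearMap.smul_apply,
      hβ, hu.coeff_zero_killingForm hm hσ hζ hx hy, smul_eq_mul, mul_ite, mul_zero]
  have hleib : ∀ x y, D₁ ⁅x, y⁆ = ⁅D₁ x, y⁆ + ⁅x, D₁ y⁆ := by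
    intro x y
    have h : ⁅d, ⁅ι x, ι y⁆⁆ = ⁅⁅d, ι x⁆, ι y⁆ + ⁅ι x, ⁅d, ι y⁆⁆ := leibniz_lie _ _ _
    have hdc : ⁅d, c⁆ = 0 := by rw [← lie_skew, hc, neg_zero]
    rw [hD₁, hD₁, hι, hι, hι, lie_add, lie_smul, hdc, smul_zero, add_zero, hD₁] at h
    refine sub_eq_zero.mp (huniq _ (-(β (D₁ (D₁ x)) y + β (D₁ x) (D₁ y))) 0 ?_).1
    rw [map_sub, h, map_add]
    module
  let D : LieDerivation k Lg Lg :=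
    { D₁ with
      leibniz' := fun x y => by
        change D₁ ⁅x, y⁆ = ⁅x, D₁ y⁆ - ⁅y, D₁ x⁆
        rw [hleib, ← lie_skew y, sub_neg_eq_add, add_comm] }
  obtain ⟨z, hz⟩ := hu.exists_conj_eq_add_lie hκ hm hσ hζ D hD₁u f
  let f' : Lg ≃ₗ⁅k⁆ Lg :=
    { f.toLinearEquiv.restrictScalars k with
      map_lie' := fun {x y} => f.map_lie x y }
  exact LieEquiv.exists_lift_of_conj_eq_add_inner hc hD₁ hι hdec huniq
    (fun x y z => by rw [hβ, hβ, LieModule.traceForm_apply_lie_apply])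
    (fun x y => by rw [hβ, hβ, LieModule.traceForm_comm]) f'
    (fun x y => by
      rw [hβ, hβ]
      exact congrArg (fun r : k[T;T⁻¹] => r.coeff 0)
        (LieAlgebra.killingForm_of_equiv_apply f x y)) z hz
end
end
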